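/- Let M₁ and M₂ be closed oriented aspherical manifolds of dimension n ≥ 4 with H₂(M₁; ℚ) ≠ 0 and H₂(M₂; ℚ) ≠ 0. Then TC(M₁ # M₂) ≥ 6 if n is odd, and TC(M₁ # M₂) ≥ 7 if n is even. -/

import Mathlib

/-!
Common definitions: rational singular (co)homology, homotopy groups and asphericity,
classifying maps, closed oriented manifolds, connected sums, wedges, topological
complexity, sectional category weights, and (a)toroidal classes.
-/

open CategoryTheory unitInterval Topology

noncomputable section

/-- The singular chain complex with rational coefficients. -/
def singularChainComplex : TopCat.{0} ⥤ ChainComplex (ModuleCat.{0} ℚ) ℕ :=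
  TopCat.toSSet ⋙ ((SimplicialObject.whiskering _ _).obj (ModuleCat.free ℚ)) ⋙
    AlgebraicTopology.alternatingFaceMapComplex (ModuleCat ℚ)

/-- The `k`-th singular homology functor with rational coefficients. -/
def singularHomologyFunctor (k : ℕ) : TopCat.{0} ⥤ ModuleCat.{0} ℚ :=
  singularChainComplex ⋙ HomologicalComplex.homologyFunctor (ModuleCat ℚ) (ComplexShape.down ℕ) k

/-- `H k X` is the `k`-th rational singular homology group `H_k(X; ℚ)`. -/
abbrev H (k : ℕ) (X : Type) [TopologicalSpace X] : Type :=
  (singularHomologyFunctor k).obj (TopCat.of X)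

/-- The map `H_k(f; ℚ)` induced on rational singular homology by a continuous map `f`. -/
def Hmap (k : ℕ) {X Y : Type} [TopologicalSpace X] [TopologicalSpace Y] (f : C(X, Y)) :
    H k X →ₗ[ℚ] H k Y :=
  ((singularHomologyFunctor k).map (TopCat.ofHom f : TopCat.of X ⟶ TopCat.of Y)).hom

/-- `Hco k X` is the `k`-th rational singular cohomology group `H^k(X; ℚ)`; over the
field `ℚ`, universal coefficients identify it naturally with the dual of homology. -/
abbrev Hco (k : ℕ) (X : Type) [TopologicalSpace X] : Type :=
  Module.Dual ℚ (H k X)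

/-- The map `H^k(f; ℚ)` induced on rational singular cohomology (the Kronecker-dual
of the map induced on homology). -/
def Hcomap (k : ℕ) {X Y : Type} [TopologicalSpace X] [TopologicalSpace Y] (f : C(X, Y)) :
    Hco k Y →ₗ[ℚ] Hco k X :=
  (Hmap k f).dualMap

/-- Transport of a cohomology class along an equality of degrees. -/
def coCast {X : Type} [TopologicalSpace X] {p q : ℕ} (h : p = q) :
    Hco p X →ₗ[ℚ] Hco q X := by
  subst h; exact LinearMap.id

/-- A non-zero element spanning a rational vector space (necessarily one-dimensional);
this characterises fundamental classes in the top (co)homology of closed connected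
oriented manifolds with rational coefficients. -/
def IsGenerator {W : Type} [AddCommGroup W] [Module ℚ W] (w : W) : Prop :=
  w ≠ 0 ∧ ∀ v : W, ∃ c : ℚ, v = c • w

/-- `π₂(X) = 0`. -/
def Pi2Trivial (X : Type) [TopologicalSpace X] : Prop :=
  ∀ x : X, Subsingleton (HomotopyGroup (Fin 2) X x)

/-- A space is aspherical iff all its homotopy groups in degrees `≥ 2` vanish
(for manifolds this is equivalent to contractibility of the universal cover). -/
def Aspherical (X : Type) [TopologicalSpace X] : Prop :=
  ∀ k : ℕ, 2 ≤ k → ∀ x : X, Subsingleton (HomotopyGroup (Fin k) X x)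

/-- A continuous map, regarded as a morphism in `TopCat`. -/
def toTopHom {X Y : Type} [TopologicalSpace X] [TopologicalSpace Y] (f : C(X, Y)) :
    TopCat.of X ⟶ TopCat.of Y := TopCat.ofHom f

/-- The homomorphism induced by a continuous map on fundamental groups. -/
def π₁map {X Y : Type} [TopologicalSpace X] [TopologicalSpace Y] (f : C(X, Y)) (x : X) :
    FundamentalGroup X x →* FundamentalGroup Y (f x) :=
  Functor.mapEnd (X := FundamentalGroupoid.mk x)
    (show FundamentalGroupoid X ⥤ FundamentalGroupoid Y from
      FundamentalGroupoid.fundamentalGroupoidFunctor.map (toTopHom f))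

/-- `B` is a model for an Eilenberg–MacLane space `K(G, 1)`:  it is path-connected and
all its higher homotopy groups vanish. -/
def IsAsphericalSpace (B : Type) [TopologicalSpace B] : Prop :=
  PathConnectedSpace B ∧ Aspherical B

/-- `c : M → B` is a classifying map for `M`, i.e. `B` is a model for `Bπ₁(M)`
(path-connected with vanishing higher homotopy groups) and `c` induces an isomorphism
on fundamental groups. -/
def IsClassifyingMap {M B : Type} [TopologicalSpace M] [TopologicalSpace B]
    (c : C(M, B)) : Prop :=
  IsAsphericalSpace B ∧ ∀ x : M, Function.Bijective (π₁map c x)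

/-- Every point has a neighbourhood homeomorphic to `ℝⁿ`. -/
def IsLocallyEuclidean (n : ℕ) (M : Type) [TopologicalSpace M] : Prop :=
  ∀ x : M, ∃ U : Set M, x ∈ U ∧ IsOpen U ∧ Nonempty (U ≃ₜ EuclideanSpace ℝ (Fin n))

/-- A closed connected oriented topological `n`-manifold.  (For a closed connected
`n`-manifold, orientability is equivalent to `H_n(M; ℚ) ≠ 0`.) -/
def IsClosedOrientedManifold (n : ℕ) (M : Type) [TopologicalSpace M] : Prop :=
  CompactSpace M ∧ T2Space M ∧ SecondCountableTopology M ∧ ConnectedSpace M ∧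
    IsLocallyEuclidean n M ∧ Nontrivial (H n M)

/-- Data exhibiting `N` as a connected sum `M₁ # M₂` of `n`-manifolds:  `N` is covered by
two closed pieces `C₁`, `C₂`, homeomorphic to `M₁` resp. `M₂` with an embedded open ball
removed, which overlap exactly along the boundary spheres.  (Gluing along any
homeomorphism of the sphere yields a space homeomorphic to the connected sum.) -/
structure ConnectedSumData (n : ℕ) (N M₁ M₂ : Type) [TopologicalSpace N]
    [TopologicalSpace M₁] [TopologicalSpace M₂] where
  φ₁ : EuclideanSpace ℝ (Fin n) → M₁
  φ₂ : EuclideanSpace ℝ (Fin n) → M₂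
  emb₁ : IsOpenEmbedding φ₁
  emb₂ : IsOpenEmbedding φ₂
  C₁ : Set N
  C₂ : Set N
  closed₁ : IsClosed C₁
  closed₂ : IsClosed C₂
  cover : C₁ ∪ C₂ = Set.univ
  h₁ : C₁ ≃ₜ ((φ₁ '' Metric.ball 0 1)ᶜ : Set M₁)
  h₂ : C₂ ≃ₜ ((φ₂ '' Metric.ball 0 1)ᶜ : Set M₂)
  inter₁ : ∀ x : C₁, (x : N) ∈ C₂ ↔ ((h₁ x : M₁) ∈ φ₁ '' Metric.sphere 0 1)
  inter₂ : ∀ x : C₂, (x : N) ∈ C₁ ↔ ((h₂ x : M₂) ∈ φ₂ '' Metric.sphere 0 1)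

/-- `N` is a connected sum of `M₁` and `M₂` (as `n`-manifolds). -/
def IsConnectedSum (n : ℕ) (N M₁ M₂ : Type) [TopologicalSpace N]
    [TopologicalSpace M₁] [TopologicalSpace M₂] : Prop :=
  Nonempty (ConnectedSumData n N M₁ M₂)

/-- The degree-one pinch map `N = M₁ # M₂ → M₁`:  it restricts to the canonical
identification on the `M₁`-piece and sends the `M₂`-piece into the closed ball. -/
def ConnectedSumData.IsPinchFst {n : ℕ} {N M₁ M₂ : Type} [TopologicalSpace N]
    [TopologicalSpace M₁] [TopologicalSpace M₂] (D : ConnectedSumData n N M₁ M₂)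
    (p : C(N, M₁)) : Prop :=
  (∀ x : D.C₁, p (x : N) = (D.h₁ x : M₁)) ∧
    ∀ x : D.C₂, p (x : N) ∈ D.φ₁ '' Metric.closedBall 0 1

/-- The degree-one pinch map `N = M₁ # M₂ → M₂`. -/
def ConnectedSumData.IsPinchSnd {n : ℕ} {N M₁ M₂ : Type} [TopologicalSpace N]
    [TopologicalSpace M₁] [TopologicalSpace M₂] (D : ConnectedSumData n N M₁ M₂)
    (p : C(N, M₂)) : Prop :=
  (∀ x : D.C₂, p (x : N) = (D.h₂ x : M₂)) ∧
    ∀ x : D.C₁, p (x : N) ∈ D.φ₂ '' Metric.closedBall 0 1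

/-- `N` is an iterated connected sum `M 0 # M 1 # ⋯ # M (m-1)` of `n`-manifolds. -/
def IsIteratedConnectedSum (n : ℕ) (N : Type) [TopologicalSpace N] :
    (m : ℕ) → (Fin m → TopCat.{0}) → Prop
  | 0, _ => False
  | 1, M => Nonempty (N ≃ₜ (M 0))
  | (m + 2), M =>
      ∃ P : TopCat.{0}, IsIteratedConnectedSum n P (m + 1) (fun i => M i.castSucc) ∧
        IsConnectedSum n N P (M (Fin.last (m + 1)))

/-- `W` is the wedge (one-point union) of the pointed spaces `(M₁, x₁)` and `(M₂, x₂)`. -/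
def IsWedge (W M₁ M₂ : Type) [TopologicalSpace W] [TopologicalSpace M₁]
    [TopologicalSpace M₂] (x₁ : M₁) (x₂ : M₂) : Prop :=
  ∃ (j₁ : C(M₁, W)) (j₂ : C(M₂, W)), IsClosedEmbedding j₁ ∧ IsClosedEmbedding j₂ ∧
    Set.range j₁ ∪ Set.range j₂ = Set.univ ∧
    Set.range j₁ ∩ Set.range j₂ = {j₁ x₁} ∧ j₁ x₁ = j₂ x₂

/-- `X × X` admits a cover by `m` open sets over each of which there is a continuous
motion planning rule (a continuous local section of the free path fibration). -/
def TCCoverable (X : Type) [TopologicalSpace X] (m : ℕ) : Prop :=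
  ∃ U : Fin m → Set (X × X), (∀ i, IsOpen (U i)) ∧ (⋃ i, U i) = Set.univ ∧
    ∀ i, ∃ s : C(U i, C(I, X)),
      ∀ p : U i, (s p) 0 = (p : X × X).1 ∧ (s p) 1 = (p : X × X).2

/-- The (unreduced) topological complexity of `X`:  the smallest number of open sets in a
cover of `X × X` admitting continuous motion planning rules (`⊤` if there is none). -/
def topologicalComplexity (X : Type) [TopologicalSpace X] : ℕ∞ :=
  sInf {c : ℕ∞ | ∃ m : ℕ, c = m ∧ TCCoverable X m}

/-- The free path fibration `X^{[0,1]} → X × X`, `γ ↦ (γ(0), γ(1))`. -/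
def pathFibration (X : Type) [TopologicalSpace X] : C(C(I, X), X × X) :=
  ⟨fun γ => (γ 0, γ 1), (continuous_eval_const 0).prodMk (continuous_eval_const 1)⟩

/-- The Schwarz genus (sectional category) of the pullback of `p` along `f` is at most
`k`:  `Y` is covered by `k` open sets over each of which `f` lifts continuously
through `p`. -/
def GenusPullbackLE {E B : Type} [TopologicalSpace E] [TopologicalSpace B] (p : C(E, B))
    {Y : Type} [TopologicalSpace Y] (f : C(Y, B)) (k : ℕ) : Prop :=
  ∃ U : Fin k → Set Y, (∀ i, IsOpen (U i)) ∧ (⋃ i, U i) = Set.univ ∧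
    ∀ i, ∃ s : C(U i, E), ∀ y : U i, p (s y) = f (y : Y)

/-- The sectional category weight of a cohomology class `u` on the base of `p`:  the
supremum of those `m` such that `u` pulls back to zero along every map `f` for which
the pullback of `p` along `f` has Schwarz genus at most `m`. -/
def secatWeight {E B : Type} [TopologicalSpace E] [TopologicalSpace B] (p : C(E, B))
    {k : ℕ} (u : Hco k B) : ℕ∞ :=
  sSup {w : ℕ∞ | ∃ m : ℕ, w = m ∧ ∀ (Y : Type) [TopologicalSpace Y] (f : C(Y, B)),
    GenusPullbackLE p f m → Hcomap k f u = 0}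

/-- The topological complexity weight:  sectional category weight with respect to the
free path fibration. -/
def tcWeight {X : Type} [TopologicalSpace X] {k : ℕ} (u : Hco k (X × X)) : ℕ∞ :=
  secatWeight (pathFibration X) u

/-- The `n`-dimensional sphere. -/
abbrev unitSphere (n : ℕ) : Type :=
  ↥(Metric.sphere (0 : EuclideanSpace ℝ (Fin (n + 1))) 1)

/-- The 2-torus `T² = S¹ × S¹`. -/
abbrev Torus2 : Type := unitSphere 1 × unitSphere 1

/-- A degree-two rational homology class `v` is toroidal (relative to a fundamental class
`ωT` of the torus) if some map from the torus realises a non-zero multiple of `v`. -/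
def IsToroidal {X : Type} [TopologicalSpace X] (ωT : H 2 Torus2) (v : H 2 X) : Prop :=
  ∃ (f : C(Torus2, X)) (α : ℚ), α ≠ 0 ∧ Hmap 2 f ωT = α • v

/-- A non-zero degree-two rational homology class is atoroidal if it is not toroidal. -/
def IsAtoroidal {X : Type} [TopologicalSpace X] (ωT : H 2 Torus2) (v : H 2 X) : Prop :=
  v ≠ 0 ∧ ¬ IsToroidal ωT v

/-- A degree-two rational cohomology class `u` is toroidal if it pulls back non-trivially
under some map from the torus. -/
def IsCoToroidal {X : Type} [TopologicalSpace X] (u : Hco 2 X) : Prop :=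
  ∃ f : C(Torus2, X), Hcomap 2 f u ≠ 0

/-- A non-zero degree-two rational cohomology class is atoroidal if it pulls back to zero
under every map from the torus. -/
def IsCoAtoroidal {X : Type} [TopologicalSpace X] (u : Hco 2 X) : Prop :=
  u ≠ 0 ∧ ∀ f : C(Torus2, X), Hcomap 2 f u = 0

namespace TCSum

/-! ### Ordered chains on a set -/

/-- Rational ordered chains on a set: formal combinations of lists. -/
abbrev Ch (S : Type*) := List S →₀ ℚ

/-- The basis chain of a list. -/
abbrev bas {S : Type*} (l : List S) : Ch S := Finsupp.single l 1

/-- Linear extension of a function on a basis. -/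
abbrev ext {A C : Type*} [AddCommGroup C] [Module ℚ C] (f : A → C) : (A →₀ ℚ) →ₗ[ℚ] C :=
  Finsupp.linearCombination ℚ f

theorem ext_bas {A C : Type*} [AddCommGroup C] [Module ℚ C] (f : A → C) (a : A) :
    ext f (Finsupp.single a 1) = f a := by
  simp

theorem lin_ext {A C : Type*} [AddCommGroup C] [Module ℚ C] {f g : (A →₀ ℚ) →ₗ[ℚ] C}
    (h : ∀ a, f (Finsupp.single a 1) = g (Finsupp.single a 1)) : f = g := by
  apply Finsupp.lhom_ext'
  intro a
  ext
  simpa using h a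

variable {S T X : Type*}

/-- Prepending a vertex. -/
def cone (a : S) : Ch S →ₗ[ℚ] Ch S := ext fun l => bas (a :: l)

@[simp] theorem cone_bas (a : S) (l : List S) : cone a (bas l) = bas (a :: l) := ext_bas _ _

/-- The boundary of a list. -/
def dl : List S → Ch S
  | [] => 0
  | a :: l => bas l - cone a (dl l)

/-- The boundary of an ordered chain. -/
def d : Ch S →ₗ[ℚ] Ch S := ext dl

@[simp] theorem d_bas (l : List S) : d (bas l) = dl l := ext_bas _ _

theorem d_cone (a : S) (w : Ch S) : d (cone a w) = w - cone a (d w) := by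
  have : d ∘ₗ cone a = LinearMap.id - cone a ∘ₗ d := lin_ext fun l => by
    simp [dl]
  exact congrArg (fun f => f w) this

theorem d_dl (l : List S) : d (dl l) = 0 := by
  induction l with
  | nil => simp [dl]
  | cons a l ih => simp [dl, d_cone, ih]

@[simp] theorem d_d (w : Ch S) : d (d w) = 0 := by
  have : (d ∘ₗ d : Ch S →ₗ[ℚ] Ch S) = 0 := lin_ext fun l => by simp [d_dl]
  exact congrArg (fun f => f w) this

/-- The map of ordered chains induced by a map of sets. -/
def mp (f : S → T) : Ch S →ₗ[ℚ] Ch T := ext fun l => bas (l.map f)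

@[simp] theorem mp_bas (f : S → T) (l : List S) : mp f (bas l) = bas (l.map f) := ext_bas _ _

theorem mp_cone (f : S → T) (a : S) (w : Ch S) : mp f (cone a w) = cone (f a) (mp f w) := by
  have : mp f ∘ₗ cone a = cone (f a) ∘ₗ mp f := lin_ext fun l => by simp
  exact congrArg (fun f => f w) this

theorem mp_mp (f : S → T) (g : T → X) (w : Ch S) : mp g (mp f w) = mp (g ∘ f) w := by
  have : mp g ∘ₗ mp f = mp (g ∘ f) := lin_ext fun l => by simp
  exact congrArg (fun f => f w) this

theorem d_mp (f : S → T) (w : Ch S) : d (mp f w) = mp f (d w) := by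
  have : d ∘ₗ mp f = mp f ∘ₗ d := lin_ext fun l => by
    induction l with
    | nil => simp [dl]
    | cons a l ih =>
      simp only [LinearMap.comp_apply, mp_bas, d_bas] at ih ⊢
      simp [dl, mp_cone, ← ih]
  exact congrArg (fun f => f w) this

theorem dl_ofFn : ∀ (k : ℕ) (v : Fin (k + 1) → S),
    dl (List.ofFn v) = ∑ i : Fin (k + 1), (-1 : ℚ) ^ (i : ℕ) • bas (List.ofFn (v ∘ i.succAbove))
  | 0, v => by simp [dl]
  | k + 1, v => by
    rw [List.ofFn_succ, dl, dl_ofFn k, Fin.sum_univ_succ (n := k + 1)]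
    simp only [map_sum, map_smul, cone_bas, sub_eq_add_neg, ← Finset.sum_neg_distrib]
    congr 1
    · simp [Function.comp_def]
    · refine Finset.sum_congr rfl fun i _ => ?_
      simp only [Fin.val_succ, pow_succ, mul_neg, mul_one, neg_smul]
      congr 3
      rw [List.ofFn_succ]
      simp [Function.comp_def]

/-! ### Homogeneous parts -/

/-- Projection to the chains of length `k`. -/
def proj (k : ℕ) : Ch S →ₗ[ℚ] Ch S := ext fun l => if l.length = k then bas l else 0

theorem proj_bas (k : ℕ) (l : List S) :
    proj k (bas l) = if l.length = k then bas l else 0 := ext_bas _ _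

theorem proj_succ_cone (k : ℕ) (a : S) (w : Ch S) :
    proj (k + 1) (cone a w) = cone a (proj k w) := by
  have : proj (k + 1) ∘ₗ cone a = cone a ∘ₗ proj k := lin_ext fun l => by
    simp only [LinearMap.comp_apply, cone_bas, proj_bas, List.length_cons, Nat.add_right_cancel_iff]
    split_ifs <;> simp
  exact congrArg (fun f => f w) this

theorem proj_zero_cone (a : S) (w : Ch S) : proj 0 (cone a w) = 0 := by
  have : proj 0 ∘ₗ cone a = 0 := lin_ext fun l => by simp [proj_bas]
  exact congrArg (fun f => f w) this

theorem proj_dl (l : List S) : ∀ k, proj k (dl l) = if l.length = k + 1 then dl l else 0 := by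
  induction l with
  | nil => intro k; simp [dl]
  | cons a l ih =>
    rintro (_ | k)
    · rw [dl, map_sub, proj_zero_cone, proj_bas, sub_zero]
      by_cases h : l.length = 0
      · obtain rfl := List.length_eq_zero_iff.1 h
        simp [dl]
      · simp [h]
    · rw [dl, map_sub, proj_succ_cone, ih, proj_bas]
      by_cases h : l.length = k + 1 <;> simp [h]

theorem proj_d (k : ℕ) (w : Ch S) : proj k (d w) = d (proj (k + 1) w) := by
  have : (proj k ∘ₗ d : Ch S →ₗ[ℚ] Ch S) = d ∘ₗ proj (k + 1) := lin_ext fun l => by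
    simp only [LinearMap.comp_apply, d_bas, proj_dl, proj_bas]
    split_ifs <;> simp
  exact congrArg (fun f => f w) this

theorem proj_mp (k : ℕ) (f : S → T) (w : Ch S) : proj k (mp f w) = mp f (proj k w) := by
  have : proj k ∘ₗ mp f = mp f ∘ₗ proj k := lin_ext fun l => by
    simp only [LinearMap.comp_apply, mp_bas, proj_bas, List.length_map]
    split_ifs <;> simp
  exact congrArg (fun f => f w) this

/-! ### The prism operator -/

/-- The prism between two maps of sets, on a list. -/
def prl (f g : S → T) : List S → Ch T
  | [] => 0
  | a :: l => bas (f a :: g a :: l.map g) - cone (f a) (prl f g l)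

/-- The prism between two maps of sets. -/
def prism (f g : S → T) : Ch S →ₗ[ℚ] Ch T := ext (prl f g)

@[simp] theorem prism_bas (f g : S → T) (l : List S) : prism f g (bas l) = prl f g l := ext_bas _ _

theorem prism_cone (f g : S → T) (a : S) (w : Ch S) :
    prism f g (cone a w) = cone (f a) (cone (g a) (mp g w)) - cone (f a) (prism f g w) := by
  have : prism f g ∘ₗ cone a = cone (f a) ∘ₗ cone (g a) ∘ₗ mp g - cone (f a) ∘ₗ prism f g :=
    lin_ext fun l => by simp [prl]
  exact congrArg (fun f => f w) this

theorem d_prism (f g : S → T) (w : Ch S) :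
    d (prism f g w) = mp g w - mp f w - prism f g (d w) := by
  have : d ∘ₗ prism f g = mp g - mp f - prism f g ∘ₗ d := lin_ext fun l => by
    induction l with
    | nil => simp [prl, dl]
    | cons a l ih =>
      simp only [LinearMap.comp_apply, LinearMap.sub_apply, prism_bas, mp_bas, d_bas] at ih ⊢
      have e : dl (List.map g l) = mp g (dl l) := by rw [← d_bas, ← mp_bas, d_mp, d_bas]
      simp only [prl, dl, map_sub, d_cone, d_bas, prism_cone, ih, List.map_cons, prism_bas,
        cone_bas, e]
      abel
  exact congrArg (fun f => f w) this

theorem mp_prism (f g : S → T) (u : T → X) (w : Ch S) :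
    mp u (prism f g w) = prism (u ∘ f) (u ∘ g) w := by
  have : mp u ∘ₗ prism f g = prism (u ∘ f) (u ∘ g) := lin_ext fun l => by
    induction l with
    | nil => simp [prl]
    | cons a l ih =>
      simp only [LinearMap.comp_apply, prism_bas] at ih ⊢
      simp [prl, mp_cone, ih]
  exact congrArg (fun f => f w) this

theorem prism_mp (u : X → S) (f g : S → T) (w : Ch X) :
    prism f g (mp u w) = prism (f ∘ u) (g ∘ u) w := by
  have : prism f g ∘ₗ mp u = prism (f ∘ u) (g ∘ u) := lin_ext fun l => by
    induction l with
    | nil => simp [prl]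
    | cons a l ih =>
      simp only [LinearMap.comp_apply, prism_bas, mp_bas] at ih ⊢
      simp [prl, ih]
  exact congrArg (fun f => f w) this

/-! ### Alternating chains -/

/-- Two lists that differ by the exchange of two neighbours. -/
inductive AdjSwap : List S → List S → Prop
  | swap (a b : S) (t : List S) : AdjSwap (a :: b :: t) (b :: a :: t)
  | cons (a : S) {l l' : List S} : AdjSwap l l' → AdjSwap (a :: l) (a :: l')

theorem AdjSwap.perm {l l' : List S} (h : AdjSwap l l') : l.Perm l' := by
  induction h with
  | swap a b t => exact List.Perm.swap _ _ _
  | cons a _ ih => exact ih.cons a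

variable (S) in
/-- The chains that vanish in the alternating quotient. -/
def Alt : Submodule ℚ (Ch S) :=
  Submodule.span ℚ {w | ∃ l l', AdjSwap l l' ∧ w = bas l + bas l'}

theorem alt_of_swap {l l' : List S} (h : AdjSwap l l') : bas l + bas l' ∈ Alt S :=
  Submodule.subset_span ⟨l, l', h, rfl⟩

theorem cone_mem_alt (a : S) {w : Ch S} (hw : w ∈ Alt S) : cone a w ∈ Alt S := by
  induction hw using Submodule.span_induction with
  | mem x hx =>
    obtain ⟨l, l', h, rfl⟩ := hx
    rw [map_add, cone_bas, cone_bas]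
    exact alt_of_swap (h.cons a)
  | zero => simp
  | add x y _ _ hx hy => rw [map_add]; exact add_mem hx hy
  | smul c x _ hx => rw [map_smul]; exact Submodule.smul_mem _ _ hx

theorem cone_cone_mem_alt (a b : S) (w : Ch S) :
    cone a (cone b w) + cone b (cone a w) ∈ Alt S := by
  induction w using Finsupp.induction_linear with
  | zero => simp
  | add f g hf hg =>
    have := add_mem hf hg
    simp only [map_add]
    convert this using 1
    abel
  | single l c =>
    have e : Finsupp.single l c = c • bas l := by simp
    simp only [e, map_smul, ← smul_add, cone_bas]
    exact Submodule.smul_mem _ _ (alt_of_swap (.swap a b l))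

theorem d_swap_mem_alt {l l' : List S} (h : AdjSwap l l') : dl l + dl l' ∈ Alt S := by
  induction h with
  | swap a b t =>
    have := cone_cone_mem_alt a b (dl t)
    simp only [dl, map_sub, cone_bas]
    convert this using 1
    abel
  | cons a h ih =>
    have := sub_mem (alt_of_swap h) (cone_mem_alt a ih)
    simp only [dl]
    convert this using 1
    rw [map_add]
    abel

theorem alt_of_perm {l l' : List S} (h : l.Perm l') :
    bas l - bas l' ∈ Alt S ∨ bas l + bas l' ∈ Alt S := by
  induction h with
  | nil => left; simp
  | cons a _ ih =>
    rcases ih with h | h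
    · left; simpa using cone_mem_alt a h
    · right; simpa using cone_mem_alt a h
  | swap a b t => right; exact alt_of_swap (.swap b a t)
  | trans _ _ h₁ h₂ =>
    rcases h₁ with h₁ | h₁ <;> rcases h₂ with h₂ | h₂
    · left; simpa using add_mem h₁ h₂
    · right; convert add_mem h₁ h₂ using 1; abel
    · right; convert sub_mem h₁ h₂ using 1; abel
    · left; convert sub_mem h₁ h₂ using 1; abel

theorem bas_mem_alt_of_not_nodup {l : List S} (h : ¬ l.Nodup) : bas l ∈ Alt S := by
  classical
  obtain ⟨a, ha⟩ : ∃ a, List.Duplicate a l := by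
    simpa [List.nodup_iff_forall_not_duplicate] using h
  rw [List.duplicate_iff_sublist] at ha
  obtain ⟨t, ht⟩ := ha.exists_perm_append
  have h2 : bas (a :: a :: t) ∈ Alt S := by
    have := Submodule.smul_mem _ (1 / 2 : ℚ) (alt_of_swap (.swap a a t))
    rw [← two_smul ℚ, smul_smul] at this
    simpa using this
  rcases alt_of_perm ht with h | h
  · simpa using add_mem h h2
  · simpa using sub_mem h h2

end TCSum

namespace TCSum
variable {S T X : Type*}

/-! ### Shuffle products -/

/-- The augmentation: coefficient of the empty list. -/
def aug : Ch S →ₗ[ℚ] ℚ := ext fun l => if l = [] then 1 else 0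

@[simp] theorem aug_bas (l : List S) : aug (bas l) = if l = [] then 1 else 0 := by
  rw [aug, ext_bas]

@[simp] theorem aug_cone (a : S) (w : Ch S) : aug (cone a w) = 0 := by
  have : aug ∘ₗ cone a = 0 := lin_ext fun l => by simp
  exact congrArg (fun f => f w) this

/-- The sign involution `(-1)^length`. -/
def sg : Ch S →ₗ[ℚ] Ch S := ext fun l => (-1 : ℚ) ^ l.length • bas l

@[simp] theorem sg_bas (l : List S) : sg (bas l) = (-1 : ℚ) ^ l.length • bas l := ext_bas _ _

theorem sg_cone (a : S) (w : Ch S) : sg (cone a w) = -cone a (sg w) := by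
  have : sg ∘ₗ cone a = -(cone a ∘ₗ sg) := lin_ext fun l => by
    simp only [LinearMap.comp_apply, LinearMap.neg_apply, cone_bas, sg_bas, List.length_cons,
      pow_succ, map_smul]
    simp
  exact congrArg (fun f => f w) this

theorem sg_sg (w : Ch S) : sg (sg w) = w := by
  have : (sg ∘ₗ sg : Ch S →ₗ[ℚ] Ch S) = LinearMap.id := lin_ext fun l => by
    simp only [LinearMap.comp_apply, sg_bas, map_smul, smul_smul, ← mul_pow]
    simp
  exact congrArg (fun f => f w) this

theorem aug_sg (w : Ch S) : aug (sg w) = aug w := by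
  have : (aug ∘ₗ sg : Ch S →ₗ[ℚ] ℚ) = aug := lin_ext fun l => by
    cases l <;> simp [-Finsupp.smul_single]
  exact congrArg (fun f => f w) this

theorem d_sg (w : Ch S) : d (sg w) = -sg (d w) := by
  have : (d ∘ₗ sg : Ch S →ₗ[ℚ] Ch S) = -(sg ∘ₗ d) := lin_ext fun l => by
    simp only [LinearMap.comp_apply, LinearMap.neg_apply, d_bas]
    induction l with
    | nil => simp [dl, -Finsupp.smul_single]
    | cons a l ih =>
      have e : (Finsupp.single (a :: l) 1 : Ch S) = cone a (bas l) := (cone_bas a l).symm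
      rw [e, sg_cone, map_neg, d_cone, ih, dl, map_sub, sg_cone, map_neg]
  exact congrArg (fun f => f w) this

/-- The shuffle product of two lists. -/
def shl : List S → List T → Ch (S × T)
  | [], _ => 0
  | _ :: _, [] => 0
  | s :: x, t :: y => cone (s, t)
      ((aug (bas x) * aug (bas y)) • bas [] + shl x (t :: y)
        + (-1 : ℚ) ^ x.length • shl (s :: x) y)
termination_by x y => x.length + y.length

/-- The shuffle product, a bilinear map. -/
def sh : Ch S →ₗ[ℚ] Ch T →ₗ[ℚ] Ch (S × T) := ext fun x => ext (shl x)

@[simp] theorem sh_bas (x : List S) (y : List T) : sh (bas x) (bas y) = shl x y := by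
  rw [sh, ext_bas, ext_bas]

theorem sh_nil_left (w : Ch T) : sh (bas ([] : List S)) w = 0 := by
  have : sh (bas ([] : List S)) = (0 : Ch T →ₗ[ℚ] _) := lin_ext fun l => by simp [shl]
  exact congrArg (fun f => f w) this

theorem sh_nil_right (w : Ch S) : sh w (bas ([] : List T)) = 0 := by
  have : sh.flip (bas ([] : List T)) = (0 : Ch S →ₗ[ℚ] _) := lin_ext fun l => by
    rw [LinearMap.flip_apply, sh_bas]
    cases l <;> simp [shl]
  exact congrArg (fun f => f w) this

theorem bilin_ext {A B C : Type*} [AddCommGroup C] [Module ℚ C]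
    {f g : (A →₀ ℚ) →ₗ[ℚ] (B →₀ ℚ) →ₗ[ℚ] C}
    (h : ∀ a b, f (Finsupp.single a 1) (Finsupp.single b 1)
      = g (Finsupp.single a 1) (Finsupp.single b 1)) : f = g :=
  lin_ext fun a => lin_ext fun b => h a b

theorem sh_cone (s : S) (t : T) (u : Ch S) (v : Ch T) :
    sh (cone s u) (cone t v) = cone (s, t)
      ((aug u * aug v) • bas [] + sh u (cone t v) + sh (cone s (sg u)) v) := by
  have : (sh ∘ₗ cone s).compl₂ (cone t) =
      (LinearMap.mk₂ ℚ (fun (u : Ch S) (v : Ch T) => (aug u * aug v) • bas ([] : List (S × T)))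
          (by intros; simp [add_mul, add_smul, -Finsupp.smul_single])
          (by intros; simp [mul_smul, -Finsupp.smul_single])
          (by intros; simp [mul_add, add_smul, -Finsupp.smul_single])
          (by intros; simp [mul_smul, mul_left_comm, -Finsupp.smul_single])
        + sh.compl₂ (cone t) + sh ∘ₗ cone s ∘ₗ sg).compr₂ (cone (s, t)) := bilin_ext fun x y => by
    simp only [LinearMap.compl₂_apply, LinearMap.comp_apply, cone_bas, sh_bas, LinearMap.compr₂_apply,
      LinearMap.add_apply, LinearMap.mk₂_apply, sg_bas, map_smul, LinearMap.smul_apply, shl]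
  exact congrArg (fun f => f u v) this

theorem d_shl (x : List S) (y : List T) :
    d (shl x y) = sh (dl x) (bas y) - sh (sg (bas x)) (dl y)
      + (aug (dl x) * aug (dl y)) • bas [] := by
  match x, y with
  | [], y => simp [shl, dl, sh_nil_left, -Finsupp.smul_single]
  | s :: u, [] => simp [shl, dl, sh_nil_right, -Finsupp.smul_single]
  | s :: u, t :: v =>
    have h1 := d_shl u (t :: v)
    have h2 := d_shl (s :: u) v
    have h2' : d (sh (cone s (sg (bas u))) (bas v)) = sh (d (cone s (sg (bas u)))) (bas v)
        - sh (sg (cone s (sg (bas u)))) (dl v)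
        + (aug (d (cone s (sg (bas u)))) * aug (dl v)) • bas [] := by
      rw [sg_bas, map_smul, cone_bas, map_smul, LinearMap.smul_apply, map_smul, sh_bas, h2]
      simp only [map_smul, LinearMap.smul_apply, d_bas, smul_add, smul_sub, smul_eq_mul, mul_assoc,
        mul_smul]
    rw [← sh_bas] at h1
    rw [← sh_bas, ← cone_bas s, ← cone_bas t, sh_cone, d_cone, map_add d, map_add d, h2',
      cone_bas t, h1]
    simp only [← d_bas, ← cone_bas, d_cone, map_sub, LinearMap.sub_apply, sh_cone, sg_cone, map_neg,
      LinearMap.neg_apply, d_sg, sg_sg, aug_cone, aug_sg, map_smul, map_add, sub_zero, sub_neg_eq_add,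
      LinearMap.add_apply]
    simp only [d_bas, dl, map_zero, smul_zero]
    rw [add_zero (aug (bas u))]
    generalize (aug (bas u) * aug (bas v)) • bas ([] : List (S × T)) = e1
    generalize (aug (dl u) * aug (bas v)) • cone (s, t) (bas []) = e2
    generalize (aug (bas u) * aug (dl v)) • cone (s, t) (bas []) = e3
    generalize cone (s, t) (sh (dl u) (cone t (bas v))) = e4
    generalize cone (s, t) (sh (sg (bas u)) (bas v)) = e5
    generalize cone (s, t) (sh (sg (bas u)) (cone t (dl v))) = e6
    generalize cone (s, t) (sh (cone s (sg (dl u))) (bas v)) = e7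
    generalize cone (s, t) (sh (cone s (bas u)) (dl v)) = e8
    generalize sh (bas u) (cone t (bas v)) = e9
    generalize sh (cone s (sg (bas u))) (bas v) = e10
    abel
termination_by x.length + y.length

theorem d_sh (u : Ch S) (v : Ch T) :
    d (sh u v) = sh (d u) v - sh (sg u) (d v) + (aug (d u) * aug (d v)) • bas [] := by
  have : (sh.compr₂ d : Ch S →ₗ[ℚ] Ch T →ₗ[ℚ] _) = sh ∘ₗ d - (sh ∘ₗ sg).compl₂ d +
      LinearMap.mk₂ ℚ (fun (u : Ch S) (v : Ch T) => (aug (d u) * aug (d v)) • bas ([] : List (S × T)))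
          (by intros; simp [add_mul, add_smul, -Finsupp.smul_single])
          (by intros; simp [mul_smul, -Finsupp.smul_single])
          (by intros; simp [mul_add, add_smul, -Finsupp.smul_single])
          (by intros; simp [mul_smul, mul_left_comm, -Finsupp.smul_single]) :=
    bilin_ext fun x y => by
      simp only [LinearMap.compl₂_apply, LinearMap.comp_apply, sh_bas, LinearMap.compr₂_apply,
        LinearMap.add_apply, LinearMap.mk₂_apply, LinearMap.sub_apply, d_bas, d_shl]
  exact congrArg (fun f => f u v) this

theorem mp_shl {S' T' : Type*} (f : S → S') (g : T → T') (x : List S) (y : List T) :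
    mp (Prod.map f g) (shl x y) = shl (x.map f) (y.map g) := by
  match x, y with
  | [], y => simp [shl]
  | s :: u, [] => simp [shl]
  | s :: u, t :: v =>
    have h1 := mp_shl f g u (t :: v)
    have h2 := mp_shl f g (s :: u) v
    simp only [List.map_cons] at h1 h2
    simp only [shl, mp_cone, map_add, map_smul, h1, h2, List.map_cons, mp_bas, aug_bas,
      List.map_eq_nil_iff, List.length_map, List.map_nil, Prod.map_apply]
termination_by x.length + y.length

theorem mp_sh {S' T' : Type*} (f : S → S') (g : T → T') (u : Ch S) (v : Ch T) :
    mp (Prod.map f g) (sh u v) = sh (mp f u) (mp g v) := by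
  have : (sh.compr₂ (mp (Prod.map f g)) : Ch S →ₗ[ℚ] Ch T →ₗ[ℚ] _) = (sh ∘ₗ mp f).compl₂ (mp g) :=
    bilin_ext fun x y => by simp [mp_shl]
  exact congrArg (fun f => f u v) this

/-- Chains all of whose members satisfy `P`. -/
def Supp {A : Type*} (P : A → Prop) : Submodule ℚ (A →₀ ℚ) :=
  Submodule.span ℚ {w | ∃ a, P a ∧ w = Finsupp.single a 1}

theorem bas_mem_supp {A : Type*} {P : A → Prop} {a : A} (h : P a) :
    Finsupp.single a 1 ∈ Supp P :=
  Submodule.subset_span ⟨a, h, rfl⟩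

theorem map_mem_of_supp {A C : Type*} [AddCommGroup C] [Module ℚ C] {P : A → Prop}
    {N : Submodule ℚ C} (L : (A →₀ ℚ) →ₗ[ℚ] C) (h : ∀ a, P a → L (Finsupp.single a 1) ∈ N)
    {w : A →₀ ℚ} (hw : w ∈ Supp P) : L w ∈ N := by
  have : Supp P ≤ N.comap L := Submodule.span_le.2 (by rintro _ ⟨a, ha, rfl⟩; exact h a ha)
  exact this hw

/-- Lists occurring in a shuffle product have entries from the two factors. -/
theorem shl_mem_supp (x : List S) (y : List T) :
    shl x y ∈ Supp fun l => ∀ p ∈ l, p.1 ∈ x ∧ p.2 ∈ y := by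
  match x, y with
  | [], y => simp [shl]
  | s :: u, [] => simp [shl]
  | s :: u, t :: v =>
    have h1 := shl_mem_supp u (t :: v)
    have h2 := shl_mem_supp (s :: u) v
    rw [shl]
    refine map_mem_of_supp (P := fun l => ∀ p ∈ l, p.1 ∈ s :: u ∧ p.2 ∈ t :: v) _
      (fun l hl => ?_) (add_mem (add_mem ?_ ?_) ?_)
    · rw [cone_bas]
      refine bas_mem_supp fun p hp => ?_
      rcases List.mem_cons.1 hp with rfl | hp
      · simp
      · exact hl p hp
    · exact Submodule.smul_mem _ _ (bas_mem_supp (by simp))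
    · refine map_mem_of_supp LinearMap.id (fun l hl => bas_mem_supp fun p hp => ?_) h1
      exact ⟨List.mem_cons_of_mem _ (hl p hp).1, (hl p hp).2⟩
    · refine Submodule.smul_mem _ _
        (map_mem_of_supp LinearMap.id (fun l hl => bas_mem_supp fun p hp => ?_) h2)
      exact ⟨(hl p hp).1, List.mem_cons_of_mem _ (hl p hp).2⟩
termination_by x.length + y.length

/-! ### Cup products -/

/-- Front face / back face pairing. -/
def ev (p : ℕ) (a b : List X → ℚ) : Ch X →ₗ[ℚ] ℚ :=
  ext fun l => a (l.take (p + 1)) * b (l.drop p)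

@[simp] theorem ev_bas (p : ℕ) (a b : List X → ℚ) (l : List X) :
    ev p a b (bas l) = a (l.take (p + 1)) * b (l.drop p) := ext_bas _ _

theorem ev_succ_cone (p : ℕ) (a b : List X → ℚ) (x : X) (w : Ch X) :
    ev (p + 1) a b (cone x w) = ev p (fun l => a (x :: l)) b w := by
  have : ev (p + 1) a b ∘ₗ cone x = ev p (fun l => a (x :: l)) b := lin_ext fun l => by simp
  exact congrArg (fun f => f w) this

theorem ev_zero_cone (a b : List X → ℚ) (x : X) (w : Ch X) :
    ev 0 a b (cone x w) = a [x] * ext b (cone x w) := by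
  have : ev 0 a b ∘ₗ cone x = a [x] • (ext b ∘ₗ cone x) := lin_ext fun l => by simp
  exact congrArg (fun f => f w) this

theorem ext_cons_dl (a : List X → ℚ) (x : X) (w : Ch X) :
    ext (fun l => a (x :: l)) w = ext a (cone x w) := by
  have : ext (fun l => a (x :: l)) = ext a ∘ₗ cone x := lin_ext fun l => by simp
  exact congrArg (fun f => f w) this

theorem ev_dl (p : ℕ) (a b : List X → ℚ) (l : List X) (hl : p + 2 ≤ l.length) :
    ev p a b (dl l) = ext a (dl (l.take (p + 2))) * b (l.drop (p + 1))
      + (-1) ^ p * (a (l.take (p + 1)) * ext b (dl (l.drop p))) := by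
  induction p generalizing a l with
  | zero =>
    match l, hl with
    | x :: y :: l, _ =>
      rw [dl, map_sub, ev_zero_cone]
      simp [dl]
      ring
  | succ p ih =>
    match l, hl with
    | x :: l, hl =>
      rw [dl, map_sub, ev_succ_cone, ih _ _ (by simpa using hl), ext_cons_dl]
      simp only [List.take_succ_cons, List.drop_succ_cons, ev_bas, dl, map_sub, ext_bas]
      ring

theorem ev_d_eq_zero (p : ℕ) (a b : List X → ℚ) (ha : ∀ w, ext a (d w) = 0)
    (hb : ∀ w, ext b (d w) = 0) (ha' : ∀ l, l.length ≠ p + 1 → a l = 0) (w : Ch X) :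
    ev p a b (d w) = 0 := by
  have : ev p a b ∘ₗ d = 0 := lin_ext fun l => by
    rw [LinearMap.comp_apply, d_bas, LinearMap.zero_apply]
    rcases le_or_gt (p + 2) l.length with h | h
    · rw [ev_dl p a b l h, ← d_bas, ← d_bas, ha, hb]; simp
    · have h1 : ∀ k, k ≠ p + 1 → ∀ w : Ch X,
          ev p a b (proj k w) = if k ≤ p then 0 else ev p a b (proj k w) := by
        intro k hk w
        split_ifs with hkp
        · have : ev p a b ∘ₗ proj k = 0 := lin_ext fun l => by
            simp only [LinearMap.comp_apply, proj_bas]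
            split_ifs with h
            · rw [ev_bas, ha', zero_mul]; rfl
              simp; omega
            · simp
          exact congrArg (fun f => f w) this
        · rfl
      cases l with
      | nil => simp [dl]
      | cons x l =>
        have h2 := proj_dl (x :: l) l.length
        rw [if_pos (by simp)] at h2
        simp only [List.length_cons] at h
        rw [← h2, h1 _ (by omega), if_pos (by omega)]
  exact congrArg (fun f => f w) this

theorem shl_singleton (s : S) (y : List T) :
    aug (bas y) • bas [] + shl [s] y = bas (y.map fun t => (s, t)) := by
  induction y with
  | nil => simp [shl]
  | cons t y ih =>
    rw [shl]
    simp only [shl, List.length_nil, pow_zero, one_smul, aug_bas, if_true, one_mul, add_zero] at ih ⊢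
    rw [ih]
    simp

theorem ev_shl (p : ℕ) (a : List S → ℚ) (b : List T → ℚ) (ha : ∀ l : List S, ¬ l.Nodup → a l = 0)
    (x : List S) (y : List T) (hx : x.length = p + 1) (hy : y ≠ []) :
    ev p (fun l => a (l.map Prod.fst)) (fun l => b (l.map Prod.snd)) (shl x y) = a x * b y := by
  induction p generalizing a x with
  | zero =>
    obtain ⟨s, rfl⟩ := List.length_eq_one_iff.1 hx
    obtain ⟨t, y, rfl⟩ := List.exists_cons_of_ne_nil hy
    have := shl_singleton s y
    rw [shl]
    simp only [shl, List.length_nil, pow_zero, one_smul, aug_bas, if_true, one_mul, add_zero] at this ⊢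
    rw [this]
    simp [Function.comp_def]
  | succ p ih =>
    match x, hx with
    | s :: s' :: x, hx =>
      obtain ⟨t, y, rfl⟩ := List.exists_cons_of_ne_nil hy
      rw [shl, ev_succ_cone]
      simp only [List.map_cons, map_add, map_smul]
      rw [ih (fun l => a (s :: l)) (fun l hl => ha _ fun h => hl (List.nodup_cons.1 h).2) (s' :: x)
        (by simpa using hx)]
      have h0 : ev p (fun l => a (s :: l.map Prod.fst)) (fun l => b (l.map Prod.snd))
          (shl (s :: s' :: x) y) = 0 := by
        cases y with
        | nil => simp [shl]
        | cons t' y =>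
          rw [shl]
          generalize ((aug _ * _) • _ + _ + _ : Ch (S × T)) = w
          have : ev p (fun l => a (s :: l.map Prod.fst)) (fun l => b (l.map Prod.snd)) ∘ₗ
              cone (s, t') = 0 :=
            lin_ext fun l => by
              rw [LinearMap.comp_apply, cone_bas, ev_bas, ha, zero_mul]; rfl
              simp
          exact congrArg (fun f => f w) this
      rw [h0]
      simp

/-! ### Cycles modulo a group of symmetries -/

/-- A functional on chains which is invariant under a family of self-maps. -/
def IsInv {G : Type*} (tr : G → S → S) (b : Ch S →ₗ[ℚ] ℚ) : Prop := ∀ g w, b (mp (tr g) w) = b w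

/-- The boundary of `Z` vanishes modulo a family of symmetries. -/
def CycleMod {G : Type*} (tr : G → S → S) (Z : Ch S) : Prop := ∀ b, IsInv tr b → b (d Z) = 0

theorem eval_mp_eq {G : Type*} {trS : G → S → S} {trT : G → T → T} {f g : S → T}
    (hf : ∀ a s, f (trS a s) = trT a (f s)) (hg : ∀ a s, g (trS a s) = trT a (g s))
    {F : Ch T →ₗ[ℚ] ℚ} (hF : IsInv trT F) (hFd : ∀ w, F (d w) = 0) {Z : Ch S}
    (hZ : CycleMod trS Z) : F (mp f Z) = F (mp g Z) := by
  have h := hFd (prism f g Z)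
  rw [d_prism, map_sub, map_sub] at h
  have h2 : IsInv trS (F ∘ₗ prism f g) := fun a w => by
    have e1 : f ∘ trS a = trT a ∘ f := funext fun s => hf a s
    have e2 : g ∘ trS a = trT a ∘ g := funext fun s => hg a s
    rw [LinearMap.comp_apply, prism_mp, e1, e2, ← mp_prism, hF]
    rfl
  have h3 := hZ _ h2
  rw [LinearMap.comp_apply] at h3
  linarith

theorem CycleMod.sh {G G' : Type*} {trS : G → S → S} {trT : G' → T → T} {Z : Ch S} {W : Ch T}
    (hZ : CycleMod trS Z) (hW : CycleMod trT W) (hZa : aug (d Z) = 0)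
    {e : G} {e' : G'} (he : ∀ s, trS e s = s) (he' : ∀ t, trT e' t = t) :
    CycleMod (fun (g : G × G') (p : S × T) => (trS g.1 p.1, trT g.2 p.2)) (sh Z W) := by
  intro b hb
  have hb' : ∀ g u v, b (TCSum.sh (mp (trS g) u) v) = b (TCSum.sh u v) := fun g u v => by
    have e1 : v = mp (trT e') v := by
      have : trT e' = id := funext he'
      rw [this]
      have : (mp id : Ch T →ₗ[ℚ] Ch T) = LinearMap.id := lin_ext fun l => by simp
      rw [this]; rfl
    rw [← hb (g, e') (TCSum.sh u v)]
    exact congrArg b (by conv_lhs => rw [e1]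
                         exact (mp_sh (trS g) (trT e') u v).symm)
  have hb'' : ∀ g u v, b (TCSum.sh u (mp (trT g) v)) = b (TCSum.sh u v) := fun g u v => by
    have e1 : u = mp (trS e) u := by
      have : trS e = id := funext he
      rw [this]
      have : (mp id : Ch S →ₗ[ℚ] Ch S) = LinearMap.id := lin_ext fun l => by simp
      rw [this]; rfl
    rw [← hb (e, g) (TCSum.sh u v)]
    exact congrArg b (by conv_lhs => rw [e1]
                         exact (mp_sh (trS e) (trT g) u v).symm)
  have h1 := hZ (b ∘ₗ TCSum.sh.flip W) fun g w => hb' g w W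
  have h2 := hW (b ∘ₗ TCSum.sh (sg Z)) fun g w => hb'' g (sg Z) w
  simp only [LinearMap.comp_apply, LinearMap.flip_apply] at h1 h2
  rw [d_sh, map_add, map_sub, h1, h2, hZa]
  simp

/-! ### Acyclic models -/

section Models
variable {C : Type*} [AddCommGroup C] [Module ℚ C] (bd : C →ₗ[ℚ] C) (κ : List S → C →ₗ[ℚ] C)

/-- Recursive extension of a degree-zero map using contractions depending on a list. -/
def model (F₀ : Ch S →ₗ[ℚ] C) : ℕ → Ch S →ₗ[ℚ] C
  | 0 => F₀
  | k + 1 => ext fun l => κ l (model F₀ k (dl l))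

theorem model_succ_bas (F₀ : Ch S →ₗ[ℚ] C) (k : ℕ) (l : List S) :
    model κ F₀ (k + 1) (bas l) = κ l (model κ F₀ k (dl l)) := by
  rw [model, ext_bas]

theorem bd_model (hκ : ∀ l, l ≠ [] → ∀ w, bd (κ l w) = w - κ l (bd w))
    (F₀ : Ch S →ₗ[ℚ] C) (h₀ : ∀ w, bd (F₀ (d w)) = 0) (k : ℕ) (w : Ch S) :
    bd (model κ F₀ (k + 1) w) = model κ F₀ k (d w) := by
  have : bd ∘ₗ model κ F₀ (k + 1) = model κ F₀ k ∘ₗ d := by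
    induction k with
    | zero =>
      refine lin_ext fun l => ?_
      by_cases hl : l = []
      · subst hl; simp [model_succ_bas, dl]
      · simp only [LinearMap.comp_apply, model_succ_bas, hκ l hl, d_bas]
        rw [model, ← d_bas, h₀]; simp
    | succ k ih =>
      refine lin_ext fun l => ?_
      by_cases hl : l = []
      · subst hl; simp [model_succ_bas, dl]
      · have := congrArg (fun f => f (dl l)) ih
        simp only [LinearMap.comp_apply, d_dl] at this
        simp only [LinearMap.comp_apply, model_succ_bas (k := k + 1), hκ l hl, d_bas, this]
        simp
  exact congrArg (fun f => f w) this

end Models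

end TCSum

namespace TCSum

/-! ### Extending maps from the boundary of a simplex -/

/-- The collapse map of an open embedding into a compact Hausdorff space. -/
theorem exists_collapse {V X : Type*} [TopologicalSpace V] [TopologicalSpace X] [T2Space X]
    {ψ : V → X} (hψ : IsOpenEmbedding ψ) :
    ∃ c : C(X, OnePoint V), (∀ v, c (ψ v) = v) ∧ ∀ x ∉ Set.range ψ, c x = OnePoint.infty := by
  classical
  let c : X → OnePoint V := fun x => if h : ∃ v, ψ v = x then (h.choose : V) else OnePoint.infty
  have h1 : ∀ v, c (ψ v) = v := fun v => by
    have h : ∃ w, ψ w = ψ v := ⟨v, rfl⟩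
    simp only [c, dif_pos h]
    exact congrArg _ (hψ.injective h.choose_spec)
  have h2 : ∀ x ∉ Set.range ψ, c x = OnePoint.infty := fun x hx => dif_neg hx
  have h3 : ∀ s : Set (OnePoint V), c ⁻¹' s ∩ Set.range ψ = ψ '' ((↑) ⁻¹' s) := fun s => by
    ext x
    constructor
    · rintro ⟨hx, v, rfl⟩
      exact ⟨v, by simpa [h1] using hx, rfl⟩
    · rintro ⟨v, hv, rfl⟩
      exact ⟨by simpa [h1] using hv, v, rfl⟩
  refine ⟨⟨c, ⟨fun s hs => ?_⟩⟩, h1, h2⟩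
  by_cases hi : OnePoint.infty ∈ s
  · have hs' := (OnePoint.isOpen_iff_of_mem hi).1 hs
    have : (c ⁻¹' s)ᶜ = ψ '' ((↑) ⁻¹' sᶜ) := by
      rw [← h3, Set.preimage_compl, eq_comm, Set.inter_eq_left]
      intro x hx
      by_contra h
      exact hx (by simpa [h2 x h] using hi)
    rw [← isClosed_compl_iff, this]
    exact (hs'.2.image hψ.continuous).isClosed
  · have : c ⁻¹' s = ψ '' ((↑) ⁻¹' s) := by
      rw [← h3, eq_comm, Set.inter_eq_left]
      intro x hx
      by_contra h
      exact hi (by simpa [h2 x h] using hx)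
    rw [this]
    exact hψ.isOpenMap _ ((OnePoint.isOpen_iff_of_notMem hi).1 hs)

theorem exists_cube_to_sphere (k : ℕ) (hk : 1 ≤ k) :
    ∃ q : C(Fin k → I, Metric.sphere (0 : EuclideanSpace ℝ (Fin (k + 1))) 1),
      Function.Surjective q ∧ (∀ u ∈ Cube.boundary (Fin k), ∀ u' ∈ Cube.boundary (Fin k), q u = q u') ∧
      ∀ u u', q u = q u' → u = u' ∨ (u ∈ Cube.boundary (Fin k) ∧ u' ∈ Cube.boundary (Fin k)) := by
  have hs : IsOpenEmbedding unitInterval.sigmoid :=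
    ⟨isEmbedding_sigmoid, by rw [unitInterval.range_sigmoid]; exact isOpen_Ioo⟩
  have hψ : IsOpenEmbedding (Pi.map (fun _ : Fin k => unitInterval.sigmoid)) :=
    IsOpenEmbedding.piMap fun _ => hs
  obtain ⟨c, hc1, hc2⟩ := exists_collapse hψ
  have hr : ∀ u : Fin k → I, u ∈ Set.range (Pi.map (fun _ : Fin k => unitInterval.sigmoid)) ↔
      u ∉ Cube.boundary (Fin k) := fun u => by
    rw [Set.range_piMap]
    simp only [unitInterval.range_sigmoid, Set.mem_pi, Set.mem_univ, true_imp_iff, Cube.boundary,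
      Set.mem_ofPred_eq, not_exists, not_or, Set.mem_Ioo, unitInterval.pos_iff_ne_zero,
      unitInterval.lt_one_iff_ne_one]
  have e := onePointEquivSphereOfFinrankEq (ι := Fin (k + 1)) (V := Fin k → ℝ) (by simp)
  refine ⟨⟨e ∘ c, e.continuous.comp c.continuous⟩, ?_, ?_, ?_⟩
  · refine e.surjective.comp fun y => ?_
    induction y using OnePoint.rec with
    | infty =>
      refine ⟨fun _ => 0, hc2 _ fun h => (hr _).1 h ⟨⟨0, hk⟩, Or.inl rfl⟩⟩
    | coe v => exact ⟨_, hc1 v⟩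
  · intro u hu u' hu'
    simp [hc2 u fun h => (hr _).1 h hu, hc2 u' fun h => (hr _).1 h hu']
  · intro u u' h
    have h : c u = c u' := e.injective h
    by_cases hu : u ∈ Cube.boundary (Fin k) <;> by_cases hu' : u' ∈ Cube.boundary (Fin k)
    · exact Or.inr ⟨hu, hu'⟩
    · obtain ⟨v, rfl⟩ := (hr _).2 hu'
      rw [hc1, hc2 u fun h => (hr _).1 h hu] at h
      exact absurd h (OnePoint.infty_ne_coe v)
    · obtain ⟨v, rfl⟩ := (hr _).2 hu
      rw [hc1, hc2 u' fun h => (hr _).1 h hu'] at h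
      exact absurd h.symm (OnePoint.infty_ne_coe v)
    · obtain ⟨v, rfl⟩ := (hr _).2 hu
      obtain ⟨v', rfl⟩ := (hr _).2 hu'
      rw [hc1, hc1] at h
      rw [OnePoint.coe_injective h]
      exact Or.inl rfl

/-- Descending a continuous map along a continuous surjection from a compact space. -/
theorem exists_descend {A B M : Type*} [TopologicalSpace A] [TopologicalSpace B] [TopologicalSpace M]
    [CompactSpace A] [T2Space B] (Q : C(A, B)) (hQ : Function.Surjective Q) (G : C(A, M))
    (h : ∀ a a', Q a = Q a' → G a = G a') : ∃ F : C(B, M), ∀ a, F (Q a) = G a := by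
  have hq : IsQuotientMap Q := Q.continuous.isClosedMap.isQuotientMap Q.continuous hQ
  let F : B → M := fun b => G (hQ b).choose
  have hF : ∀ a, F (Q a) = G a := fun a => h _ _ (hQ (Q a)).choose_spec
  refine ⟨⟨F, hq.continuous_iff.2 ?_⟩, hF⟩
  have : F ∘ Q = G := funext hF
  rw [this]
  exact G.continuous

theorem extend_ball {M : Type*} [TopologicalSpace M] (k : ℕ) (hk : 1 ≤ k)
    (hM : ∀ x : M, Subsingleton (HomotopyGroup (Fin k) M x))
    (f : C(Metric.sphere (0 : EuclideanSpace ℝ (Fin (k + 1))) 1, M)) :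
    ∃ F : C(Metric.closedBall (0 : EuclideanSpace ℝ (Fin (k + 1))) 1, M),
      ∀ v (hv : v ∈ Metric.sphere (0 : EuclideanSpace ℝ (Fin (k + 1))) 1),
        F ⟨v, Metric.sphere_subset_closedBall hv⟩ = f ⟨v, hv⟩ := by
  obtain ⟨q, hq1, hq2, hq3⟩ := exists_cube_to_sphere k hk
  have hb : (fun _ => 0 : Fin k → I) ∈ Cube.boundary (Fin k) := ⟨⟨0, hk⟩, Or.inl rfl⟩
  let x : M := f (q fun _ => 0)
  let g : GenLoop (Fin k) M x := ⟨f.comp q, fun y hy => congrArg f (hq2 _ hy _ hb)⟩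
  have hg : GenLoop.Homotopic g GenLoop.const :=
    Quotient.exact ((hM x).elim (Quotient.mk _ g) (Quotient.mk _ GenLoop.const))
  obtain ⟨G⟩ := hg
  have hn : ∀ u, ‖(q u : EuclideanSpace ℝ (Fin (k + 1)))‖ = 1 := fun u => by simp
  let Q : C(I × (Fin k → I), Metric.closedBall (0 : EuclideanSpace ℝ (Fin (k + 1))) 1) :=
    ⟨fun p => ⟨(1 - (p.1 : ℝ)) • (q p.2 : EuclideanSpace ℝ (Fin (k + 1))), by
      have := p.1.2.1
      rw [mem_closedBall_zero_iff, norm_smul, hn, mul_one, Real.norm_of_nonneg (by linarith [p.1.2.2])]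
      linarith⟩, by fun_prop⟩
  have hQ : ∀ p, ‖(Q p : EuclideanSpace ℝ (Fin (k + 1)))‖ = 1 - (p.1 : ℝ) := fun p => by
    change ‖(1 - (p.1 : ℝ)) • (q p.2 : EuclideanSpace ℝ (Fin (k + 1)))‖ = _
    rw [norm_smul, hn, mul_one, Real.norm_of_nonneg (by linarith [p.1.2.2])]
  obtain ⟨F, hF⟩ := exists_descend Q (by
      rintro ⟨v, hv⟩
      rw [mem_closedBall_zero_iff] at hv
      by_cases h0 : v = 0
      · exact ⟨(1, fun _ => 0), Subtype.ext (by simp [Q, h0])⟩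
      · obtain ⟨u, hu⟩ := hq1 ⟨‖v‖⁻¹ • v, by simp [norm_smul, h0]⟩
        refine ⟨(⟨1 - ‖v‖, by linarith, by linarith [norm_nonneg v]⟩, u), Subtype.ext ?_⟩
        simp [Q, hu, smul_smul, h0]) (G.toContinuousMap) (by
      rintro ⟨t, u⟩ ⟨t', u'⟩ h
      have h1 : t = t' := by
        have := hQ (t, u)
        rw [h, hQ] at this
        exact Subtype.ext (by simp at this; linarith)
      subst h1
      by_cases ht : t = 1
      · subst ht
        exact (G.apply_one u).trans (G.apply_one u').symm
      · have h2 : q u = q u' := by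
          have := congrArg Subtype.val h
          simp only [Q, ContinuousMap.coe_mk] at this
          refine Subtype.ext (smul_right_injective _ ?_ this)
          intro h
          exact ht (Subtype.ext (show (t : ℝ) = ((1 : I) : ℝ) by rw [Set.Icc.coe_one]; linarith))
        rcases hq3 u u' h2 with rfl | ⟨hu, hu'⟩
        · rfl
        · have e1 := G.eq_fst t hu
          have e2 := G.eq_fst t hu'
          refine e1.trans (Eq.trans ?_ e2.symm)
          exact congrArg f h2)
  refine ⟨F, fun v hv => ?_⟩
  obtain ⟨u, hu⟩ := hq1 ⟨v, hv⟩
  have := hF (0, u)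
  have e : Q (0, u) = ⟨v, Metric.sphere_subset_closedBall hv⟩ := Subtype.ext (by simp [Q, hu])
  rw [e] at this
  rw [this]
  refine (G.apply_zero u).trans ?_
  change f (q u) = _
  rw [hu]

end TCSum

namespace TCSum

/-- The simplex in `ℝᵐ` cut out by nonnegative coordinates of sum at most `1`. -/
def cornerSimplex (m : ℕ) : Set (EuclideanSpace ℝ (Fin m)) := {v | (∀ i, 0 ≤ v i) ∧ ∑ i, v i ≤ 1}

theorem isClosed_cornerSimplex (m : ℕ) : IsClosed (cornerSimplex m) := by
  have : cornerSimplex m = (⋂ i, {v | 0 ≤ v i}) ∩ {v | ∑ i, v i ≤ 1} := by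
    ext; simp [cornerSimplex]
  rw [this]
  refine (isClosed_iInter fun i => isClosed_le (by fun_prop) (by fun_prop)).inter
    (isClosed_le (by fun_prop) (by fun_prop))

theorem convex_cornerSimplex (m : ℕ) : Convex ℝ (cornerSimplex m) := by
  rintro v ⟨hv, hv'⟩ w ⟨hw, hw'⟩ a b ha hb hab
  refine ⟨fun i => ?_, ?_⟩
  · have := mul_nonneg ha (hv i)
    have := mul_nonneg hb (hw i)
    simp; linarith
  · simp only [PiLp.add_apply, PiLp.smul_apply, smul_eq_mul, Finset.sum_add_distrib,
      ← Finset.mul_sum]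
    nlinarith

theorem isBounded_cornerSimplex (m : ℕ) : Bornology.IsBounded (cornerSimplex m) := by
  refine (isBounded_iff_forall_norm_le).2 ⟨Real.sqrt m, ?_⟩
  rintro v ⟨hv, hv'⟩
  rw [EuclideanSpace.norm_eq]
  refine Real.sqrt_le_sqrt ?_
  have h1 : ∀ i, v i ≤ 1 := fun i =>
    (Finset.single_le_sum (f := fun i => v i) (fun i _ => hv i) (Finset.mem_univ i)).trans hv'
  calc ∑ i, ‖v i‖ ^ 2 ≤ ∑ i : Fin m, (1 : ℝ) := Finset.sum_le_sum fun i _ => by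
        rw [Real.norm_of_nonneg (hv i)]; exact pow_le_one₀ (hv i) (h1 i)
    _ = m := by simp

theorem strict_subset_interior_cornerSimplex (m : ℕ) :
    {v : EuclideanSpace ℝ (Fin m) | (∀ i, 0 < v i) ∧ ∑ i, v i < 1} ⊆ interior (cornerSimplex m) := by
  refine interior_maximal (fun v hv => ⟨fun i => (hv.1 i).le, hv.2.le⟩) ?_
  have : {v : EuclideanSpace ℝ (Fin m) | (∀ i, 0 < v i) ∧ ∑ i, v i < 1} =
      (⋂ i, {v | 0 < v i}) ∩ {v | ∑ i, v i < 1} := by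
    ext; simp
  rw [this]
  exact (isOpen_iInter_of_finite fun i => isOpen_lt (by fun_prop) (by fun_prop)).inter
    (isOpen_lt (by fun_prop) (by fun_prop))

theorem interior_cornerSimplex_subset (m : ℕ) (hm : 0 < m) {v : EuclideanSpace ℝ (Fin m)}
    (hv : v ∈ interior (cornerSimplex m)) : (∀ i, 0 < v i) ∧ ∑ i, v i < 1 := by
  have key : ∀ u : EuclideanSpace ℝ (Fin m), ∃ t : ℝ, 0 < t ∧ v + t • u ∈ cornerSimplex m := by
    intro u
    have h1 : Filter.Tendsto (fun t : ℝ => v + t • u) (𝓝[>] 0) (𝓝 v) := by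
      have : Continuous fun t : ℝ => v + t • u := by fun_prop
      simpa using (this.tendsto 0).mono_left nhdsWithin_le_nhds
    have h2 := h1.eventually (mem_interior_iff_mem_nhds.1 hv)
    obtain ⟨t, ht, ht'⟩ := (h2.and self_mem_nhdsWithin).exists
    exact ⟨t, ht', ht⟩
  constructor
  · intro i
    obtain ⟨t, ht, h⟩ := key (EuclideanSpace.single i (-1))
    have := h.1 i
    simp at this
    linarith
  · obtain ⟨t, ht, h⟩ := key (EuclideanSpace.single ⟨0, hm⟩ 1)
    have := h.2
    simp [Finset.sum_add_distrib] at this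
    linarith

theorem extend_simplex {M : Type*} [TopologicalSpace M] (k : ℕ) (hk : 1 ≤ k)
    (hM : ∀ x : M, Subsingleton (HomotopyGroup (Fin k) M x))
    (f : C({w : stdSimplex ℝ (Fin (k + 2)) // ∃ i, w i = 0}, M)) :
    ∃ F : C(stdSimplex ℝ (Fin (k + 2)), M), ∀ w, F w.1 = f w := by
  let s := cornerSimplex (k + 1)
  have hne : (interior s).Nonempty := by
    refine ⟨WithLp.toLp 2 fun _ => 1 / (k + 2 : ℝ),
      strict_subset_interior_cornerSimplex _ ⟨fun i => ?_, ?_⟩⟩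
    · simp; positivity
    · simp
      rw [← div_eq_mul_inv, div_lt_one (by positivity)]; linarith
  obtain ⟨h, h1, h2, h3⟩ := exists_homeomorph_image_interior_closure_frontier_eq_unitBall
    (convex_cornerSimplex (k + 1)) hne (isBounded_cornerSimplex _)
  rw [(isClosed_cornerSimplex _).closure_eq] at h2
  have hsum : ∀ w : stdSimplex ℝ (Fin (k + 2)), w 0 + ∑ i : Fin (k + 1), w i.succ = 1 := fun w => by
    rw [← Fin.sum_univ_succ (fun i => w i)]; exact w.2.2
  let e : C(stdSimplex ℝ (Fin (k + 2)), EuclideanSpace ℝ (Fin (k + 1))) :=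
    ⟨fun w => WithLp.toLp 2 fun i => w i.succ, by
      refine (PiLp.continuous_toLp 2 _).comp (continuous_pi fun i => ?_)
      exact (continuous_apply _).comp continuous_subtype_val⟩
  have he : ∀ w, e w ∈ s := fun w => ⟨fun i => w.2.1 _, by
    have := hsum w
    have h0 : 0 ≤ w 0 := w.2.1 0
    change ∑ i : Fin (k + 1), w i.succ ≤ 1
    linarith⟩
  let e' : C(s, stdSimplex ℝ (Fin (k + 2))) :=
    ⟨fun v => ⟨Fin.cons (1 - ∑ i, v.1 i) fun i => v.1 i, by
      constructor
      · intro i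
        refine Fin.cases ?_ (fun j => ?_) i
        · simpa using v.2.2
        · simpa using v.2.1 j
      · rw [Fin.sum_univ_succ]; simp⟩, by
      refine Continuous.subtype_mk (continuous_pi fun i => ?_) _
      refine Fin.cases ?_ (fun j => ?_) i
      · simp only [Fin.cons_zero]; fun_prop
      · simp only [Fin.cons_succ]; fun_prop⟩
  have hee : ∀ w, e' ⟨e w, he w⟩ = w := fun w => by
    apply Subtype.ext
    funext i
    refine Fin.cases ?_ (fun j => ?_) i
    · have := hsum w
      change 1 - ∑ i : Fin (k + 1), w i.succ = w 0
      linarith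
    · rfl
  have hfr : ∀ v : Metric.sphere (0 : EuclideanSpace ℝ (Fin (k + 1))) 1,
      ∃ hv : h.symm v.1 ∈ s, ∃ i, e' ⟨h.symm v.1, hv⟩ i = 0 := by
    rintro ⟨v, hv⟩
    rw [← h3] at hv
    obtain ⟨u, hu, rfl⟩ := hv
    have hus : u ∈ s := (isClosed_cornerSimplex (k + 1)).frontier_subset hu
    simp only [Homeomorph.symm_apply_apply]
    refine ⟨hus, ?_⟩
    by_contra! hcon
    refine hu.2 (strict_subset_interior_cornerSimplex _ ⟨fun i => ?_, ?_⟩)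
    · exact lt_of_le_of_ne (hus.1 i) (Ne.symm (hcon i.succ))
    · have h0 : 1 - ∑ i, u i ≠ 0 := hcon 0
      exact lt_of_le_of_ne hus.2 (fun h => h0 (by linarith))
  obtain ⟨F, hF⟩ := extend_ball k hk hM
    (f.comp ⟨fun v => ⟨e' ⟨h.symm v.1, (hfr v).1⟩, (hfr v).2⟩, by fun_prop⟩)
  have hcl : ∀ w, h (e w) ∈ Metric.closedBall (0 : EuclideanSpace ℝ (Fin (k + 1))) 1 := fun w => by
    rw [← h2]; exact ⟨_, he w, rfl⟩
  refine ⟨F.comp ⟨fun w => ⟨h (e w), hcl w⟩, by fun_prop⟩, ?_⟩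
  rintro ⟨w, hw⟩
  have hs : h (e w) ∈ Metric.sphere (0 : EuclideanSpace ℝ (Fin (k + 1))) 1 := by
    rw [← h3]
    refine ⟨_, ⟨subset_closure (he w), fun hi => ?_⟩, rfl⟩
    obtain ⟨g1, g2⟩ := interior_cornerSimplex_subset (k + 1) (by omega) hi
    obtain ⟨i, hi⟩ := hw
    revert hi
    refine Fin.cases ?_ (fun j => ?_) i
    · intro hi
      have := hsum w
      have g3 : ∑ i : Fin (k + 1), w i.succ < 1 := g2
      linarith
    · intro hj
      exact (g1 j).ne' hj
  refine (hF _ hs).trans ?_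
  change f _ = f _
  congr 1
  apply Subtype.ext
  change e' ⟨h.symm (h (e w)), _⟩ = w
  conv_rhs => rw [← hee w]
  congr 1
  exact Subtype.ext (h.symm_apply_apply _)

end TCSum

namespace TCSum

section PathClasses

variable {M : Type*} [TopologicalSpace M]

/-- Points of the universal cover of `M`: endpoints together with a homotopy class of paths. -/
abbrev Cov (x₀ : M) : Type _ := Σ x : M, Path.Homotopic.Quotient x₀ x

/-- The fundamental group, acting on `Cov x₀` by deck translations. -/
def Deck (x₀ : M) : Type _ := Path.Homotopic.Quotient x₀ x₀

instance (x₀ : M) : Group (Deck x₀) :=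
  { mul := fun a b => Path.Homotopic.Quotient.trans a b
    one := Path.Homotopic.Quotient.refl x₀
    inv := fun a => Path.Homotopic.Quotient.symm a
    mul_assoc := fun a b c => Path.Homotopic.Quotient.trans_assoc a b c
    one_mul := fun a => Path.Homotopic.Quotient.refl_trans a
    mul_one := fun a => Path.Homotopic.Quotient.trans_refl a
    inv_mul_cancel := fun a => Path.Homotopic.Quotient.symm_trans a }

instance (x₀ : M) : MulAction (Deck x₀) (Cov x₀) where
  smul g s := ⟨s.1, Path.Homotopic.Quotient.trans g s.2⟩
  one_smul s := congrArg (Sigma.mk s.1) (Path.Homotopic.Quotient.refl_trans s.2)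
  mul_smul a b s := congrArg (Sigma.mk s.1) (Path.Homotopic.Quotient.trans_assoc a b s.2)

/-- The position of a point of the cover relative to a chosen sheet over each point of the base. -/
def rel {x₀ : M} (s : Cov x₀) (β : Path.Homotopic.Quotient x₀ s.1) : Deck x₀ :=
  Path.Homotopic.Quotient.trans s.2 β.symm

theorem rel_smul {x₀ : M} (g : Deck x₀) (s : Cov x₀) (β : Path.Homotopic.Quotient x₀ s.1) :
    rel (g • s) β = g * rel s β :=
  Path.Homotopic.Quotient.trans_assoc g s.2 β.symm

theorem exists_smul_eq {x₀ : M} {s t : Cov x₀} (h : s.1 = t.1) : ∃ g : Deck x₀, g • s = t := by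
  obtain ⟨x, γ⟩ := s
  obtain ⟨y, γ'⟩ := t
  obtain rfl : x = y := h
  refine ⟨Path.Homotopic.Quotient.trans γ' γ.symm, ?_⟩
  refine congrArg (Sigma.mk x) ?_
  change Path.Homotopic.Quotient.trans (Path.Homotopic.Quotient.trans γ' γ.symm) γ = γ'
  rw [Path.Homotopic.Quotient.trans_assoc, Path.Homotopic.Quotient.symm_trans,
    Path.Homotopic.Quotient.trans_refl]

theorem trans_left_cancel {x y z : M} {a : Path.Homotopic.Quotient x y}
    {b c : Path.Homotopic.Quotient y z} (h : a.trans b = a.trans c) : b = c := by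
  have := congrArg (Path.Homotopic.Quotient.trans a.symm) h
  simpa [← Path.Homotopic.Quotient.trans_assoc] using this

variable {Y Y' : Type*} [TopologicalSpace Y] [TopologicalSpace Y']

/-- A function to the cover is a lift if it transports along paths. -/
def IsLift {x₀ : M} (ℓ : Y → Cov x₀) : Prop :=
  ∃ hc : Continuous fun w => (ℓ w).1, ∀ w w' (p : Path w w'),
    (ℓ w').2 = (ℓ w).2.trans (Path.Homotopic.Quotient.mk (p.map hc))

theorem IsLift.comp {x₀ : M} {ℓ : Y → Cov x₀} (h : IsLift ℓ) (f : C(Y', Y)) : IsLift (ℓ ∘ f) := by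
  obtain ⟨hc, h⟩ := h
  refine ⟨hc.comp f.continuous, fun w w' p => ?_⟩
  exact h _ _ (p.map f.continuous)

theorem IsLift.smul {x₀ : M} {ℓ : Y → Cov x₀} (h : IsLift ℓ) (g : Deck x₀) :
    IsLift fun w => g • ℓ w := by
  obtain ⟨hc, h⟩ := h
  refine ⟨hc, fun w w' p => ?_⟩
  change Path.Homotopic.Quotient.trans g (ℓ w').2 = _
  rw [h w w' p]
  exact (Path.Homotopic.Quotient.trans_assoc _ _ _).symm

theorem IsLift.eq_of_eq [PathConnectedSpace Y] {x₀ : M} {ℓ ℓ' : Y → Cov x₀} (h : IsLift ℓ)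
    (h' : IsLift ℓ') (hb : ∀ w, (ℓ w).1 = (ℓ' w).1) (w₀ : Y) (h₀ : ℓ w₀ = ℓ' w₀) : ℓ = ℓ' := by
  obtain ⟨τ, γ, rfl⟩ : ∃ (τ : Y → M) (γ : ∀ w, Path.Homotopic.Quotient x₀ (τ w)),
    ℓ = fun w => ⟨τ w, γ w⟩ := ⟨_, _, rfl⟩
  obtain ⟨τ', γ', rfl⟩ : ∃ (τ' : Y → M) (γ' : ∀ w, Path.Homotopic.Quotient x₀ (τ' w)),
    ℓ' = fun w => ⟨τ' w, γ' w⟩ := ⟨_, _, rfl⟩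
  obtain rfl : τ = τ' := funext hb
  have e : γ w₀ = γ' w₀ := eq_of_heq (Sigma.mk.inj h₀).2
  obtain ⟨hc, h⟩ := h
  obtain ⟨hc', h'⟩ := h'
  funext w
  have p := PathConnectedSpace.somePath w₀ w
  have h1 := h w₀ w p
  have h2 := h' w₀ w p
  simp only at h1 h2
  simp only [h1, h2, e]

theorem exists_lift [SimplyConnectedSpace Y] {x₀ : M} (τ : C(Y, M)) (w₀ : Y)
    (γ : Path.Homotopic.Quotient x₀ (τ w₀)) :
    ∃ ℓ : Y → Cov x₀, IsLift ℓ ∧ (∀ w, (ℓ w).1 = τ w) ∧ ℓ w₀ = ⟨τ w₀, γ⟩ := by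
  have key : ∀ {w : Y} (p q : Path w₀ w), Path.Homotopic.Quotient.mk (p.map τ.continuous) =
      Path.Homotopic.Quotient.mk (q.map τ.continuous) := fun p q =>
    Path.Homotopic.Quotient.eq.2 ((SimplyConnectedSpace.paths_homotopic p q).map τ)
  refine ⟨fun w => ⟨τ w, γ.trans (Path.Homotopic.Quotient.mk
    ((PathConnectedSpace.somePath w₀ w).map τ.continuous))⟩, ⟨τ.continuous, fun w w' p => ?_⟩,
    fun w => rfl, ?_⟩
  · simp only
    rw [Path.Homotopic.Quotient.trans_assoc, ← Path.Homotopic.Quotient.mk_trans, ← Path.map_trans,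
      key ((PathConnectedSpace.somePath w₀ w).trans p)]
  · dsimp only
    rw [key _ (Path.refl w₀)]
    exact congrArg (Sigma.mk _) (Path.Homotopic.Quotient.trans_refl γ)

theorem exists_smul_lift [PathConnectedSpace Y] {x₀ : M} {ℓ ℓ' : Y → Cov x₀} (h : IsLift ℓ)
    (h' : IsLift ℓ') (hb : ∀ w, (ℓ w).1 = (ℓ' w).1) :
    ∃ g : Deck x₀, (fun w => g • ℓ w) = ℓ' := by
  obtain ⟨w₀⟩ := (inferInstance : Nonempty Y)
  obtain ⟨g, hg⟩ := exists_smul_eq (hb w₀)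
  exact ⟨g, (h.smul g).eq_of_eq h' hb w₀ hg⟩

end PathClasses

/-- The topological simplex with `k` vertices. -/
abbrev Splx (k : ℕ) : Type := stdSimplex ℝ (Fin k)

/-- The inclusion of the face opposite to the vertex `i`. -/
def δ {k : ℕ} (i : Fin (k + 1)) : C(Splx k, Splx (k + 1)) :=
  ⟨stdSimplex.map i.succAbove, stdSimplex.continuous_map _⟩

theorem δ_apply_self {k : ℕ} (i : Fin (k + 1)) (w : Splx k) : δ i w i = 0 := by
  simp [δ, stdSimplex.map_coe, FunOnFinite.linearMap_apply_apply, Fin.succAbove_ne]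

theorem δ_apply_succAbove {k : ℕ} (i : Fin (k + 1)) (w : Splx k) (j : Fin k) :
    δ i w (i.succAbove j) = w j := by
  simp [δ, stdSimplex.map_coe, FunOnFinite.linearMap_apply_apply, Finset.filter_eq']

instance (k : ℕ) : SimplyConnectedSpace (Splx (k + 1)) := by
  have : ContractibleSpace (Splx (k + 1)) :=
    (convex_stdSimplex ℝ (Fin (k + 1))).contractibleSpace ⟨_, single_mem_stdSimplex ℝ 0⟩
  infer_instance

theorem δ_injective {k : ℕ} (i : Fin (k + 1)) : Function.Injective (δ i) := by
  intro w w' h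
  apply stdSimplex.ext
  funext j
  rw [← δ_apply_succAbove i w j, h, δ_apply_succAbove]

theorem exists_δ_eq {k : ℕ} (i : Fin (k + 1)) (w : Splx (k + 1)) (h : w i = 0) :
    ∃ u, δ i u = w := by
  have h' : (∑ j, w (i.succAbove j)) = 1 := by
    have := w.2.2
    rw [Fin.sum_univ_succAbove _ i] at this
    change w i + _ = 1 at this
    rw [h, zero_add] at this
    exact this
  refine ⟨⟨fun j => w (i.succAbove j), fun j => w.2.1 _, h'⟩, ?_⟩
  apply stdSimplex.ext
  funext j
  rcases Fin.eq_self_or_eq_succAbove i j with rfl | ⟨j, rfl⟩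
  · rw [δ_apply_self, h]
  · rw [δ_apply_succAbove]; rfl

theorem δ_vertex {k : ℕ} (i : Fin (k + 1)) (j : Fin k) :
    δ i (stdSimplex.vertex j) = stdSimplex.vertex (S := ℝ) (i.succAbove j) :=
  stdSimplex.map_vertex _ _

theorem δ_comp_δ {k : ℕ} {i j : Fin (k + 1)} (h : i ≤ j) (w : Splx k) :
    δ j.succ (δ i w) = δ i.castSucc (δ j w) := by
  change stdSimplex.map _ (stdSimplex.map _ w) = stdSimplex.map _ (stdSimplex.map _ w)
  rw [stdSimplex.map_comp_apply, stdSimplex.map_comp_apply]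
  congr 1
  funext a
  apply Fin.ext
  have := Fin.le_def.1 h
  simp only [Function.comp_apply, Fin.succAbove, Fin.lt_def]
  split_ifs <;> simp_all <;> omega

/-- Points of two different faces that agree come from the common codimension-two face. -/
theorem exists_common_face {k : ℕ} {i j : Fin (k + 1)} (h : i ≤ j) {w w' : Splx (k + 1)}
    (e : δ j.succ w = δ i.castSucc w') : ∃ u, w = δ i u ∧ w' = δ j u := by
  have h1 : j.succ.succAbove i = i.castSucc := by
    rw [Fin.succAbove_of_castSucc_lt]
    exact Fin.lt_def.2 (by simpa using Nat.lt_succ_of_le h)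
  have h2 : w i = 0 := by
    rw [← δ_apply_succAbove j.succ w i, e, h1, δ_apply_self]
  obtain ⟨u, rfl⟩ := exists_δ_eq i w h2
  rw [δ_comp_δ h] at e
  exact ⟨u, rfl, (δ_injective _ e).symm⟩

end TCSum

namespace TCSum

/-- A triangle filling a homotopy between a composite path and a path. -/
theorem exists_triangle {M : Type*} [TopologicalSpace M] {a b c : M} (p : Path a b) (q : Path b c)
    (r : Path a c) (h : (p.trans q).Homotopic r) :
    ∃ F : C(Splx 3, M), ∀ w : Splx 3, ∀ t : I,
      (w 2 = 0 → w 1 = t → F w = p t) ∧ (w 0 = 0 → w 2 = t → F w = q t) ∧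
      (w 1 = 0 → w 2 = t → F w = r t) := by
  obtain ⟨G⟩ := h
  let y : I × I → ℝ := fun z => (1 - z.1) * (1 - |2 * (z.2 : ℝ) - 1|)
  have hy : Continuous y := by fun_prop
  have habs : ∀ t : I, |2 * (t : ℝ) - 1| ≤ 1 := fun t =>
    abs_le.2 ⟨by linarith [t.2.1], by linarith [t.2.2]⟩
  have hy0 : ∀ z, 0 ≤ y z := fun z => mul_nonneg (by linarith [z.1.2.2]) (by linarith [habs z.2])
  have hy1 : ∀ z, y z ≤ 1 - |2 * (z.2 : ℝ) - 1| := fun z =>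
    mul_le_of_le_one_left (by linarith [habs z.2]) (by linarith [z.1.2.1])
  let Q : C(I × I, Splx 3) :=
    ⟨fun z => ⟨![(1 - y z - (2 * z.2 - 1)) / 2, y z, (1 - y z + (2 * z.2 - 1)) / 2], by
      have := hy1 z
      have h1 := le_abs_self (2 * (z.2 : ℝ) - 1)
      have h2 := neg_abs_le (2 * (z.2 : ℝ) - 1)
      refine ⟨fun i => ?_, ?_⟩
      · fin_cases i
        · simp; linarith
        · simpa using hy0 z
        · simp; linarith
      · simp [Fin.sum_univ_three]; ring⟩, by
      refine Continuous.subtype_mk (continuous_pi fun i => ?_) _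
      fin_cases i
      · simp; fun_prop
      · simpa using hy
      · simp; fun_prop⟩
  have Q0 : ∀ z, Q z 0 = (1 - y z - (2 * z.2 - 1)) / 2 := fun z => rfl
  have Q1 : ∀ z, Q z 1 = y z := fun z => rfl
  have Q2 : ∀ z, Q z 2 = (1 - y z + (2 * z.2 - 1)) / 2 := fun z => rfl
  have ext3 : ∀ w w' : Splx 3, w 1 = w' 1 → w 2 = w' 2 → w = w' := fun w w' h1 h2 => by
    have e1 := w.2.2
    have e2 := w'.2.2
    rw [Fin.sum_univ_three] at e1 e2
    change w 0 + w 1 + w 2 = 1 at e1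
    change w' 0 + w' 1 + w' 2 = 1 at e2
    apply stdSimplex.ext
    funext i
    fin_cases i
    · change w 0 = w' 0; linarith
    · exact h1
    · exact h2
  have hsum : ∀ w : Splx 3, w 0 + w 1 + w 2 = 1 := fun w => by
    have := w.2.2; rw [Fin.sum_univ_three] at this; exact this
  obtain ⟨F, hF⟩ := exists_descend Q (by
      intro w
      have h0 : 0 ≤ w 0 := w.2.1 0
      have h1 : 0 ≤ w 1 := w.2.1 1
      have h2 : 0 ≤ w 2 := w.2.1 2
      have hs := hsum w
      let t : I := ⟨(1 + w 2 - w 0) / 2, by linarith, by linarith⟩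
      have ht : 2 * (t : ℝ) - 1 = w 2 - w 0 := by simp [t]; ring
      have hle : w 1 ≤ 1 - |2 * (t : ℝ) - 1| := by
        rw [ht]
        rcases abs_cases (w 2 - w 0) with ⟨e, _⟩ | ⟨e, _⟩ <;> rw [e] <;> linarith
      obtain ⟨s, hs⟩ : ∃ s : I, y (s, t) = w 1 := by
        rcases (habs t).lt_or_eq with hlt | heq
        · refine ⟨⟨1 - w 1 / (1 - |2 * (t : ℝ) - 1|), ?_, ?_⟩, ?_⟩
          · rw [sub_nonneg]; exact div_le_one_of_le₀ hle (by linarith)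
          · have : 0 ≤ w 1 / (1 - |2 * (t : ℝ) - 1|) := div_nonneg h1 (by linarith)
            linarith
          · have : (1 - |2 * (t : ℝ) - 1|) ≠ 0 := by linarith
            simp only [y]
            field_simp
            ring
        · refine ⟨0, ?_⟩
          have : w 1 = 0 := by linarith
          simp [y, heq, this]
      refine ⟨(s, t), ext3 _ _ hs ?_⟩
      rw [Q2, hs, ht]
      linarith) G.toContinuousMap (by
      rintro ⟨s, t⟩ ⟨s', t'⟩ h
      have e1 : y (s, t) = y (s', t') := by rw [← Q1, h, Q1]
      have e2 := Q2 (s, t)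
      rw [h, Q2, e1] at e2
      obtain rfl : t = t' := Subtype.ext (by simp at e2; linarith)
      have e3 : ((s' : ℝ) - s) * (1 - |2 * (t : ℝ) - 1|) = 0 := by simp only [y] at e1; linarith
      rcases mul_eq_zero.1 e3 with h | h
      · obtain rfl : s = s' := Subtype.ext (by linarith)
        rfl
      · have : t = 0 ∨ t = 1 := by
          rcases abs_cases (2 * (t : ℝ) - 1) with ⟨e, _⟩ | ⟨e, _⟩
          · right; exact Subtype.ext (show (t : ℝ) = 1 by linarith)
          · left; exact Subtype.ext (show (t : ℝ) = 0 by linarith)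
        rcases this with rfl | rfl
        · exact (G.source s).trans (G.source s').symm
        · exact (G.target s).trans (G.target s').symm)
  refine ⟨F, fun w t => ⟨fun h1 h2 => ?_, fun h1 h2 => ?_, fun h1 h2 => ?_⟩⟩
  · have e : Q (0, ⟨t / 2, by linarith [t.2.1], by linarith [t.2.2]⟩) = w := by
      have : y (0, ⟨t / 2, by linarith [t.2.1], by linarith [t.2.2]⟩) = t := by
        simp only [y, Set.Icc.coe_zero]
        rw [abs_of_nonpos (by linarith [t.2.2])]; ring
      refine ext3 _ _ (by rw [Q1, this, h2]) ?_
      rw [Q2, this, h1]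
      simp; ring
    rw [← e, hF]
    refine (G.apply_zero _).trans ?_
    change (p.trans q) _ = _
    rw [Path.trans_apply]
    simp only
    rw [dif_pos (by linarith [t.2.2])]
    congr 1
    exact Subtype.ext (by simp; ring)
  · have e : Q (0, ⟨(1 + t) / 2, by linarith [t.2.1], by linarith [t.2.2]⟩) = w := by
      have : y (0, ⟨(1 + t) / 2, by linarith [t.2.1], by linarith [t.2.2]⟩) = 1 - t := by
        simp only [y, Set.Icc.coe_zero]
        rw [abs_of_nonneg (by linarith [t.2.1])]; ring
      have hs := hsum w
      refine ext3 _ _ (by rw [Q1, this]; linarith) ?_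
      rw [Q2, this, h2]
      simp; ring
    rw [← e, hF]
    refine (G.apply_zero _).trans ?_
    change (p.trans q) _ = _
    rw [Path.trans_apply]
    simp only
    split_ifs with hh
    · have ht : t = 0 := Subtype.ext (show (t : ℝ) = 0 by linarith [t.2.1])
      subst ht
      simp
    · congr 1
      exact Subtype.ext (by simp; ring)
  · have e : Q (1, t) = w := by
      have : y (1, t) = 0 := by simp [y]
      refine ext3 _ _ (by rw [Q1, this, h1]) ?_
      rw [Q2, this, h2]
      ring
    rw [← e, hF]
    exact G.apply_one _

end TCSum

namespace TCSum

variable {M : Type*} [TopologicalSpace M]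

theorem exists_lift_through {Y : Type*} [TopologicalSpace Y] [SimplyConnectedSpace Y] {x₀ : M}
    (τ : C(Y, M)) (w₀ : Y) (s : Cov x₀) (hs : s.1 = τ w₀) :
    ∃ ℓ : Y → Cov x₀, IsLift ℓ ∧ (∀ w, (ℓ w).1 = τ w) ∧ ℓ w₀ = s := by
  obtain ⟨x, γ⟩ := s
  obtain rfl : x = τ w₀ := hs
  exact exists_lift τ w₀ γ

/-- Lifted singular simplices with `k` vertices. -/
def Lv (x₀ : M) (k : ℕ) : Type _ := {ℓ : Splx k → Cov x₀ // IsLift ℓ}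

namespace Lv

variable {x₀ : M} {k : ℕ}

/-- The face opposite to the vertex `i`. -/
def face (i : Fin (k + 1)) (ℓ : Lv x₀ (k + 1)) : Lv x₀ k := ⟨ℓ.1 ∘ δ i, ℓ.2.comp (δ i)⟩

/-- The underlying singular simplex. -/
def base (ℓ : Lv x₀ k) : C(Splx k, M) := ⟨fun w => (ℓ.1 w).1, ℓ.2.1⟩

instance : MulAction (Deck x₀) (Lv x₀ k) where
  smul g ℓ := ⟨fun w => g • ℓ.1 w, ℓ.2.smul g⟩
  one_smul ℓ := Subtype.ext (funext fun w => one_smul _ (ℓ.1 w))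
  mul_smul a b ℓ := Subtype.ext (funext fun w => mul_smul a b (ℓ.1 w))

theorem smul_val (g : Deck x₀) (ℓ : Lv x₀ k) (w : Splx k) : (g • ℓ).1 w = g • ℓ.1 w := rfl

theorem face_smul (g : Deck x₀) (i : Fin (k + 1)) (ℓ : Lv x₀ (k + 1)) :
    face i (g • ℓ) = g • face i ℓ := rfl

theorem base_smul (g : Deck x₀) (ℓ : Lv x₀ k) : base (g • ℓ) = base ℓ := rfl

theorem face_face {i j : Fin (k + 1)} (h : i ≤ j) (ℓ : Lv x₀ (k + 2)) :
    face i (face j.succ ℓ) = face j (face i.castSucc ℓ) :=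
  Subtype.ext (funext fun w => congrArg ℓ.1 (δ_comp_δ h w))

instance : Subsingleton (Lv x₀ 0) :=
  ⟨fun a b => Subtype.ext (funext fun w => absurd w.2.2 (by simp))⟩

theorem exists_smul_eq_of_base_eq {ℓ ℓ' : Lv x₀ k} (h : ℓ.base = ℓ'.base) :
    ∃ g : Deck x₀, g • ℓ = ℓ' := by
  cases k with
  | zero => exact ⟨1, Subsingleton.elim _ _⟩
  | succ k =>
    obtain ⟨g, hg⟩ := exists_smul_lift ℓ.2 ℓ'.2
      (fun w => congrArg (fun f : C(Splx (k + 1), M) => f w) h)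
    exact ⟨g, Subtype.ext hg⟩

theorem exists_base_eq [PathConnectedSpace M] (τ : C(Splx k, M)) : ∃ ℓ : Lv x₀ k, ℓ.base = τ := by
  cases k with
  | zero => exact ⟨⟨fun w => absurd w.2.2 (by simp), by
      refine ⟨continuous_of_const fun w => absurd w.2.2 (by simp), fun w => absurd w.2.2 (by simp)⟩⟩,
      ContinuousMap.ext fun w => absurd w.2.2 (by simp)⟩
  | succ k =>
    let v : Splx (k + 1) := stdSimplex.vertex 0
    obtain ⟨ℓ, h1, h2, -⟩ := exists_lift τ v
      (Path.Homotopic.Quotient.mk (PathConnectedSpace.somePath x₀ (τ v)))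
    exact ⟨⟨ℓ, h1⟩, ContinuousMap.ext h2⟩

/-- A compatible family of faces takes equal values at common points. -/
theorem val_eq_of_compatible {f : Fin (k + 2) → Lv x₀ (k + 1)}
    (hf : ∀ i j : Fin (k + 1), i ≤ j → face i (f j.succ) = face j (f i.castSucc))
    {i j : Fin (k + 2)} {w w' : Splx (k + 1)} (h : δ i w = δ j w') : (f i).1 w = (f j).1 w' := by
  have key : ∀ {i j : Fin (k + 2)} {w w' : Splx (k + 1)}, i < j → δ i w = δ j w' →
      (f i).1 w = (f j).1 w' := by
    intro i j w w' hij h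
    obtain ⟨a, rfl⟩ : ∃ a : Fin (k + 1), i = a.castSucc :=
      ⟨i.castPred (Fin.ne_last_of_lt hij), by simp⟩
    obtain ⟨b, rfl⟩ : ∃ b : Fin (k + 1), j = b.succ := ⟨j.pred (Fin.ne_zero_of_lt hij), by simp⟩
    have hab : a ≤ b := Fin.le_def.2 (by simpa [Fin.lt_def, Nat.lt_succ_iff] using hij)
    obtain ⟨u, rfl, rfl⟩ := exists_common_face hab h.symm
    exact (congrFun (congrArg Subtype.val (hf a b hab)) u).symm
  rcases lt_trichotomy i j with hij | rfl | hij
  · exact key hij h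
  · rw [δ_injective _ h]
  · exact (key hij h.symm).symm

/-- A singular simplex filling the bases of a compatible family lifts to a filling. -/
theorem exists_filling_of_base {f : Fin (k + 3) → Lv x₀ (k + 2)}
    (hf : ∀ i j : Fin (k + 2), i ≤ j → face i (f j.succ) = face j (f i.castSucc))
    (F : C(Splx (k + 3), M)) (hF : ∀ i w, F (δ i w) = ((f i).1 w).1) :
    ∃ L : Lv x₀ (k + 3), ∀ i, face i L = f i := by
  have hv : ∀ i : Fin (k + 3), i ≠ 0 → δ i (stdSimplex.vertex 0) = stdSimplex.vertex (S := ℝ) 0 := by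
    intro i hi
    rw [δ_vertex, Fin.succAbove_ne_zero_zero hi]
  obtain ⟨L, h1, h2, h3⟩ := exists_lift_through F (stdSimplex.vertex 0)
    ((f 1).1 (stdSimplex.vertex 0)) (by rw [← hF, hv 1 (by simp)])
  have main : ∀ i : Fin (k + 3), i ≠ 0 → L ∘ δ i = (f i).1 := by
    intro i hi
    refine (h1.comp (δ i)).eq_of_eq (f i).2 (fun w => by rw [← hF, ← h2]; rfl) (stdSimplex.vertex 0) ?_
    rw [Function.comp_apply, hv i hi, h3]
    exact val_eq_of_compatible hf ((hv 1 (by simp)).trans (hv i hi).symm)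
  refine ⟨⟨L, h1⟩, fun i => Subtype.ext ?_⟩
  by_cases hi : i = 0
  · subst hi
    refine (h1.comp (δ 0)).eq_of_eq (f 0).2 (fun w => by rw [← hF, ← h2]; rfl) (stdSimplex.vertex 0) ?_
    have e : δ 0 (stdSimplex.vertex 0) = δ (k := k + 2) 2 (stdSimplex.vertex 1) := by
      rw [δ_vertex, δ_vertex]
      congr 1
    have h22 : (2 : Fin (k + 3)) ≠ 0 := by simp [Fin.ext_iff, Nat.mod_eq_of_lt]
    have e2 := congrFun (main 2 h22) (stdSimplex.vertex 1)
    rw [Function.comp_apply] at e2 ⊢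
    rw [e, e2]
    exact val_eq_of_compatible hf e.symm
  · exact main i hi

/-- The standard parametrisation of the 1-simplex. -/
def edge (u : I) : Splx 2 :=
  ⟨![1 - u, u], fun i => by fin_cases i <;> simp [u.2.1, u.2.2], by simp [Fin.sum_univ_two]⟩

theorem continuous_edge : Continuous edge := by
  refine Continuous.subtype_mk (continuous_pi fun i => ?_) _
  fin_cases i
  · simp; fun_prop
  · simp; fun_prop

theorem edge_eq {w : Splx 2} {u : I} (h : w 1 = u) : edge u = w := by
  have h2 := w.2.2
  rw [Fin.sum_univ_two] at h2
  change w 0 + w 1 = 1 at h2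
  apply stdSimplex.ext
  funext i
  fin_cases i
  · change 1 - (u : ℝ) = w 0; linarith
  · exact h.symm

theorem edge_zero : edge 0 = stdSimplex.vertex 0 := edge_eq (by simp)

theorem edge_one : edge 1 = stdSimplex.vertex 1 := edge_eq (by simp)

theorem exists_path_of_edge (ℓ : Lv x₀ 2) {s t : Cov x₀} (hs : ℓ.1 (stdSimplex.vertex 0) = s)
    (ht : ℓ.1 (stdSimplex.vertex 1) = t) :
    ∃ p : Path s.1 t.1, (∀ u, p u = (ℓ.1 (edge u)).1) ∧
      t.2 = s.2.trans (Path.Homotopic.Quotient.mk p) := by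
  subst hs ht
  let e : Path (stdSimplex.vertex (S := ℝ) (0 : Fin 2)) (stdSimplex.vertex 1) :=
    ⟨⟨edge, continuous_edge⟩, edge_zero, edge_one⟩
  exact ⟨e.map ℓ.2.1, fun u => rfl, ℓ.2.2 _ _ e⟩

theorem eq_of_path_eq {s t t' : Cov x₀} {p : Path s.1 t.1} {q : Path s.1 t'.1}
    (hp : Path.Homotopic.Quotient.mk p = s.2.symm.trans t.2)
    (hq : t'.2 = s.2.trans (Path.Homotopic.Quotient.mk q)) (h : ∀ u, q u = p u) : t' = t := by
  have e : t'.1 = t.1 := by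
    have := h 1
    rwa [q.target, p.target] at this
  obtain ⟨x, γ⟩ := t
  obtain ⟨x', γ'⟩ := t'
  obtain rfl : x' = x := e
  obtain rfl : q = p := Path.ext (funext h)
  congr 1
  simp only at hq hp
  rw [hq, hp, ← Path.Homotopic.Quotient.trans_assoc]
  simp

theorem exists_edge (s t : Cov x₀) :
    ∃ L : Lv x₀ 2, L.1 (stdSimplex.vertex 0) = s ∧ L.1 (stdSimplex.vertex 1) = t := by
  obtain ⟨p, hp⟩ := Path.Homotopic.Quotient.mk_surjective (s.2.symm.trans t.2)
  have hw : ∀ w : Splx 2, w 1 ∈ I := fun w => ⟨w.2.1 1, stdSimplex.le_one w 1⟩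
  obtain ⟨L, h1, h2, h3⟩ := exists_lift_through (p.toContinuousMap.comp
    ⟨fun w : Splx 2 => ⟨w 1, hw w⟩, ((continuous_apply (1 : Fin 2)).comp
      continuous_subtype_val).subtype_mk _⟩) (stdSimplex.vertex 0) s (by
        change s.1 = p _
        refine p.source.symm.trans (congrArg p ?_)
        exact Subtype.ext (by simp))
  refine ⟨⟨L, h1⟩, h3, ?_⟩
  obtain ⟨q, hq1, hq2⟩ := exists_path_of_edge ⟨L, h1⟩ h3 rfl
  exact eq_of_path_eq hp hq2 fun u => by rw [hq1, h2]; rfl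

theorem exists_filling (hM : ∀ k, 2 ≤ k → ∀ x : M, Subsingleton (HomotopyGroup (Fin k) M x))
    {f : Fin (k + 2) → Lv x₀ (k + 1)}
    (hf : ∀ i j : Fin (k + 1), i ≤ j → face i (f j.succ) = face j (f i.castSucc)) :
    ∃ L : Lv x₀ (k + 2), ∀ i, face i L = f i := by
  match k with
  | 0 =>
    obtain ⟨L, h0, h1⟩ := exists_edge ((f 1).1 (stdSimplex.vertex 0)) ((f 0).1 (stdSimplex.vertex 0))
    refine ⟨L, fun i => Subtype.ext (funext fun w => ?_)⟩
    obtain rfl : w = stdSimplex.vertex 0 := Subsingleton.elim _ _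
    change L.1 (δ i _) = _
    rw [δ_vertex]
    fin_cases i
    · exact h1
    · exact h0
  | 1 =>
    have v0 : (f 2).1 (stdSimplex.vertex 0) = (f 1).1 (stdSimplex.vertex 0) :=
      val_eq_of_compatible hf (by rw [δ_vertex, δ_vertex]; rfl)
    have v1 : (f 2).1 (stdSimplex.vertex 1) = (f 0).1 (stdSimplex.vertex 0) :=
      val_eq_of_compatible hf (by rw [δ_vertex, δ_vertex]; rfl)
    have v2 : (f 0).1 (stdSimplex.vertex 1) = (f 1).1 (stdSimplex.vertex 1) :=
      val_eq_of_compatible hf (by rw [δ_vertex, δ_vertex]; rfl)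
    obtain ⟨p, p1, p2⟩ := exists_path_of_edge (f 2) v0 v1
    obtain ⟨q, q1, q2⟩ := exists_path_of_edge (f 0) rfl v2
    obtain ⟨r, r1, r2⟩ := exists_path_of_edge (f 1) rfl rfl
    have hpqr : (p.trans q).Homotopic r := by
      rw [← Path.Homotopic.Quotient.eq, Path.Homotopic.Quotient.mk_trans]
      refine trans_left_cancel (a := ((f 1).1 (stdSimplex.vertex 0)).2) ?_
      rw [← r2, ← Path.Homotopic.Quotient.trans_assoc, ← p2, ← q2]
    obtain ⟨F, hF⟩ := exists_triangle p q r hpqr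
    refine exists_filling_of_base hf F fun i w => ?_
    let t : I := ⟨w 1, w.2.1 1, stdSimplex.le_one w 1⟩
    have ht : w 1 = t := rfl
    have hz := δ_apply_self i w
    have h3 := δ_apply_succAbove i w 1
    rw [ht] at h3
    rw [← edge_eq ht] at hz h3 ⊢
    fin_cases i
    · exact ((hF _ t).2.1 hz h3).trans (q1 t)
    · exact ((hF _ t).2.2 hz h3).trans (r1 t)
    · exact ((hF _ t).1 hz h3).trans (p1 t)
  | k + 2 =>
    let Q : C(Σ _ : Fin (k + 4), Splx (k + 3), {w : Splx (k + 4) // ∃ i, w i = 0}) :=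
      ⟨fun z => ⟨δ z.1 z.2, z.1, δ_apply_self _ _⟩, by
        refine continuous_sigma fun i => ?_
        exact (δ i).continuous.subtype_mk _⟩
    obtain ⟨g, hg⟩ := exists_descend Q (by
        rintro ⟨w, i, hi⟩
        obtain ⟨u, rfl⟩ := exists_δ_eq i w hi
        exact ⟨⟨i, u⟩, rfl⟩) ⟨fun z => ((f z.1).1 z.2).1, continuous_sigma fun i => (f i).2.1⟩ (by
        rintro ⟨i, w⟩ ⟨j, w'⟩ h
        exact congrArg Sigma.fst (val_eq_of_compatible hf (congrArg Subtype.val h)))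
    obtain ⟨F, hF⟩ := extend_simplex (k + 2) (by omega) (hM (k + 2) (by omega)) g
    refine exists_filling_of_base hf F fun i w => ?_
    exact (hF (Q ⟨i, w⟩)).trans (hg ⟨i, w⟩)

end Lv

end TCSum

namespace TCSum

/-! ### Equivariant models of ordered chains of a group -/

/-- The data of an augmented equivariant complex with a contraction. -/
structure ContractibleComplex (G : Type*) [Group G] (E : Type*) [AddCommGroup E] [Module ℚ E] where
  /-- the group action -/
  ρ : G → E →ₗ[ℚ] E
  /-- the differential -/
  bd : E →ₗ[ℚ] E
  /-- the contraction -/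
  K : E →ₗ[ℚ] E
  /-- the generator of the bottom degree -/
  e : E
  ρ_one : ∀ w, ρ 1 w = w
  ρ_mul : ∀ g h w, ρ (g * h) w = ρ g (ρ h w)
  bd_ρ : ∀ g w, bd (ρ g w) = ρ g (bd w)
  bd_K : ∀ w, bd (K w) = w - K (bd w)
  ρ_e : ∀ g, ρ g e = e
  bd_e : bd e = 0

namespace ContractibleComplex

variable {G : Type*} [Group G] {E : Type*} [AddCommGroup E] [Module ℚ E]
  (D : ContractibleComplex G E)

/-- The translate of the contraction by a group element. -/
def conj (g : G) : E →ₗ[ℚ] E := D.ρ g ∘ₗ D.K ∘ₗ D.ρ g⁻¹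

theorem bd_conj (g : G) (w : E) : D.bd (D.conj g w) = w - D.conj g (D.bd w) := by
  simp only [conj, LinearMap.comp_apply, D.bd_ρ, D.bd_K, map_sub]
  rw [← D.ρ_mul, mul_inv_cancel, D.ρ_one]

theorem conj_mul (h g : G) (w : E) : D.conj (h * g) (D.ρ h w) = D.ρ h (D.conj g w) := by
  simp only [conj, LinearMap.comp_apply, D.ρ_mul]
  rw [← D.ρ_mul _ h, mul_inv_rev, inv_mul_cancel_right]

/-- The average of the contractions attached to the entries of a list. -/
def avg (l : List G) : E →ₗ[ℚ] E := (l.length : ℚ)⁻¹ • (l.map D.conj).sum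

theorem avg_perm {l l' : List G} (h : l.Perm l') : D.avg l = D.avg l' := by
  rw [avg, avg, h.length_eq, (h.map D.conj).sum_eq]

theorem bd_avg (l : List G) (hl : l ≠ []) (w : E) :
    D.bd (D.avg l w) = w - D.avg l (D.bd w) := by
  have key : ∀ l : List G, D.bd ((l.map D.conj).sum w) =
      (l.length : ℚ) • w - (l.map D.conj).sum (D.bd w) := by
    intro l
    induction l with
    | nil => simp
    | cons a l ih =>
      simp only [List.map_cons, List.sum_cons, LinearMap.add_apply, map_add, ih, D.bd_conj,
        List.length_cons, Nat.cast_add, Nat.cast_one, add_smul, one_smul]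
      abel
  have h0 : (l.length : ℚ) ≠ 0 := by simpa using hl
  simp only [avg, LinearMap.smul_apply, map_smul, key, smul_sub, smul_smul, inv_mul_cancel₀ h0,
    one_smul]

theorem avg_map_mul (h : G) (l : List G) (w : E) :
    D.avg (l.map (h * ·)) (D.ρ h w) = D.ρ h (D.avg l w) := by
  simp only [avg, LinearMap.smul_apply, map_smul, List.length_map]
  congr 1
  induction l with
  | nil => simp
  | cons a l ih =>
    simp only [List.map_cons, List.sum_cons, LinearMap.add_apply, map_add, ih, D.conj_mul]

/-- The augmentation at the bottom degree. -/
def bottom : Ch G →ₗ[ℚ] E := ext fun l => if l = [] then D.e else 0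

/-- The equivariant chain map from ordered chains of the group. -/
def R (k : ℕ) : Ch G →ₗ[ℚ] E := model D.avg D.bottom k

theorem R_zero_bas (l : List G) : D.R 0 (bas l) = if l = [] then D.e else 0 := ext_bas _ _

theorem R_succ_bas (k : ℕ) (l : List G) : D.R (k + 1) (bas l) = D.avg l (D.R k (dl l)) :=
  model_succ_bas _ _ _ _

theorem bd_R (k : ℕ) (w : Ch G) : D.bd (D.R (k + 1) w) = D.R k (d w) := by
  refine bd_model D.bd D.avg D.bd_avg D.bottom (fun w => ?_) k w
  have : D.bd ∘ₗ D.bottom = 0 := lin_ext fun l => by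
    rw [LinearMap.comp_apply, bottom, ext_bas]
    split_ifs <;> simp [D.bd_e]
  exact congrArg (fun f => f (d w)) this

theorem R_mp (k : ℕ) (g : G) (w : Ch G) : D.R k (mp (g * ·) w) = D.ρ g (D.R k w) := by
  have : D.R k ∘ₗ mp (g * ·) = D.ρ g ∘ₗ D.R k := by
    induction k with
    | zero =>
      refine lin_ext fun l => ?_
      rw [LinearMap.comp_apply, LinearMap.comp_apply, mp_bas, R_zero_bas, R_zero_bas]
      by_cases h : l = [] <;> simp [h, D.ρ_e]
    | succ k ih =>
      refine lin_ext fun l => ?_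
      rw [LinearMap.comp_apply, LinearMap.comp_apply, mp_bas, R_succ_bas, R_succ_bas, ← d_bas,
        ← mp_bas, d_mp, ← D.avg_map_mul, ← d_bas]
      congr 1
      exact congrArg (fun f => f (d (bas l))) ih
  exact congrArg (fun f => f w) this

theorem R_alt (k : ℕ) {w : Ch G} (hw : w ∈ Alt G) : D.R k w = 0 := by
  induction k generalizing w with
  | zero =>
    induction hw using Submodule.span_induction with
    | mem x hx =>
      obtain ⟨l, l', h, rfl⟩ := hx
      rw [map_add, R_zero_bas, R_zero_bas]
      cases h <;> simp
    | zero => simp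
    | add x y _ _ hx hy => simp [hx, hy]
    | smul a x _ hx => simp [hx]
  | succ k ih =>
    induction hw using Submodule.span_induction with
    | mem x hx =>
      obtain ⟨l, l', h, rfl⟩ := hx
      rw [map_add, R_succ_bas, R_succ_bas, D.avg_perm h.perm, ← map_add, ← map_add,
        ih (d_swap_mem_alt h), map_zero]
    | zero => simp
    | add x y _ _ hx hy => simp [hx, hy]
    | smul a x _ hx => simp [hx]

/-- The ordered cochain obtained from an invariant cocycle on the complex. -/
def cochain (μ : E →ₗ[ℚ] ℚ) (k : ℕ) : Ch G →ₗ[ℚ] ℚ := μ ∘ₗ D.R k ∘ₗ proj k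

variable {μ : E →ₗ[ℚ] ℚ}

theorem cochain_mp (hμ : ∀ g w, μ (D.ρ g w) = μ w) (k : ℕ) (g : G) (w : Ch G) :
    D.cochain μ k (mp (g * ·) w) = D.cochain μ k w := by
  simp only [cochain, LinearMap.comp_apply, proj_mp, R_mp, hμ]

theorem cochain_d (hμ : ∀ w, μ (D.bd w) = 0) (k : ℕ) (w : Ch G) : D.cochain μ k (d w) = 0 := by
  simp only [cochain, LinearMap.comp_apply, proj_d, ← bd_R, hμ]

theorem cochain_of_length_ne {k : ℕ} {l : List G} (h : l.length ≠ k) :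
    D.cochain μ k (bas l) = 0 := by
  simp [cochain, proj_bas, h]

theorem cochain_of_length {k : ℕ} {l : List G} (h : l.length = k) :
    D.cochain μ k (bas l) = μ (D.R k (bas l)) := by
  simp [cochain, proj_bas, h]

theorem cochain_of_not_nodup {k : ℕ} {l : List G} (h : ¬ l.Nodup) :
    D.cochain μ k (bas l) = 0 := by
  by_cases hk : l.length = k
  · rw [D.cochain_of_length hk, D.R_alt k (bas_mem_alt_of_not_nodup h), map_zero]
  · exact D.cochain_of_length_ne hk

end ContractibleComplex

end TCSum

namespace TCSum

variable {M : Type*} [TopologicalSpace M]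

/-- Chains of lifted singular simplices, in all degrees at once. -/
abbrev LCh (x₀ : M) : Type _ := (Σ k, Lv x₀ k) →₀ ℚ

variable {x₀ : M}

/-- A lifted simplex as a chain. -/
abbrev smp {k : ℕ} (ℓ : Lv x₀ k) : LCh x₀ := Finsupp.single ⟨k, ℓ⟩ 1

/-- The boundary of a lifted simplex. -/
def lbdl : (Σ k, Lv x₀ k) → LCh x₀
  | ⟨0, _⟩ => 0
  | ⟨k + 1, ℓ⟩ => ∑ i : Fin (k + 1), (-1 : ℚ) ^ (i : ℕ) • smp (ℓ.face i)

/-- The augmented boundary operator. -/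
def lbd : LCh x₀ →ₗ[ℚ] LCh x₀ := ext lbdl

theorem lbd_zero (ℓ : Lv x₀ 0) : lbd (smp ℓ) = 0 := ext_bas _ _

theorem lbd_succ {k : ℕ} (ℓ : Lv x₀ (k + 1)) :
    lbd (smp ℓ) = ∑ i : Fin (k + 1), (-1 : ℚ) ^ (i : ℕ) • smp (ℓ.face i) := ext_bas _ _

theorem lin_ext_smp {C : Type*} [AddCommGroup C] [Module ℚ C] {f g : LCh x₀ →ₗ[ℚ] C}
    (h : ∀ k (ℓ : Lv x₀ k), f (smp ℓ) = g (smp ℓ)) : f = g :=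
  lin_ext fun a => h a.1 a.2

/-- Restriction of a lifted simplex along a map of vertices. -/
def Lv.pull {m k : ℕ} (ℓ : Lv x₀ m) (v : Fin k → Fin m) : Lv x₀ k :=
  ⟨ℓ.1 ∘ stdSimplex.map v, ℓ.2.comp ⟨_, stdSimplex.continuous_map v⟩⟩

theorem Lv.pull_id {m : ℕ} (ℓ : Lv x₀ m) : ℓ.pull id = ℓ :=
  Subtype.ext (funext fun w => congrArg ℓ.1 (stdSimplex.map_id_apply w))

theorem Lv.face_pull {m k : ℕ} (ℓ : Lv x₀ m) (v : Fin (k + 1) → Fin m) (i : Fin (k + 1)) :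
    (ℓ.pull v).face i = ℓ.pull (v ∘ i.succAbove) :=
  Subtype.ext (funext fun w => congrArg ℓ.1 (stdSimplex.map_comp_apply _ _ w))

/-- Ordered chains on the vertices of a lifted simplex map to lifted chains. -/
def Lv.simplices {m : ℕ} (ℓ : Lv x₀ m) : Ch (Fin m) →ₗ[ℚ] LCh x₀ :=
  ext fun l => smp (ℓ.pull (List.equivSigmaTuple l).2)

theorem Lv.simplices_ofFn {m k : ℕ} (ℓ : Lv x₀ m) (v : Fin k → Fin m) :
    ℓ.simplices (bas (List.ofFn v)) = smp (ℓ.pull v) := by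
  have h : List.equivSigmaTuple (List.ofFn v) = ⟨k, v⟩ := List.equivSigmaTuple.right_inv ⟨k, v⟩
  rw [Lv.simplices, ext_bas, h]

theorem Lv.lbd_simplices {m : ℕ} (ℓ : Lv x₀ m) (w : Ch (Fin m)) :
    lbd (ℓ.simplices w) = ℓ.simplices (d w) := by
  have : lbd ∘ₗ ℓ.simplices = ℓ.simplices ∘ₗ d := lin_ext fun l => by
    obtain ⟨⟨k, v⟩, rfl⟩ := List.equivSigmaTuple.symm.surjective l
    change lbd (ℓ.simplices (bas (List.ofFn v))) = ℓ.simplices (d (bas (List.ofFn v)))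
    rw [Lv.simplices_ofFn]
    cases k with
    | zero => rw [lbd_zero]; simp [dl]
    | succ k =>
      rw [lbd_succ, d_bas, dl_ofFn, map_sum]
      refine Finset.sum_congr rfl fun i _ => ?_
      rw [map_smul, Lv.simplices_ofFn, Lv.face_pull]
  exact congrArg (fun f => f w) this

theorem lbd_lbd (w : LCh x₀) : lbd (lbd w) = 0 := by
  have : (lbd ∘ₗ lbd : LCh x₀ →ₗ[ℚ] LCh x₀) = 0 := lin_ext_smp fun k ℓ => by
    rw [LinearMap.comp_apply, ← ℓ.pull_id, ← ℓ.simplices_ofFn, ℓ.lbd_simplices, ℓ.lbd_simplices,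
      d_d, map_zero, LinearMap.zero_apply]
  exact congrArg (fun f => f w) this

/-- The action of the deck group on lifted chains. -/
def lact (g : Deck x₀) : LCh x₀ →ₗ[ℚ] LCh x₀ := ext fun p => smp (g • p.2)

theorem lact_smp (g : Deck x₀) {k : ℕ} (ℓ : Lv x₀ k) : lact g (smp ℓ) = smp (g • ℓ) := ext_bas _ _

theorem lbd_lact (g : Deck x₀) (w : LCh x₀) : lbd (lact g w) = lact g (lbd w) := by
  have : lbd ∘ₗ lact g = lact g ∘ₗ lbd := lin_ext_smp fun k ℓ => by
    rw [LinearMap.comp_apply, LinearMap.comp_apply, lact_smp]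
    cases k with
    | zero => rw [lbd_zero, lbd_zero, map_zero]
    | succ k => simp only [lbd_succ, map_sum, map_smul, lact_smp, Lv.face_smul]
  exact congrArg (fun f => f w) this

theorem Lv.exists_point (x₀ : M) : ∃ _ : Lv x₀ 1, True := by
  obtain ⟨ℓ, h, -⟩ := exists_lift_through (ContinuousMap.const (Splx 1) x₀) (stdSimplex.vertex 0)
    ⟨x₀, Path.Homotopic.Quotient.refl x₀⟩ rfl
  exact ⟨⟨ℓ, h⟩, trivial⟩

open Classical in
/-- The contraction of lifted simplices, joining them to a base point. -/
def Lv.join : ∀ k, Lv x₀ k → Lv x₀ (k + 1)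
  | 0, _ => (Lv.exists_point x₀).choose
  | k + 1, ℓ =>
    if h : ∃ L : Lv x₀ (k + 2), ∀ i : Fin (k + 2), L.face i =
      (Fin.cons ℓ fun i => Lv.join k (ℓ.face i) : Fin (k + 2) → Lv x₀ (k + 1)) i
    then h.choose else ℓ.pull (Function.const _ 0)

theorem Lv.join_spec (hM : ∀ k, 2 ≤ k → ∀ x : M, Subsingleton (HomotopyGroup (Fin k) M x)) (k : ℕ) :
    (∀ ℓ : Lv x₀ k, (Lv.join k ℓ).face 0 = ℓ) ∧
    ∀ (ℓ : Lv x₀ (k + 1)), (∀ i : Fin (k + 2), (Lv.join (k + 1) ℓ).face i =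
      (Fin.cons ℓ fun i => Lv.join k (ℓ.face i) : Fin (k + 2) → Lv x₀ (k + 1)) i) := by
  have step : ∀ ℓ : Lv x₀ (k + 1), (∃ L : Lv x₀ (k + 2), ∀ i : Fin (k + 2), L.face i =
      (Fin.cons ℓ fun i => Lv.join k (ℓ.face i) : Fin (k + 2) → Lv x₀ (k + 1)) i) →
      ∀ i : Fin (k + 2), (Lv.join (k + 1) ℓ).face i =
      (Fin.cons ℓ fun i => Lv.join k (ℓ.face i) : Fin (k + 2) → Lv x₀ (k + 1)) i := by
    intro ℓ h
    rw [Lv.join, dif_pos h]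
    exact h.choose_spec
  induction k with
  | zero =>
    refine ⟨fun ℓ => Subsingleton.elim _ _, fun ℓ => step ℓ (Lv.exists_filling hM ?_)⟩
    intro i j _
    exact Subsingleton.elim _ _
  | succ k ih =>
    have ih := ih (fun ℓ h => by rw [Lv.join, dif_pos h]; exact h.choose_spec)
    have h0 : ∀ ℓ : Lv x₀ (k + 1), (Lv.join (k + 1) ℓ).face 0 = ℓ := fun ℓ => ih.2 ℓ 0
    have hs : ∀ (ℓ : Lv x₀ (k + 1)) (i : Fin (k + 1)),
        (Lv.join (k + 1) ℓ).face i.succ = Lv.join k (ℓ.face i) := fun ℓ i => ih.2 ℓ i.succ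
    refine ⟨h0, fun ℓ => step ℓ (Lv.exists_filling hM ?_)⟩
    intro i j hij
    rw [Fin.cons_succ]
    induction i using Fin.cases with
    | zero => rw [h0]; rfl
    | succ i =>
      induction j using Fin.cases with
      | zero => exact absurd hij (by simp)
      | succ j =>
        rw [hs, ← Fin.succ_castSucc, Fin.cons_succ, hs, Lv.face_face (Fin.succ_le_succ_iff.1 hij)]

/-- The contraction on chains. -/
def ljoin : LCh x₀ →ₗ[ℚ] LCh x₀ := ext fun p => smp (Lv.join p.1 p.2)

theorem ljoin_smp {k : ℕ} (ℓ : Lv x₀ k) : ljoin (smp ℓ) = smp (Lv.join k ℓ) := ext_bas _ _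

theorem lbd_ljoin (hM : ∀ k, 2 ≤ k → ∀ x : M, Subsingleton (HomotopyGroup (Fin k) M x))
    (w : LCh x₀) : lbd (ljoin w) = w - ljoin (lbd w) := by
  have : (lbd ∘ₗ ljoin : LCh x₀ →ₗ[ℚ] LCh x₀) =
      LinearMap.id - ljoin ∘ₗ lbd := lin_ext_smp fun k ℓ => by
    rw [LinearMap.sub_apply, LinearMap.comp_apply, LinearMap.comp_apply, LinearMap.id_apply,
      ljoin_smp, lbd_succ, Fin.sum_univ_succ, (Lv.join_spec hM k).1 ℓ]
    cases k with
    | zero => simp [lbd_zero]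
    | succ k =>
      simp only [(Lv.join_spec hM k).2 ℓ, lbd_succ, map_sum, map_smul, ljoin_smp, Fin.cons_succ,
        Fin.val_zero, pow_zero, one_smul, Fin.val_succ, pow_succ, mul_neg, mul_one, neg_smul,
        Finset.sum_neg_distrib, ← sub_eq_add_neg]
  exact congrArg (fun f => f w) this

/-- The empty lifted simplex. -/
def Lv.empty (x₀ : M) : Lv x₀ 0 := (Lv.exists_point x₀).choose.face 0

/-- Lifted chains of an aspherical space form an equivariantly contractible complex. -/
def liftedComplex (x₀ : M) (hM : ∀ k, 2 ≤ k → ∀ x : M, Subsingleton (HomotopyGroup (Fin k) M x)) :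
    ContractibleComplex (Deck x₀) (LCh x₀) where
  ρ := lact
  bd := lbd
  K := ljoin
  e := smp (Lv.empty x₀)
  ρ_one w := by
    have : lact (1 : Deck x₀) = LinearMap.id := lin_ext_smp fun k ℓ => by
      rw [lact_smp, one_smul, LinearMap.id_apply]
    exact congrArg (fun f => f w) this
  ρ_mul g h w := by
    have : lact (g * h) = lact g ∘ₗ lact h := lin_ext_smp fun k ℓ => by
      rw [LinearMap.comp_apply, lact_smp, lact_smp, lact_smp, mul_smul]
    exact congrArg (fun f => f w) this
  bd_ρ := lbd_lact
  bd_K := lbd_ljoin hM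
  ρ_e g := by
    rw [lact_smp]
    congr 2
    exact Subsingleton.elim _ _
  bd_e := lbd_zero _

end TCSum

namespace TCSum

namespace ContractibleComplex

variable {G : Type*} [Group G] {E : Type*} [AddCommGroup E] [Module ℚ E]
  (D : ContractibleComplex G E)

/-- The chain maps `R k`, assembled over all lengths. -/
def total : Ch G →ₗ[ℚ] E := ext fun l => D.R l.length (bas l)

theorem total_of_proj {k : ℕ} {w : Ch G} (h : proj k w = w) : D.total w = D.R k w := by
  have : D.total ∘ₗ proj k = D.R k ∘ₗ proj k := lin_ext fun l => by
    rw [LinearMap.comp_apply, LinearMap.comp_apply, proj_bas]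
    split_ifs with hl
    · rw [total, ext_bas, hl]
    · simp
  rw [← h]
  exact congrArg (fun f => f w) this

theorem bd_total (w : Ch G) : D.bd (D.total w) = D.total (d w) := by
  have : D.bd ∘ₗ D.total = D.total ∘ₗ d := lin_ext fun l => by
    rw [LinearMap.comp_apply, LinearMap.comp_apply, total, ext_bas, ← total]
    cases l with
    | nil => simp [R_zero_bas, D.bd_e, dl]
    | cons a l =>
      rw [List.length_cons, bd_R, d_bas]
      exact (D.total_of_proj (by simp [proj_dl])).symm
  exact congrArg (fun f => f w) this

theorem total_mp (g : G) (w : Ch G) : D.total (mp (g * ·) w) = D.ρ g (D.total w) := by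
  have : D.total ∘ₗ mp (g * ·) = D.ρ g ∘ₗ D.total := lin_ext fun l => by
    rw [LinearMap.comp_apply, LinearMap.comp_apply, mp_bas, total, ext_bas, ext_bas,
      List.length_map, ← R_mp, mp_bas]
  exact congrArg (fun f => f w) this

theorem cochain_eq_total (μ : E →ₗ[ℚ] ℚ) {k : ℕ} {w : Ch G} (h : proj k w = w) :
    D.cochain μ k w = μ (D.total w) := by
  rw [D.total_of_proj h, cochain, LinearMap.comp_apply, LinearMap.comp_apply, h]

end ContractibleComplex

variable {M : Type*} [TopologicalSpace M] {x₀ : M}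

/-- An equivariant augmented chain map from lifted chains to ordered chains of the cover. -/
structure VertexMap (V : LCh x₀ →ₗ[ℚ] Ch (Cov x₀)) : Prop where
  d_eq : ∀ w, d (V w) = V (lbd w)
  empty : V (smp (Lv.empty x₀)) = bas []
  smul : ∀ g w, V (lact g w) = mp (g • ·) (V w)

/-- A lifted chain whose boundary vanishes modulo the deck group. -/
def LCycle (w : LCh x₀) : Prop :=
  ∀ B : LCh x₀ →ₗ[ℚ] ℚ, (∀ g v, B (lact g v) = B v) → B (lbd w) = 0

theorem LCycle.cycleMod {V : LCh x₀ →ₗ[ℚ] Ch (Cov x₀)} (hV : VertexMap V) {w : LCh x₀}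
    (hw : LCycle w) : CycleMod (fun (g : Deck x₀) s => g • s) (V w) := fun b hb => by
  rw [hV.d_eq]
  exact hw (b ∘ₗ V) fun g v => by rw [LinearMap.comp_apply, hV.smul]; exact hb g (V v)

section Homotopy

variable (hM : ∀ k, 2 ≤ k → ∀ x : M, Subsingleton (HomotopyGroup (Fin k) M x))
  (ψ : Cov x₀ → Deck x₀) (V : LCh x₀ →ₗ[ℚ] Ch (Cov x₀))

/-- The self-map of lifted chains factoring through ordered chains of the deck group. -/
def roundTrip : LCh x₀ →ₗ[ℚ] LCh x₀ := (liftedComplex x₀ hM).total ∘ₗ mp ψ ∘ₗ V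

/-- The homotopy between the identity and `roundTrip`, on simplices. -/
def homotopyAux : ∀ k, Lv x₀ k → LCh x₀
  | 0, _ => 0
  | k + 1, ℓ => (liftedComplex x₀ hM).conj (ψ (ℓ.1 (stdSimplex.vertex 0)))
      (smp ℓ - roundTrip hM ψ V (smp ℓ)
        - ∑ i : Fin (k + 1), (-1 : ℚ) ^ (i : ℕ) • homotopyAux k (ℓ.face i))

/-- The homotopy between the identity and `roundTrip`. -/
def homotopy : LCh x₀ →ₗ[ℚ] LCh x₀ := ext fun p => homotopyAux hM ψ V p.1 p.2

theorem homotopy_smp {k : ℕ} (ℓ : Lv x₀ k) :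
    homotopy hM ψ V (smp ℓ) = homotopyAux hM ψ V k ℓ := ext_bas _ _

theorem homotopy_succ {k : ℕ} (ℓ : Lv x₀ (k + 1)) :
    homotopy hM ψ V (smp ℓ) = (liftedComplex x₀ hM).conj (ψ (ℓ.1 (stdSimplex.vertex 0)))
      (smp ℓ - roundTrip hM ψ V (smp ℓ) - homotopy hM ψ V (lbd (smp ℓ))) := by
  rw [homotopy_smp, homotopyAux, lbd_succ, map_sum]
  simp only [map_smul, homotopy_smp]

variable {V}

theorem lbd_roundTrip (hV : VertexMap V) (w : LCh x₀) :
    lbd (roundTrip hM ψ V w) = roundTrip hM ψ V (lbd w) := by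
  simp only [roundTrip, LinearMap.comp_apply]
  rw [← hV.d_eq, ← d_mp]
  exact (liftedComplex x₀ hM).bd_total _

theorem lbd_homotopy (hV : VertexMap V) (w : LCh x₀) :
    lbd (homotopy hM ψ V w) = w - roundTrip hM ψ V w - homotopy hM ψ V (lbd w) := by
  have : (lbd ∘ₗ homotopy hM ψ V : LCh x₀ →ₗ[ℚ] LCh x₀) =
      LinearMap.id - roundTrip hM ψ V - homotopy hM ψ V ∘ₗ lbd := lin_ext_smp fun k ℓ => by
    simp only [LinearMap.sub_apply, LinearMap.comp_apply, LinearMap.id_apply]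
    induction k with
    | zero =>
      obtain rfl : ℓ = Lv.empty x₀ := Subsingleton.elim _ _
      rw [homotopy_smp, homotopyAux, lbd_zero, roundTrip, LinearMap.comp_apply,
        LinearMap.comp_apply, hV.empty, mp_bas, ContractibleComplex.total, ext_bas]
      simp [ContractibleComplex.R_zero_bas, liftedComplex]
    | succ k ih =>
      have ih' : lbd (homotopy hM ψ V (lbd (smp ℓ))) =
          lbd (smp ℓ) - roundTrip hM ψ V (lbd (smp ℓ)) - homotopy hM ψ V (lbd (lbd (smp ℓ))) := by
        simp only [lbd_succ ℓ, map_sum, map_smul, ih, ← Finset.sum_sub_distrib, smul_sub]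
      rw [lbd_lbd, map_zero, sub_zero] at ih'
      rw [homotopy_succ]
      refine ((liftedComplex x₀ hM).bd_conj _ _).trans ?_
      change _ - (liftedComplex x₀ hM).conj _ (lbd _) = _
      rw [map_sub lbd, map_sub lbd, ih', lbd_roundTrip hM ψ hV, sub_self, map_zero, sub_zero]
  exact congrArg (fun f => f w) this

variable {ψ}

theorem roundTrip_lact (hV : VertexMap V) (hψ : ∀ g s, ψ (g • s) = g * ψ s) (g : Deck x₀)
    (w : LCh x₀) : roundTrip hM ψ V (lact g w) = lact g (roundTrip hM ψ V w) := by
  simp only [roundTrip, LinearMap.comp_apply]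
  rw [hV.smul, mp_mp]
  have : ψ ∘ (g • ·) = (g * ·) ∘ ψ := funext fun s => hψ g s
  rw [this, ← mp_mp]
  exact (liftedComplex x₀ hM).total_mp g _

theorem homotopy_lact (hV : VertexMap V) (hψ : ∀ g s, ψ (g • s) = g * ψ s) (g : Deck x₀)
    (w : LCh x₀) : homotopy hM ψ V (lact g w) = lact g (homotopy hM ψ V w) := by
  have : homotopy hM ψ V ∘ₗ lact g = lact g ∘ₗ homotopy hM ψ V := lin_ext_smp fun k ℓ => by
    simp only [LinearMap.comp_apply]
    induction k with
    | zero => rw [lact_smp, homotopy_smp, homotopy_smp, homotopyAux, homotopyAux, map_zero]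
    | succ k ih =>
      have ih' : homotopy hM ψ V (lact g (lbd (smp ℓ))) = lact g (homotopy hM ψ V (lbd (smp ℓ))) := by
        simp only [lbd_succ ℓ, map_sum, map_smul, ih]
      rw [lact_smp, homotopy_succ, homotopy_succ, ← lact_smp, lbd_lact, ih',
        roundTrip_lact hM hV hψ, ← map_sub, ← map_sub, Lv.smul_val, hψ]
      exact (liftedComplex x₀ hM).conj_mul _ _ _
  exact congrArg (fun f => f w) this

theorem cochain_vertexMap (hV : VertexMap V) (hψ : ∀ g s, ψ (g • s) = g * ψ s)
    {μ : LCh x₀ →ₗ[ℚ] ℚ} (hμ : ∀ g w, μ (lact g w) = μ w) (hμd : ∀ w, μ (lbd w) = 0) {w : LCh x₀}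
    (hw : LCycle w) {k : ℕ} (hk : proj k (V w) = V w) :
    (liftedComplex x₀ hM).cochain μ k (mp ψ (V w)) = μ w := by
  rw [ContractibleComplex.cochain_eq_total _ _ (by rw [proj_mp, hk])]
  have h1 := congrArg μ (lbd_homotopy hM ψ hV w)
  have h2 := hw (μ ∘ₗ homotopy hM ψ V) fun g v => by
    rw [LinearMap.comp_apply, homotopy_lact hM hV hψ, hμ]; rfl
  rw [LinearMap.comp_apply] at h2
  rw [hμd, map_sub, map_sub, h2, sub_zero] at h1
  exact (sub_eq_zero.1 h1.symm).symm

end Homotopy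

/-! ### Lifting chains -/

/-- Singular chains of a fixed dimension. -/
abbrev SCh (k : ℕ) (M : Type*) [TopologicalSpace M] := C(Splx k, M) →₀ ℚ

/-- The boundary of singular chains. -/
def sbd (k : ℕ) : SCh (k + 1) M →ₗ[ℚ] SCh k M :=
  ext fun τ => ∑ i : Fin (k + 1), (-1 : ℚ) ^ (i : ℕ) • Finsupp.single (τ.comp (δ i)) 1

/-- The functional on lifted chains induced by a singular cochain. -/
def liftFun (x₀ : M) {k : ℕ} (μ : SCh k M →ₗ[ℚ] ℚ) : LCh x₀ →ₗ[ℚ] ℚ :=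
  ext fun p => if h : p.1 = k then μ (Finsupp.single (h ▸ p.2).base 1) else 0

theorem liftFun_smp {k : ℕ} (μ : SCh k M →ₗ[ℚ] ℚ) (ℓ : Lv x₀ k) :
    liftFun x₀ μ (smp ℓ) = μ (Finsupp.single ℓ.base 1) := by
  rw [liftFun, ext_bas, dif_pos rfl]

theorem liftFun_smp_ne {k j : ℕ} (μ : SCh k M →ₗ[ℚ] ℚ) (ℓ : Lv x₀ j) (h : j ≠ k) :
    liftFun x₀ μ (smp ℓ) = 0 := by
  rw [liftFun, ext_bas, dif_neg h]

theorem liftFun_lact {k : ℕ} (μ : SCh k M →ₗ[ℚ] ℚ) (g : Deck x₀) (w : LCh x₀) :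
    liftFun x₀ μ (lact g w) = liftFun x₀ μ w := by
  have : liftFun x₀ μ ∘ₗ lact g = liftFun x₀ μ := lin_ext_smp fun j ℓ => by
    rw [LinearMap.comp_apply, lact_smp]
    by_cases h : j = k
    · subst h
      rw [liftFun_smp, liftFun_smp, Lv.base_smul]
    · rw [liftFun_smp_ne _ _ h, liftFun_smp_ne _ _ h]
  exact congrArg (fun f => f w) this

theorem liftFun_lbd {k : ℕ} (μ : SCh k M →ₗ[ℚ] ℚ) (hμ : ∀ z, μ (sbd k z) = 0) (w : LCh x₀) :
    liftFun x₀ μ (lbd w) = 0 := by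
  have : liftFun x₀ μ ∘ₗ lbd = 0 := lin_ext_smp fun j ℓ => by
    rw [LinearMap.comp_apply, LinearMap.zero_apply]
    cases j with
    | zero => rw [lbd_zero, map_zero]
    | succ j =>
      rw [lbd_succ, map_sum]
      by_cases h : j = k
      · subst h
        rw [← hμ (Finsupp.single ℓ.base 1), sbd, ext_bas, map_sum]
        simp only [map_smul, liftFun_smp]
        rfl
      · simp only [map_smul, liftFun_smp_ne _ _ h, smul_zero, Finset.sum_const_zero]
  exact congrArg (fun f => f w) this

variable [PathConnectedSpace M]

/-- A chosen lift of a singular simplex. -/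
def chosenLift (x₀ : M) {k : ℕ} (τ : C(Splx k, M)) : Lv x₀ k := (Lv.exists_base_eq τ).choose

theorem chosenLift_base {k : ℕ} (τ : C(Splx k, M)) : (chosenLift x₀ τ).base = τ :=
  (Lv.exists_base_eq τ).choose_spec

/-- Lifting chains simplexwise. -/
def liftChain (x₀ : M) (k : ℕ) : SCh k M →ₗ[ℚ] LCh x₀ := ext fun τ => smp (chosenLift x₀ τ)

theorem apply_chosenLift {B : LCh x₀ →ₗ[ℚ] ℚ} (hB : ∀ g v, B (lact g v) = B v) {k : ℕ}
    (ℓ : Lv x₀ k) : B (smp (chosenLift x₀ ℓ.base)) = B (smp ℓ) := by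
  obtain ⟨g, hg⟩ := Lv.exists_smul_eq_of_base_eq (chosenLift_base ℓ.base).symm
  rw [← hg, ← lact_smp, hB]

theorem apply_lbd_liftChain {B : LCh x₀ →ₗ[ℚ] ℚ} (hB : ∀ g v, B (lact g v) = B v) {k : ℕ}
    (z : SCh (k + 1) M) : B (lbd (liftChain x₀ (k + 1) z)) = B (liftChain x₀ k (sbd k z)) := by
  have : B ∘ₗ lbd ∘ₗ liftChain x₀ (k + 1) = B ∘ₗ liftChain x₀ k ∘ₗ sbd k := lin_ext fun τ => by
    simp only [LinearMap.comp_apply, sbd, liftChain, ext_bas, lbd_succ, map_sum, map_smul]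
    refine Finset.sum_congr rfl fun i _ => ?_
    rw [← apply_chosenLift hB]
    congr 4
    exact ContinuousMap.ext fun w => DFunLike.congr_fun (chosenLift_base τ) (δ i w)
  exact congrArg (fun f => f z) this

theorem lCycle_liftChain {k : ℕ} {z : SCh (k + 1) M} (hz : sbd k z = 0) :
    LCycle (liftChain x₀ (k + 1) z) := fun B hB => by
  rw [apply_lbd_liftChain hB, hz, map_zero, map_zero]

theorem liftFun_liftChain {k : ℕ} (μ : SCh k M →ₗ[ℚ] ℚ) (z : SCh k M) :
    liftFun x₀ μ (liftChain x₀ k z) = μ z := by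
  have : liftFun x₀ μ ∘ₗ liftChain x₀ k = μ := lin_ext fun τ => by
    rw [LinearMap.comp_apply, liftChain, ext_bas, liftFun_smp, chosenLift_base]
  exact congrArg (fun f => f z) this

end TCSum

namespace TCSum

/-! ### Barycentric subdivision of ordered chains in a simplex -/

theorem sum_mem_stdSimplex {m : ℕ} (l : List (Splx m)) (hl : l ≠ []) :
    (l.length : ℝ)⁻¹ • (l.map Subtype.val).sum ∈ stdSimplex ℝ (Fin m) := by
  have key : ∀ l : List (Splx m), (∀ i, 0 ≤ (l.map Subtype.val).sum i) ∧
      ∑ i, (l.map Subtype.val).sum i = l.length := by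
    intro l
    induction l with
    | nil => simp
    | cons a l ih =>
      refine ⟨fun i => ?_, ?_⟩
      · simpa using add_nonneg (a.2.1 i) (ih.1 i)
      · simp only [List.map_cons, List.sum_cons, Pi.add_apply, Finset.sum_add_distrib, ih.2,
          a.2.2, List.length_cons, Nat.cast_add, Nat.cast_one, add_comm]
  have h0 : (l.length : ℝ) ≠ 0 := by simpa using hl
  refine ⟨fun i => mul_nonneg (by positivity) ((key l).1 i), ?_⟩
  simp only [Pi.smul_apply, smul_eq_mul]
  rw [← Finset.mul_sum, (key l).2, inv_mul_cancel₀ h0]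

/-- The barycentre of a nonempty list of points of a simplex. -/
def bary {m : ℕ} (l : List (Splx m)) (hl : l ≠ []) : Splx m := ⟨_, sum_mem_stdSimplex l hl⟩

theorem dist_bary_le {m : ℕ} (l : List (Splx m)) (hl : l ≠ []) (z : Splx m) :
    dist z (bary l hl) ≤ (l.length : ℝ)⁻¹ * (l.map fun x => dist z x).sum := by
  have key : ∀ l : List (Splx m), ‖(l.length : ℝ) • z.1 - (l.map Subtype.val).sum‖ ≤
      (l.map fun x => dist z x).sum := by
    intro l
    induction l with
    | nil => simp
    | cons a l ih =>
      simp only [List.length_cons, List.map_cons, List.sum_cons, Nat.cast_add, Nat.cast_one]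
      calc ‖((l.length : ℝ) + 1) • z.1 - (a.1 + (l.map Subtype.val).sum)‖
          = ‖(z.1 - a.1) + ((l.length : ℝ) • z.1 - (l.map Subtype.val).sum)‖ := by
            congr 1; module
        _ ≤ _ := (norm_add_le _ _).trans (add_le_add (le_of_eq (dist_eq_norm _ _).symm) ih)
  have h0 : (l.length : ℝ) ≠ 0 := by simpa using hl
  have e : z.1 - (bary l hl).1 =
      (l.length : ℝ)⁻¹ • ((l.length : ℝ) • z.1 - (l.map Subtype.val).sum) := by
    rw [smul_sub, smul_smul, inv_mul_cancel₀ h0, one_smul]; rfl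
  rw [Subtype.dist_eq, dist_eq_norm, e, norm_smul, norm_inv, Real.norm_natCast]
  exact mul_le_mul_of_nonneg_left (key l) (by positivity)

theorem sum_le_length_mul {A : Type*} (f : A → ℝ) (R : ℝ) (l : List A) (h : ∀ x ∈ l, f x ≤ R) :
    (l.map f).sum ≤ l.length * R := by
  have := List.sum_le_card_nsmul (l.map f) R (by simpa using h)
  simpa using this

theorem dist_bary_le_of_le {m : ℕ} (l : List (Splx m)) (hl : l ≠ []) (z : Splx m) {R : ℝ}
    (h : ∀ x ∈ l, dist x z ≤ R) : dist (bary l hl) z ≤ R := by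
  have h0 : (l.length : ℝ) ≠ 0 := by simpa using hl
  rw [dist_comm]
  refine (dist_bary_le l hl z).trans ?_
  refine (mul_le_mul_of_nonneg_left (sum_le_length_mul _ R l fun x hx => ?_) (by positivity)).trans
    (le_of_eq ?_)
  · rw [dist_comm]; exact h x hx
  · rw [← mul_assoc, inv_mul_cancel₀ h0, one_mul]

theorem dist_bary_le_of_mem {m : ℕ} (l : List (Splx m)) (hl : l ≠ []) {x : Splx m} (hx : x ∈ l)
    {D : ℝ} (h : ∀ y ∈ l, dist x y ≤ D) {N : ℕ} (hN : l.length ≤ N + 1) :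
    dist x (bary l hl) ≤ N / (N + 1) * D := by
  classical
  have hD : 0 ≤ D := by simpa using h x hx
  refine (dist_bary_le l hl x).trans ?_
  have hp := List.perm_cons_erase hx
  rw [(hp.map fun y => dist x y).sum_eq, List.map_cons, List.sum_cons, dist_self, zero_add]
  have h1 := sum_le_length_mul (fun y => dist x y) D (l.erase x)
    fun y hy => h y (List.mem_of_mem_erase hy)
  obtain ⟨j, hj⟩ : ∃ j, l.length = j + 1 := ⟨l.length - 1, by
    have := List.length_pos_of_mem hx; omega⟩
  rw [List.length_erase_of_mem hx, hj, Nat.add_sub_cancel] at h1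
  rw [hj]
  refine (mul_le_mul_of_nonneg_left h1 (by positivity)).trans ?_
  rw [← mul_assoc]
  refine mul_le_mul_of_nonneg_right ?_ hD
  push_cast
  rw [inv_mul_eq_div, div_le_div_iff₀ (by positivity) (by positivity)]
  have : (j : ℝ) ≤ N := by exact_mod_cast (by omega : j ≤ N)
  nlinarith

theorem δ_bary {m : ℕ} (i : Fin (m + 1)) (l : List (Splx m)) (hl : l ≠ []) :
    δ i (bary l hl) = bary (l.map (δ i)) (by simpa using hl) := by
  have key : ∀ (l : List (Splx m)) (j : Fin (m + 1)),
      ((l.map (δ i)).map Subtype.val).sum j =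
        if h : ∃ a, i.succAbove a = j then (l.map Subtype.val).sum h.choose else 0 := by
    intro l j
    induction l with
    | nil => simp
    | cons a l ih =>
      simp only [List.map_cons, List.sum_cons, Pi.add_apply, ih]
      rcases Fin.eq_self_or_eq_succAbove i j with rfl | ⟨j, rfl⟩
      · have hn : ¬ ∃ a, j.succAbove a = j := fun ⟨a, ha⟩ => Fin.succAbove_ne _ _ ha
        rw [dif_neg hn, dif_neg hn, add_zero]
        exact δ_apply_self _ _
      · have h : ∃ a, i.succAbove a = i.succAbove j := ⟨j, rfl⟩
        rw [dif_pos h, dif_pos h]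
        congr 1
        rw [show h.choose = j from Fin.succAbove_right_injective h.choose_spec]
        exact δ_apply_succAbove _ _ _
  apply stdSimplex.ext
  funext j
  change _ = ((l.map (δ i)).length : ℝ)⁻¹ * ((l.map (δ i)).map Subtype.val).sum j
  rw [key, List.length_map]
  rcases Fin.eq_self_or_eq_succAbove i j with rfl | ⟨j, rfl⟩
  · have hn : ¬ ∃ a, j.succAbove a = j := fun ⟨a, ha⟩ => Fin.succAbove_ne _ _ ha
    rw [dif_neg hn, mul_zero]
    exact δ_apply_self _ _
  · have h : ∃ a, i.succAbove a = i.succAbove j := ⟨j, rfl⟩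
    rw [dif_pos h, show h.choose = j from Fin.succAbove_right_injective h.choose_spec]
    exact δ_apply_succAbove _ _ _

/-- Coning from the barycentre. -/
def baryCone {m : ℕ} (l : List (Splx m)) : Ch (Splx m) →ₗ[ℚ] Ch (Splx m) :=
  if hl : l ≠ [] then cone (bary l hl) else 0

theorem baryCone_of_ne {m : ℕ} {l : List (Splx m)} (hl : l ≠ []) :
    baryCone l = cone (bary l hl) := dif_pos hl

/-- Barycentric subdivision, on chains of length `k`. -/
def sd (m k : ℕ) : Ch (Splx m) →ₗ[ℚ] Ch (Splx m) := model baryCone LinearMap.id k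

theorem sd_zero {m : ℕ} (w : Ch (Splx m)) : sd m 0 w = w := rfl

theorem sd_succ_bas {m k : ℕ} (l : List (Splx m)) :
    sd m (k + 1) (bas l) = baryCone l (sd m k (dl l)) := model_succ_bas _ _ _ _

theorem d_sd {m k : ℕ} (w : Ch (Splx m)) : d (sd m (k + 1) w) = sd m k (d w) := by
  refine bd_model d baryCone (fun l hl w => ?_) LinearMap.id (fun w => ?_) k w
  · rw [baryCone_of_ne hl, d_cone]
  · simp

theorem mp_sd {m k : ℕ} (i : Fin (m + 1)) (w : Ch (Splx m)) :
    mp (δ i) (sd m k w) = sd (m + 1) k (mp (δ i) w) := by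
  induction k generalizing w with
  | zero => rfl
  | succ k ih =>
    have : mp (δ i) ∘ₗ sd m (k + 1) = sd (m + 1) (k + 1) ∘ₗ mp (δ i) := lin_ext fun l => by
      rw [LinearMap.comp_apply, LinearMap.comp_apply, mp_bas, sd_succ_bas, sd_succ_bas]
      by_cases hl : l = []
      · subst hl; simp [baryCone]
      · rw [baryCone_of_ne hl, baryCone_of_ne (by simpa using hl), mp_cone, ih, ← d_bas, ← d_mp,
          mp_bas, d_bas, δ_bary]
    exact congrArg (fun f => f w) this

theorem supp_mono {A : Type*} {P Q : A → Prop} (h : ∀ a, P a → Q a) : Supp P ≤ Supp Q :=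
  Submodule.span_mono fun _ ⟨a, ha, e⟩ => ⟨a, h a ha, e⟩

theorem dl_mem_supp {S : Type*} (l : List S) :
    dl l ∈ Supp fun l' => l'.length + 1 = l.length ∧ ∀ x ∈ l', x ∈ l := by
  induction l with
  | nil => simp [dl]
  | cons a l ih =>
    rw [dl]
    refine Submodule.sub_mem _ (bas_mem_supp ⟨by simp, fun x hx => by simp [hx]⟩) ?_
    refine map_mem_of_supp (cone a) (fun l' h => ?_) ih
    rw [cone_bas]
    refine bas_mem_supp ⟨by simp [h.1], fun x hx => ?_⟩
    rcases List.mem_cons.1 hx with rfl | hx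
    · simp
    · exact List.mem_cons_of_mem _ (h.2 x hx)

theorem sd_mem_supp {m N : ℕ} {D : ℝ} (hD : 0 ≤ D) (k : ℕ) (hk : k ≤ N + 1) (l : List (Splx m))
    (hl : l.length = k) (h : ∀ x ∈ l, ∀ y ∈ l, dist x y ≤ D) :
    sd m k (bas l) ∈ Supp fun l' => l'.length = k ∧
      (∀ y ∈ l', ∀ z R, (∀ x ∈ l, dist x z ≤ R) → dist y z ≤ R) ∧
      ∀ x ∈ l', ∀ y ∈ l', dist x y ≤ N / (N + 1) * D := by
  induction k generalizing l with
  | zero =>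
    obtain rfl := List.length_eq_zero_iff.1 hl
    exact bas_mem_supp ⟨rfl, by simp⟩
  | succ k ih =>
    have hne : l ≠ [] := by rintro rfl; simp at hl
    rw [sd_succ_bas, baryCone_of_ne hne, ← LinearMap.comp_apply]
    refine map_mem_of_supp _ (fun l₁ h₁ => ?_) (dl_mem_supp l)
    rw [LinearMap.comp_apply]
    refine map_mem_of_supp _ (fun l₂ h₂ => ?_) (ih (by omega) l₁ (by omega)
      fun x hx y hy => h x (h₁.2 x hx) y (h₁.2 y hy))
    rw [cone_bas]
    have hb : ∀ y ∈ l₂, dist y (bary l hne) ≤ N / (N + 1) * D := fun y hy =>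
      h₂.2.1 y hy _ _ fun x hx => dist_bary_le_of_mem l hne (h₁.2 x hx)
        (h x (h₁.2 x hx)) (by omega)
    refine bas_mem_supp ⟨by simp [h₂.1], fun y hy z R hR => ?_, fun x hx y hy => ?_⟩
    · rcases List.mem_cons.1 hy with rfl | hy
      · exact dist_bary_le_of_le l hne z hR
      · exact h₂.2.1 y hy z R fun x hx => hR x (h₁.2 x hx)
    · rcases List.mem_cons.1 hx with rfl | hx <;> rcases List.mem_cons.1 hy with rfl | hy
      · rw [dist_self]; positivity
      · rw [dist_comm]; exact hb y hy
      · exact hb x hx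
      · exact h₂.2.2 x hx y hy

/-- The iterated subdivision of the standard simplex. -/
def fineSimplex (m k : ℕ) : Ch (Splx k) :=
  (sd k k)^[m] (bas (List.ofFn fun i => stdSimplex.vertex i))

theorem fineSimplex_mem_supp (m N : ℕ) {k : ℕ} (hk : k ≤ N + 1) :
    fineSimplex m k ∈ Supp fun l => l.length = k ∧
      ∀ x ∈ l, ∀ y ∈ l, dist x y ≤ (N / (N + 1) : ℝ) ^ m * 1 := by
  induction m with
  | zero =>
    refine bas_mem_supp ⟨by simp, fun x _ y _ => ?_⟩
    rw [pow_zero, one_mul, Subtype.dist_eq, dist_pi_le_iff zero_le_one]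
    intro i
    rw [Real.dist_eq, abs_le]
    have hx := x.2.1 i
    have hy := y.2.1 i
    have hx' := stdSimplex.le_one x i
    have hy' := stdSimplex.le_one y i
    change x.1 i ≤ 1 at hx'
    change y.1 i ≤ 1 at hy'
    constructor <;> linarith
  | succ m ih =>
    rw [fineSimplex, Function.iterate_succ_apply']
    refine map_mem_of_supp _ (fun l hl => ?_) ih
    have := sd_mem_supp (N := N) (D := (N / (N + 1) : ℝ) ^ m * 1) (by positivity) k hk l hl.1 hl.2
    refine supp_mono (fun l' h' => ⟨h'.1, fun x hx y hy => ?_⟩) this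
    refine (h'.2.2 x hx y hy).trans (le_of_eq ?_)
    ring

theorem exists_fineSimplex_mem (k : ℕ) {ε : ℝ} (hε : 0 < ε) :
    ∃ m, fineSimplex m k ∈ Supp fun l => l.length = k ∧ ∀ x ∈ l, ∀ y ∈ l, dist x y < ε := by
  obtain ⟨m, hm⟩ := exists_pow_lt_of_lt_one hε
    (show (k / (k + 1) : ℝ) < 1 by rw [div_lt_one (by positivity)]; linarith)
  refine ⟨m, supp_mono (fun l h => ⟨h.1, fun x hx y hy => ?_⟩)
    (fineSimplex_mem_supp m k (Nat.le_succ k))⟩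
  refine (h.2 x hx y hy).trans_lt ?_
  rwa [mul_one]

theorem d_fineSimplex (m k : ℕ) : d (fineSimplex m (k + 1)) =
    ∑ i : Fin (k + 1), (-1 : ℚ) ^ (i : ℕ) • mp (δ i) (fineSimplex m k) := by
  have h1 : ∀ (m : ℕ) (w : Ch (Splx (k + 1))),
      d ((sd (k + 1) (k + 1))^[m] w) = ((sd (k + 1) k)^[m]) (d w) := by
    intro m
    induction m with
    | zero => intro w; rfl
    | succ m ih => intro w; rw [Function.iterate_succ_apply, ih, d_sd, Function.iterate_succ_apply]
  have h2 : ∀ (m : ℕ) (i : Fin (k + 1)) (w : Ch (Splx k)),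
      mp (δ i) ((sd k k)^[m] w) = ((sd (k + 1) k)^[m]) (mp (δ i) w) := by
    intro m i
    induction m with
    | zero => intro w; rfl
    | succ m ih => intro w; rw [Function.iterate_succ_apply, ih, mp_sd, Function.iterate_succ_apply]
  have h3 : ∀ (m : ℕ), ((sd (k + 1) k)^[m]) = ((sd (k + 1) k) ^ m : Module.End ℚ _) := fun m =>
    (Module.End.coe_pow _ _).symm
  rw [fineSimplex, h1, d_bas, dl_ofFn, h3, map_sum]
  refine Finset.sum_congr rfl fun i _ => ?_
  rw [fineSimplex, h2, h3, map_smul, mp_bas, List.map_ofFn]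
  congr 4
  funext j
  exact (δ_vertex i j).symm

variable {M : Type*} [TopologicalSpace M]

/-- The vertices of the iterated subdivision of lifted simplices. -/
def fineVertices (x₀ : M) (m : ℕ) : LCh x₀ →ₗ[ℚ] Ch (Cov x₀) :=
  ext fun p => mp p.2.1 (fineSimplex m p.1)

theorem fineVertices_smp {x₀ : M} (m : ℕ) {k : ℕ} (ℓ : Lv x₀ k) :
    fineVertices x₀ m (smp ℓ) = mp ℓ.1 (fineSimplex m k) := ext_bas _ _

theorem fineSimplex_zero (m : ℕ) : fineSimplex m 0 = bas [] := by
  induction m with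
  | zero => rfl
  | succ m ih => rw [fineSimplex, Function.iterate_succ_apply', ← fineSimplex, ih, sd_zero]

theorem vertexMap_fineVertices (x₀ : M) (m : ℕ) : VertexMap (fineVertices x₀ m) where
  d_eq w := by
    have : d ∘ₗ fineVertices x₀ m = fineVertices x₀ m ∘ₗ lbd := lin_ext_smp fun k ℓ => by
      rw [LinearMap.comp_apply, LinearMap.comp_apply, fineVertices_smp]
      cases k with
      | zero => rw [lbd_zero, map_zero, fineSimplex_zero, mp_bas, List.map_nil, d_bas, dl]
      | succ k =>
        rw [lbd_succ, d_mp, d_fineSimplex, map_sum, map_sum]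
        refine Finset.sum_congr rfl fun i _ => ?_
        rw [map_smul, map_smul, fineVertices_smp, mp_mp]
        rfl
    exact congrArg (fun f => f w) this
  empty := by rw [fineVertices_smp, fineSimplex_zero, mp_bas, List.map_nil]
  smul g w := by
    have : fineVertices x₀ m ∘ₗ lact g = mp (g • ·) ∘ₗ fineVertices x₀ m := lin_ext_smp fun k ℓ => by
      rw [LinearMap.comp_apply, LinearMap.comp_apply, lact_smp, fineVertices_smp, fineVertices_smp,
        mp_mp]
      rfl
    exact congrArg (fun f => f w) this

end TCSum

namespace TCSum

/-! ### Cycles representing singular homology -/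

section Homology

variable {X : Type} [TopologicalSpace X]

/-- Singular chains in the sense of the singular chain complex, as formal combinations of maps. -/
def chainEquiv (X : Type) [TopologicalSpace X] (k : ℕ) :
    (singularChainComplex.obj (TopCat.of X)).X k ≃ₗ[ℚ] SCh (k + 1) X :=
  Finsupp.domLCongr ((TopCat.of X).toSSetObjEquiv (Opposite.op (SimplexCategory.mk k)))

theorem hom_sum_zsmul_apply {A B : ModuleCat.{0} ℚ} {ι : Type} [Fintype ι] (c : ι → ℤ)
    (f : ι → (A ⟶ B)) (x : A) : (∑ i, c i • f i).hom x = ∑ i, c i • (f i).hom x := by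
  simp

theorem map_sum_zsmul {A B : Type*} [AddCommGroup A] [Module ℚ A] [AddCommGroup B] [Module ℚ B]
    {ι : Type} [Fintype ι] (L : A →ₗ[ℚ] B) (c : ι → ℤ) (x : ι → A) :
    L (∑ i, c i • x i) = ∑ i, (c i : ℚ) • L (x i) := by
  simp [map_sum, Int.cast_smul_eq_zsmul]

theorem chainEquiv_d (k : ℕ) (x : (singularChainComplex.obj (TopCat.of X)).X (k + 1)) :
    chainEquiv X k ((singularChainComplex.obj (TopCat.of X)).d (k + 1) k x) =
      sbd (k + 1) (chainEquiv X (k + 1) x) := by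
  have hd : (singularChainComplex.obj (TopCat.of X)).d (k + 1) k =
      ∑ i : Fin (k + 2), (-1 : ℤ) ^ (i : ℕ) • SimplicialObject.δ
        (((SimplicialObject.whiskering _ _).obj (ModuleCat.free ℚ)).obj
          (TopCat.toSSet.obj (TopCat.of X))) i :=
    AlgebraicTopology.AlternatingFaceMapComplex.obj_d_eq _ _
  have : (chainEquiv X k).toLinearMap ∘ₗ
      ((singularChainComplex.obj (TopCat.of X)).d (k + 1) k).hom =
      sbd (k + 1) ∘ₗ (chainEquiv X (k + 1)).toLinearMap := by
    refine lin_ext (A := (TopCat.toSSet.obj (TopCat.of X)).obj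
      (Opposite.op (SimplexCategory.mk (k + 1)))) fun s => ?_
    have h1 : ((singularChainComplex.obj (TopCat.of X)).d (k + 1) k).hom (Finsupp.single s 1) =
        ∑ i : Fin (k + 2), (-1 : ℤ) ^ (i : ℕ) • (SimplicialObject.δ
          (((SimplicialObject.whiskering _ _).obj (ModuleCat.free ℚ)).obj
            (TopCat.toSSet.obj (TopCat.of X))) i).hom (Finsupp.single s 1) :=
      (congrArg (fun f => f.hom (Finsupp.single s 1)) hd).trans (hom_sum_zsmul_apply _ _ _)
    have h2 : ∀ i : Fin (k + 2), chainEquiv X k ((SimplicialObject.δ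
          (((SimplicialObject.whiskering _ _).obj (ModuleCat.free ℚ)).obj
            (TopCat.toSSet.obj (TopCat.of X))) i).hom (Finsupp.single s 1)) =
        Finsupp.single (((TopCat.of X).toSSetObjEquiv _ s).comp (δ i)) 1 := fun i => by
      have h3 : (SimplicialObject.δ
          (((SimplicialObject.whiskering _ _).obj (ModuleCat.free ℚ)).obj
            (TopCat.toSSet.obj (TopCat.of X))) i).hom (Finsupp.single s 1) =
          Finsupp.single (SimplicialObject.δ (TopCat.toSSet.obj (TopCat.of X)) i s) (1 : ℚ) :=
        Finsupp.mapDomain_single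
      rw [h3]
      exact Finsupp.domLCongr_single _ _ _
    have h4 : sbd (k + 1) (chainEquiv X (k + 1) (Finsupp.single s 1)) =
        ∑ i : Fin (k + 2), (-1 : ℚ) ^ (i : ℕ) •
          Finsupp.single (((TopCat.of X).toSSetObjEquiv _ s).comp (δ i)) 1 :=
      (congrArg (sbd (k + 1)) (Finsupp.domLCongr_single _ _ _)).trans (ext_bas _ _)
    refine (congrArg (chainEquiv X k) h1).trans (Eq.trans ?_ h4.symm)
    refine (map_sum_zsmul (chainEquiv X k).toLinearMap _ _).trans
      (Finset.sum_congr rfl fun i _ => (congrArg _ (h2 i)).trans ?_)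
    simp
  exact congrArg (fun f => f x) this

theorem exists_cycle {n : ℕ} (h : Nontrivial (H (n + 1) X)) :
    ∃ (z : SCh (n + 2) X) (μ : SCh (n + 2) X →ₗ[ℚ] ℚ), sbd (n + 1) z = 0 ∧
      (∀ w, μ (sbd (n + 2) w) = 0) ∧ μ z ≠ 0 := by
  set K := singularChainComplex.obj (TopCat.of X) with hK
  have hne : ¬ K.ExactAt (n + 1) := fun hex => by
    have hz := (K.exactAt_iff_isZero_homology _).1 hex
    have : Subsingleton (K.homology (n + 1)) := ModuleCat.subsingleton_of_isZero hz
    exact not_subsingleton (H (n + 1) X) this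
  rw [K.exactAt_iff' (n + 2) (n + 1) n (by simp) (by simp), ShortComplex.moduleCat_exact_iff] at hne
  push Not at hne
  obtain ⟨x, hx, hx'⟩ := hne
  change K.X (n + 1) at x
  change K.d (n + 1) n x = 0 at hx
  change ∀ y : K.X (n + 2), K.d (n + 2) (n + 1) y ≠ x at hx'
  have hmem : chainEquiv X (n + 1) x ∉ LinearMap.range (sbd (n + 2) : SCh (n + 3) X →ₗ[ℚ] _) := by
    rintro ⟨y, hy⟩
    refine hx' ((chainEquiv X (n + 2)).symm y) ((chainEquiv X (n + 1)).injective ?_)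
    rw [chainEquiv_d, LinearEquiv.apply_symm_apply, hy]
  obtain ⟨μ, h1, h2⟩ := Submodule.exists_le_ker_of_notMem hmem
  refine ⟨chainEquiv X (n + 1) x, μ, ?_, fun w => h2 ⟨w, rfl⟩, h1⟩
  rw [← chainEquiv_d, hx, map_zero]

end Homology

end TCSum

namespace TCSum

/-! ### Coherent path classes over open sets -/

section Coherent

variable {P M : Type*} [TopologicalSpace P] [TopologicalSpace M] {x₀ : M}

/-- A choice of path classes to the images of points which is transported along paths in `A`. -/
def Coherent (π : C(P, M)) (A : Set P) (γ : ∀ p, Path.Homotopic.Quotient x₀ (π p)) : Prop :=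
  ∀ p q (ρ : Path p q), (∀ t, ρ t ∈ A) →
    γ q = (γ p).trans (Path.Homotopic.Quotient.mk (ρ.map π.continuous))

end Coherent

section Colour

variable {P M : Type*} [PseudoMetricSpace P] [TopologicalSpace M] [PathConnectedSpace M] {x₀ : M}
  {ι : Type*} (π : C(P, M)) (A : ι → Set P) (γ : ι → ∀ p, Path.Homotopic.Quotient x₀ (π p)) (r : ℝ)

open Classical in
/-- Path classes chosen from the members of a family that contain a ball of radius `r`. -/
def colourClass (p : P) : Path.Homotopic.Quotient x₀ (π p) :=
  if h : ∃ i, Metric.ball p r ⊆ A i then γ h.choose p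
  else Path.Homotopic.Quotient.mk (PathConnectedSpace.somePath _ _)

variable {π A γ r}

theorem not_nodup_rel [Fintype ι] (hγ : ∀ i, Coherent π (A i) (γ i)) {E : Type*} (pt : E → P)
    (cls : ∀ e, Path.Homotopic.Quotient x₀ (π (pt e))) (L : List E)
    (hL : Fintype.card ι < L.length) (hA : ∀ e ∈ L, ∃ i, Metric.ball (pt e) r ⊆ A i)
    (hp : ∀ e ∈ L, ∀ e' ∈ L, ∃ ρ : Path (pt e) (pt e'), (∀ t, ρ t ∈ Metric.ball (pt e) r) ∧
      cls e' = (cls e).trans (Path.Homotopic.Quotient.mk (ρ.map π.continuous))) :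
    ¬ (L.map fun e => rel ⟨π (pt e), cls e⟩ (colourClass π A γ r (pt e))).Nodup := by
  classical
  intro hn
  obtain ⟨e₀, he₀⟩ := List.exists_mem_of_length_pos (Nat.zero_lt_of_lt hL)
  obtain ⟨i₀, -⟩ := hA e₀ he₀
  let col : E → ι := fun e => if h : ∃ i, Metric.ball (pt e) r ⊆ A i then h.choose else i₀
  have hcol : (L.map col).Nodup := by
    rw [List.Nodup, List.pairwise_map] at hn ⊢
    refine hn.imp_of_mem fun {e e'} he he' hne hc => hne ?_
    obtain ⟨ρ, h1, h2⟩ := hp e he e' he'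
    have hc1 : col e = (hA e he).choose := dif_pos _
    have hc2 : col e' = (hA e' he').choose := dif_pos _
    have hs := (hA e he).choose_spec
    have e1 : colourClass π A γ r (pt e) = γ (col e) (pt e) := by
      rw [hc1]; exact dif_pos _
    have e2 : colourClass π A γ r (pt e') = γ (col e) (pt e') := by
      rw [hc, hc2]; exact dif_pos _
    have h3 := hγ (col e) _ _ ρ fun t => by rw [hc1]; exact hs (h1 t)
    change (cls e).trans (colourClass π A γ r (pt e)).symm =
      (cls e').trans (colourClass π A γ r (pt e')).symm
    rw [e1, e2, h2, h3]
    generalize Path.Homotopic.Quotient.mk (ρ.map π.continuous) = a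
    generalize γ (col e) (pt e) = b
    have : (b.trans a).symm = a.symm.trans b.symm := by
      obtain ⟨a, rfl⟩ := Path.Homotopic.Quotient.mk_surjective a
      obtain ⟨b, rfl⟩ := Path.Homotopic.Quotient.mk_surjective b
      simp only [← Path.Homotopic.Quotient.mk_trans, ← Path.Homotopic.Quotient.mk_symm,
        Path.trans_symm]
    rw [this, Path.Homotopic.Quotient.trans_assoc, ← Path.Homotopic.Quotient.trans_assoc a]
    simp
  have := hcol.length_le_card
  rw [List.length_map] at this
  omega

end Colour

/-- The straight path in a simplex. -/
def linePath {k : ℕ} (x y : Splx k) : Path x y where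
  toFun t := ⟨(1 - (t : ℝ)) • x.1 + (t : ℝ) • y.1,
    convex_stdSimplex ℝ (Fin k) x.2 y.2 (sub_nonneg.2 t.2.2) t.2.1 (by ring)⟩
  continuous_toFun := by fun_prop
  source' := Subtype.ext (by simp)
  target' := Subtype.ext (by simp)

theorem dist_linePath_le {k : ℕ} (x y : Splx k) (t : I) : dist x (linePath x y t) ≤ dist x y := by
  rw [Subtype.dist_eq, Subtype.dist_eq, dist_eq_norm, dist_eq_norm]
  have : x.1 - (linePath x y t).1 = (t : ℝ) • (x.1 - y.1) := by
    change x.1 - ((1 - (t : ℝ)) • x.1 + (t : ℝ) • y.1) = _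
    module
  rw [this, norm_smul, Real.norm_of_nonneg t.2.1]
  exact mul_le_of_le_one_left (norm_nonneg _) t.2.2

/-! ### Small representatives of a homology class -/

/-- Lists of points of the cover lying on a small lifted simplex. -/
def SmallList {M : Type*} [PseudoMetricSpace M] {x₀ : M} (k : ℕ) (r : ℝ) (l : List (Cov x₀)) :
    Prop :=
  l.length = k ∧ ∃ (ℓ : Lv x₀ k) (u : List (Splx k)), l = u.map ℓ.1 ∧
    ∀ x ∈ u, ∀ y ∈ u, ∀ t, dist (ℓ.base x) (ℓ.base (linePath x y t)) < r

theorem SmallList.exists_path {M : Type*} [PseudoMetricSpace M] {x₀ : M} {k : ℕ} {r : ℝ}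
    {l : List (Cov x₀)} (h : SmallList k r l) {s t : Cov x₀} (hs : s ∈ l) (ht : t ∈ l) :
    ∃ ρ : Path s.1 t.1, (∀ u, dist (ρ u) s.1 < r) ∧
      t.2 = s.2.trans (Path.Homotopic.Quotient.mk ρ) := by
  obtain ⟨-, ℓ, u, rfl, hu⟩ := h
  obtain ⟨x, hx, rfl⟩ := List.mem_map.1 hs
  obtain ⟨y, hy, rfl⟩ := List.mem_map.1 ht
  exact ⟨(linePath x y).map ℓ.2.1, fun t => by rw [dist_comm]; exact hu x hx y hy t,
    ℓ.2.2 x y (linePath x y)⟩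

theorem exists_small {M : Type*} [PseudoMetricSpace M] [PathConnectedSpace M] (x₀ : M) {k : ℕ}
    (z : SCh k M) {r : ℝ} (hr : 0 < r) :
    ∃ m, fineVertices x₀ m (liftChain x₀ k z) ∈ Supp (SmallList k r) := by
  classical
  obtain ⟨ε, hε, h⟩ : ∃ ε > 0, ∀ τ ∈ z.support, ∀ x y : Splx k, dist x y < ε →
      dist (τ x) (τ y) < r := by
    induction z.support using Finset.induction_on with
    | empty => exact ⟨1, one_pos, by simp⟩
    | insert τ s _ ih =>
      obtain ⟨ε, hε, h⟩ := ih
      obtain ⟨ε', hε', h'⟩ := Metric.uniformContinuous_iff.1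
        (CompactSpace.uniformContinuous_of_continuous τ.continuous) r hr
      refine ⟨min ε ε', lt_min hε hε', fun τ₁ hτ x y hxy => ?_⟩
      rcases Finset.mem_insert.1 hτ with rfl | hτ
      · exact h' (hxy.trans_le (min_le_right _ _))
      · exact h τ₁ hτ x y (hxy.trans_le (min_le_left _ _))
  obtain ⟨m, hm⟩ := exists_fineSimplex_mem k hε
  refine ⟨m, ?_⟩
  rw [liftChain, ext, Finsupp.linearCombination_apply, Finsupp.sum, map_sum]
  refine Submodule.sum_mem _ fun τ hτ => ?_
  rw [map_smul, fineVertices_smp]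
  refine Submodule.smul_mem _ _ (map_mem_of_supp _ (fun u hu => ?_) hm)
  rw [mp_bas]
  refine bas_mem_supp ⟨by simp [hu.1], chosenLift x₀ τ, u, rfl, fun x hx y hy t => ?_⟩
  rw [chosenLift_base]
  exact h τ hτ _ _ ((dist_linePath_le x y t).trans_lt (hu.2 x hx y hy))

theorem proj_eq_of_mem_supp {S : Type*} {k : ℕ} {w : Ch S}
    (hw : w ∈ Supp fun l : List S => l.length = k) : proj k w = w := by
  have := map_mem_of_supp (N := ⊥) (proj k - LinearMap.id) (fun l hl => by
    simp [proj_bas, hl]) hw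
  exact sub_eq_zero.1 this

end TCSum

namespace TCSum

/-! ### Detecting products of top classes -/

/-- A non-zero rational homology class of an aspherical space is detected by an invariant
alternating cocycle of the group of deck transformations, on arbitrarily fine cycles. -/
theorem exists_cocycle {M : Type} [PseudoMetricSpace M] [PathConnectedSpace M] (x₀ : M)
    (hM : ∀ k, 2 ≤ k → ∀ x : M, Subsingleton (HomotopyGroup (Fin k) M x)) {n : ℕ}
    (h : Nontrivial (H (n + 1) M)) :
    ∃ (c : Ch (Deck x₀) →ₗ[ℚ] ℚ) (a : ℚ), a ≠ 0 ∧ (∀ g w, c (mp (g * ·) w) = c w) ∧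
      (∀ w, c (d w) = 0) ∧ (∀ l, l.length ≠ n + 2 → c (bas l) = 0) ∧
      (∀ l, ¬ l.Nodup → c (bas l) = 0) ∧
      ∀ r > 0, ∃ Z ∈ Supp (SmallList (x₀ := x₀) (n + 2) r),
        CycleMod (fun (g : Deck x₀) s => g • s) Z ∧
        ∀ ψ : Cov x₀ → Deck x₀, (∀ g s, ψ (g • s) = g * ψ s) → c (mp ψ Z) = a := by
  obtain ⟨z, μ, hz, hμ, hne⟩ := exists_cycle h
  refine ⟨(liftedComplex x₀ hM).cochain (liftFun x₀ μ) (n + 2), μ z, hne,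
    ContractibleComplex.cochain_mp _ (liftFun_lact μ) _,
    ContractibleComplex.cochain_d _ (liftFun_lbd μ hμ) _,
    fun l hl => ContractibleComplex.cochain_of_length_ne _ hl,
    fun l hl => ContractibleComplex.cochain_of_not_nodup _ hl, fun r hr => ?_⟩
  obtain ⟨m, hm⟩ := exists_small x₀ z hr
  have hw := lCycle_liftChain (x₀ := x₀) hz
  refine ⟨_, hm, hw.cycleMod (vertexMap_fineVertices x₀ m), fun ψ hψ => ?_⟩
  rw [cochain_vertexMap hM (vertexMap_fineVertices x₀ m) hψ (liftFun_lact μ) (liftFun_lbd μ hμ) hw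
    (proj_eq_of_mem_supp (supp_mono (fun l hl => hl.1) hm)), liftFun_liftChain]

theorem aug_d_eq_zero {S : Type*} {k : ℕ} {w : Ch S}
    (hw : w ∈ Supp fun l : List S => l.length = k + 2) : aug (d w) = 0 := by
  have := map_mem_of_supp (N := ⊥) (aug ∘ₗ d) (fun l hl => by
    rw [LinearMap.comp_apply, d_bas]
    refine map_mem_of_supp aug (fun l' hl' => ?_) (dl_mem_supp l)
    rw [Submodule.mem_bot, aug_bas, if_neg]
    rintro rfl
    simp only [List.length_nil] at hl'
    omega) hw
  exact this

theorem ev_sh {S T : Type*} (p : ℕ) (a : Ch S →ₗ[ℚ] ℚ) (b : Ch T →ₗ[ℚ] ℚ)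
    (ha : ∀ l : List S, ¬ l.Nodup → a (bas l) = 0) {Z : Ch S} {W : Ch T}
    (hZ : Z ∈ Supp fun l : List S => l.length = p + 1) (hW : W ∈ Supp fun l : List T => l ≠ []) :
    ev p (fun l => a (bas (l.map Prod.fst))) (fun l => b (bas (l.map Prod.snd))) (sh Z W)
      = a Z * b W := by
  set F := ev p (fun l => a (bas (l.map Prod.fst))) (fun l => b (bas (l.map Prod.snd)))
  have h1 : ∀ x : List S, x.length = p + 1 → F (sh (bas x) W) = a (bas x) * b W := fun x hx =>
    sub_eq_zero.1 (map_mem_of_supp (N := ⊥) (F ∘ₗ sh (bas x) - a (bas x) • b) (fun y hy => by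
      rw [Submodule.mem_bot, LinearMap.sub_apply, LinearMap.comp_apply, sh_bas,
        ev_shl p (fun l => a (bas l)) (fun l => b (bas l)) ha x y hx hy]
      simp) hW)
  have h2 := sub_eq_zero.1 (map_mem_of_supp (N := ⊥) (F ∘ₗ sh.flip W - b W • a) (fun x hx => by
    rw [Submodule.mem_bot, LinearMap.sub_apply, LinearMap.comp_apply, LinearMap.flip_apply, h1 x hx,
      LinearMap.smul_apply, smul_eq_mul, mul_comm, sub_self]) hZ)
  exact h2.trans (mul_comm _ _)

theorem sh_mem_supp {S T : Type*} {P : List S → Prop} {Q : List T → Prop} {Z : Ch S} {W : Ch T}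
    (hZ : Z ∈ Supp P) (hW : W ∈ Supp Q) :
    sh Z W ∈ Supp fun l => ∃ x y, P x ∧ Q y ∧ ∀ p ∈ l, p.1 ∈ x ∧ p.2 ∈ y := by
  refine map_mem_of_supp (sh.flip W) (fun x hx => ?_) hZ
  rw [LinearMap.flip_apply]
  refine map_mem_of_supp (sh _) (fun y hy => ?_) hW
  rw [sh_bas]
  exact supp_mono (fun l hl => ⟨x, y, hx, hy, hl⟩) (shl_mem_supp x y)

theorem not_exists_coherent_cover {M₁ M₂ : Type} [MetricSpace M₁] [MetricSpace M₂] [CompactSpace M₁]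
    [CompactSpace M₂] [PathConnectedSpace M₁] [PathConnectedSpace M₂] (x₁ : M₁) (x₂ : M₂)
    (h₁ : ∀ k, 2 ≤ k → ∀ x : M₁, Subsingleton (HomotopyGroup (Fin k) M₁ x))
    (h₂ : ∀ k, 2 ≤ k → ∀ x : M₂, Subsingleton (HomotopyGroup (Fin k) M₂ x)) {n : ℕ}
    (hH₁ : Nontrivial (H (n + 1) M₁)) (hH₂ : Nontrivial (H (n + 1) M₂))
    (A B : Fin (n + 1) → Set (M₁ × M₂)) (hA : ∀ i, IsOpen (A i)) (hB : ∀ i, IsOpen (B i))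
    (hcov : ∀ p, (∃ i, p ∈ A i) ∨ ∃ i, p ∈ B i)
    (γA : Fin (n + 1) → ∀ p, Path.Homotopic.Quotient x₁ (ContinuousMap.fst (α := M₁) (β := M₂) p))
    (γB : Fin (n + 1) → ∀ p, Path.Homotopic.Quotient x₂ (ContinuousMap.snd (α := M₁) (β := M₂) p))
    (hγA : ∀ i, Coherent _ (A i) (γA i)) (hγB : ∀ i, Coherent _ (B i) (γB i)) : False := by
  obtain ⟨c₁, a₁, ha₁, hi₁, hd₁, hl₁, hn₁, hs₁⟩ := exists_cocycle x₁ h₁ hH₁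
  obtain ⟨c₂, a₂, ha₂, hi₂, hd₂, hl₂, hn₂, hs₂⟩ := exists_cocycle x₂ h₂ hH₂
  obtain ⟨r, hr, hleb⟩ : ∃ r > 0, ∀ p, (∃ i, Metric.ball p (r + r) ⊆ A i) ∨
      ∃ i, Metric.ball p (r + r) ⊆ B i := by
    obtain ⟨δ, hδ, h⟩ := lebesgue_number_lemma_of_metric (c := Sum.elim A B)
      (isCompact_univ (X := M₁ × M₂)) (by rintro (i | i); exacts [hA i, hB i]) fun p _ => by
        rcases hcov p with ⟨i, hi⟩ | ⟨i, hi⟩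
        exacts [Set.mem_iUnion.2 ⟨Sum.inl i, hi⟩, Set.mem_iUnion.2 ⟨Sum.inr i, hi⟩]
    refine ⟨δ / 2, half_pos hδ, fun p => ?_⟩
    rw [add_halves]
    obtain ⟨i | i, hi⟩ := h p trivial
    exacts [Or.inl ⟨i, hi⟩, Or.inr ⟨i, hi⟩]
  obtain ⟨Z₁, hZ₁, hc₁, he₁⟩ := hs₁ r hr
  obtain ⟨Z₂, hZ₂, hc₂, he₂⟩ := hs₂ r hr
  let ψ₁ : Cov x₁ → Deck x₁ := fun s =>
    rel s (Path.Homotopic.Quotient.mk (PathConnectedSpace.somePath _ _))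
  let ψ₂ : Cov x₂ → Deck x₂ := fun s =>
    rel s (Path.Homotopic.Quotient.mk (PathConnectedSpace.somePath _ _))
  let Ψ : Cov x₁ × Cov x₂ → Deck x₁ × Deck x₂ := fun p =>
    (rel p.1 (colourClass _ A γA r (p.1.1, p.2.1)), rel p.2 (colourClass _ B γB r (p.1.1, p.2.1)))
  let F : Ch (Deck x₁ × Deck x₂) →ₗ[ℚ] ℚ := ev (n + 1) (fun l => c₁ (bas (l.map Prod.fst)))
    fun l => c₂ (bas (l.map Prod.snd))
  have hlen₁ := supp_mono (fun l hl => hl.1) hZ₁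
  have hlen₂ := supp_mono (Q := fun l : List (Cov x₂) => l ≠ [])
    (fun l hl h0 => by simpa [h0] using hl.1) hZ₂
  have hZ := CycleMod.sh hc₁ hc₂ (aug_d_eq_zero hlen₁) (e := 1) (e' := 1) (fun s => one_smul _ s)
    fun s => one_smul _ s
  have hFi : IsInv (fun (g : Deck x₁ × Deck x₂) (p : Deck x₁ × Deck x₂) =>
      (g.1 * p.1, g.2 * p.2)) F := fun g w => by
    refine congrArg (fun f => f w) (lin_ext (f := F ∘ₗ mp _) (g := F) fun l => ?_)
    rw [LinearMap.comp_apply, mp_bas]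
    simp only [F, ev_bas, ← List.map_take, ← List.map_drop, List.map_map]
    rw [← hi₁ g.1 (bas (List.map Prod.fst _)), ← hi₂ g.2 (bas (List.map Prod.snd _)), mp_bas,
      mp_bas, List.map_map, List.map_map]
    rfl
  have hext₁ : ext (fun l : List (Deck x₁ × Deck x₂) => c₁ (bas (l.map Prod.fst))) =
      c₁ ∘ₗ mp Prod.fst :=
    lin_ext fun l => by rw [ext_bas, LinearMap.comp_apply, mp_bas]
  have hext₂ : ext (fun l : List (Deck x₁ × Deck x₂) => c₂ (bas (l.map Prod.snd))) =
      c₂ ∘ₗ mp Prod.snd :=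
    lin_ext fun l => by rw [ext_bas, LinearMap.comp_apply, mp_bas]
  have hFd : ∀ w, F (d w) = 0 := ev_d_eq_zero _ _ _
    (fun w => by rw [hext₁, LinearMap.comp_apply, ← d_mp, hd₁])
    (fun w => by rw [hext₂, LinearMap.comp_apply, ← d_mp, hd₂])
    fun l hl => hl₁ _ (by rwa [List.length_map])
  have key := eval_mp_eq (f := Prod.map ψ₁ ψ₂) (g := Ψ) (F := F) (Z := sh Z₁ Z₂)
    (trS := fun (g : Deck x₁ × Deck x₂) (p : Cov x₁ × Cov x₂) => (g.1 • p.1, g.2 • p.2))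
    (trT := fun (g : Deck x₁ × Deck x₂) (p : Deck x₁ × Deck x₂) => (g.1 * p.1, g.2 * p.2))
    (fun g s => Prod.ext (rel_smul g.1 s.1 _) (rel_smul g.2 s.2 _))
    (fun g s => Prod.ext (rel_smul g.1 s.1 _) (rel_smul g.2 s.2 _)) hFi hFd hZ
  have hlen₁' : mp ψ₁ Z₁ ∈ Supp fun l : List (Deck x₁) => l.length = n + 1 + 1 :=
    map_mem_of_supp _ (fun l hl => by
      rw [mp_bas]; exact bas_mem_supp (by simpa using hl)) hlen₁
  have hlen₂' : mp ψ₂ Z₂ ∈ Supp fun l : List (Deck x₂) => l ≠ [] :=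
    map_mem_of_supp _ (fun l hl => by
      rw [mp_bas]; exact bas_mem_supp (by simpa using hl)) hlen₂
  rw [mp_sh, ev_sh _ _ _ hn₁ hlen₁' hlen₂', he₁ _ fun g s => rel_smul _ _ _,
    he₂ _ fun g s => rel_smul _ _ _] at key
  refine mul_ne_zero ha₁ ha₂ (key.trans ?_)
  refine map_mem_of_supp (N := ⊥) (F ∘ₗ mp Ψ) (fun L hL => ?_) (sh_mem_supp hZ₁ hZ₂)
  obtain ⟨x, y, hx, hy, hxy⟩ := hL
  rw [Submodule.mem_bot, LinearMap.comp_apply, mp_bas, ev_bas]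
  have hpath : ∀ e ∈ L, ∀ e' ∈ L, ∃ (ρ : Path e.1.1 e'.1.1) (ρ' : Path e.2.1 e'.2.1),
      (∀ t, (ρ t, ρ' t) ∈ Metric.ball (e.1.1, e.2.1) r) ∧
      e'.1.2 = e.1.2.trans (Path.Homotopic.Quotient.mk ρ) ∧
      e'.2.2 = e.2.2.trans (Path.Homotopic.Quotient.mk ρ') := fun e he e' he' => by
    obtain ⟨ρ, h1, h2⟩ := hx.exists_path (hxy e he).1 (hxy e' he').1
    obtain ⟨ρ', h1', h2'⟩ := hy.exists_path (hxy e he).2 (hxy e' he').2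
    exact ⟨ρ, ρ', fun t => by
      rw [Metric.mem_ball, Prod.dist_eq]; exact max_lt (h1 t) (h1' t), h2, h2'⟩
  have hball : ∀ e₀ ∈ L, ∀ e ∈ L, Metric.ball (e.1.1, e.2.1) r ⊆
      Metric.ball (e₀.1.1, e₀.2.1) (r + r) := fun e₀ h₀ e he => by
    obtain ⟨ρ, ρ', h, -⟩ := hpath e₀ h₀ e he
    have := Metric.mem_ball.1 (h 1)
    rw [ρ.target, ρ'.target] at this
    exact Metric.ball_subset_ball' (by linarith)
  by_cases hL1 : (L.take (n + 1 + 1)).length = n + 2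
  swap
  · rw [hl₁ _ (by simpa using hL1), zero_mul]
  by_cases hL2 : (L.drop (n + 1)).length = n + 2
  swap
  · rw [hl₂ _ (by simpa using hL2), mul_zero]
  obtain ⟨e₀, h₀⟩ : ∃ e₀, e₀ ∈ L := List.exists_mem_of_length_pos (by
    rw [List.length_take] at hL1; omega)
  rcases hleb (e₀.1.1, e₀.2.1) with ⟨i, hi⟩ | ⟨i, hi⟩
  · have := not_nodup_rel (r := r) hγA (fun e : Cov x₁ × Cov x₂ => (e.1.1, e.2.1)) (fun e => e.1.2)
      (L.take (n + 1 + 1)) (by rw [hL1]; simp)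
      (fun e he => ⟨i, (hball e₀ h₀ e (List.mem_of_mem_take he)).trans hi⟩)
      (fun e he e' he' => by
        obtain ⟨ρ, ρ', h, h1, -⟩ := hpath e (List.mem_of_mem_take he) e' (List.mem_of_mem_take he')
        exact ⟨ρ.prod ρ', h, h1⟩)
    rw [hn₁ _ (by rw [← List.map_take, List.map_map]; exact this), zero_mul]
  · have := not_nodup_rel (r := r) hγB (fun e : Cov x₁ × Cov x₂ => (e.1.1, e.2.1)) (fun e => e.2.2)
      (L.drop (n + 1)) (by rw [hL2]; simp)
      (fun e he => ⟨i, (hball e₀ h₀ e (List.mem_of_mem_drop he)).trans hi⟩)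
      (fun e he e' he' => by
        obtain ⟨ρ, ρ', h, -, h1⟩ := hpath e (List.mem_of_mem_drop he) e' (List.mem_of_mem_drop he')
        exact ⟨ρ.prod ρ', h, h1⟩)
    rw [hn₂ _ (by rw [← List.map_drop, List.map_map]; exact this), mul_zero]

end TCSum

namespace TCSum

/-! ### Coherent families of path classes -/

/-- The tautological path in the unit interval. -/
def idPath : Path (0 : I) 1 := ⟨ContinuousMap.id I, rfl, rfl⟩

theorem mk_trans_eq_of_square {M : Type*} [TopologicalSpace M] (K : C(I × I, M)) {a b c e : M}
    (p : Path a b) (q : Path b e) (p' : Path a c) (q' : Path c e) (hp : ∀ t, p t = K (t, 0))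
    (hq : ∀ t, q t = K (1, t)) (hp' : ∀ t, p' t = K (0, t)) (hq' : ∀ t, q' t = K (t, 1)) :
    (Path.Homotopic.Quotient.mk p).trans (Path.Homotopic.Quotient.mk q) =
      (Path.Homotopic.Quotient.mk p').trans (Path.Homotopic.Quotient.mk q') := by
  obtain rfl : K (0, 0) = a := by rw [← hp, p.source]
  obtain rfl : K (1, 0) = b := by rw [← hp, p.target]
  obtain rfl : K (0, 1) = c := by rw [← hp', p'.target]
  obtain rfl : K (1, 1) = e := by rw [← hq, q.target]
  have e1 : p = (idPath.prod (Path.refl (0 : I))).map K.continuous := by ext t; exact hp t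
  have e2 : q = ((Path.refl (1 : I)).prod idPath).map K.continuous := by ext t; exact hq t
  have e3 : p' = ((Path.refl (0 : I)).prod idPath).map K.continuous := by ext t; exact hp' t
  have e4 : q' = (idPath.prod (Path.refl (1 : I))).map K.continuous := by ext t; exact hq' t
  rw [e1, e2, e3, e4, ← Path.Homotopic.Quotient.mk_trans, ← Path.Homotopic.Quotient.mk_trans,
    ← Path.map_trans, ← Path.map_trans]
  have : ContractibleSpace I := (convex_Icc (0 : ℝ) 1).contractibleSpace ⟨0, by simp⟩
  exact Path.Homotopic.Quotient.eq.2 ((SimplyConnectedSpace.paths_homotopic _ _).map K)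

theorem Coherent.comap {P M : Type*} [TopologicalSpace P] [TopologicalSpace M] {x₀ : M} {R : Set M}
    {β : ∀ a, Path.Homotopic.Quotient x₀ a}
    (hβ : Coherent (ContinuousMap.id M) R β) (π : C(P, M)) :
    Coherent π (π ⁻¹' R) fun p => β (π p) := fun _ _ ρ hρ =>
  hβ _ _ (ρ.map π.continuous) hρ

section

variable {P M E : Type*} [TopologicalSpace P] [TopologicalSpace M] [TopologicalSpace E]
  [PathConnectedSpace M]

theorem exists_coherent_range [SimplyConnectedSpace E] (x₀ : M) {φ : E → M} (hφ : IsEmbedding φ) :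
    ∃ β : ∀ a, Path.Homotopic.Quotient x₀ a,
      Coherent (ContinuousMap.id M) (Set.range φ) β := by
  obtain ⟨e₀⟩ : Nonempty E := inferInstance
  obtain ⟨ℓ, ⟨hc, hℓ⟩, hb, -⟩ := exists_lift (x₀ := x₀) ⟨φ, hφ.continuous⟩ e₀
    (Path.Homotopic.Quotient.mk (PathConnectedSpace.somePath _ _))
  have hex : ∀ a, ∃ q : Path.Homotopic.Quotient x₀ a, ∀ e, φ e = a → ℓ e = ⟨a, q⟩ := fun a => by
    by_cases h : ∃ e, φ e = a
    · obtain ⟨e, rfl⟩ := h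
      rw [show φ e = (ℓ e).1 from (hb e).symm]
      refine ⟨(ℓ e).2, fun e' he' => ?_⟩
      rw [hφ.injective (he'.trans (hb e))]
    · exact ⟨Path.Homotopic.Quotient.mk (PathConnectedSpace.somePath _ _),
        fun e he => (h ⟨e, he⟩).elim⟩
  choose β hβ using hex
  obtain rfl : ℓ = fun e => ⟨φ e, β (φ e)⟩ := funext fun e => hβ _ e rfl
  refine ⟨β, fun a b ρ hρ => ?_⟩
  obtain ⟨u, rfl⟩ : a ∈ Set.range φ := by simpa using hρ 0
  obtain ⟨v, rfl⟩ : b ∈ Set.range φ := by simpa using hρ 1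
  let ρ' : Path u v :=
    { toFun := fun t => hφ.toHomeomorph.symm ⟨ρ t, hρ t⟩
      continuous_toFun := by fun_prop
      source' := by
        rw [Homeomorph.symm_apply_eq]; exact Subtype.ext ρ.source
      target' := by
        rw [Homeomorph.symm_apply_eq]; exact Subtype.ext ρ.target }
  have h := hℓ u v ρ'
  have e1 : ρ'.map hc = ρ.map (ContinuousMap.id M).continuous := by
    ext t
    exact congrArg Subtype.val (hφ.toHomeomorph.apply_symm_apply ⟨ρ t, hρ t⟩)
  rw [e1] at h
  exact h

theorem exists_coherent_of_homotopy {x₀ : M} {R : Set M} {β : ∀ a, Path.Homotopic.Quotient x₀ a}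
    (hβ : Coherent (ContinuousMap.id M) R β) (π : C(P, M)) (A : Set P) (G : C(A × I, M))
    (h0 : ∀ q : A, G (q, 0) = π q) (h1 : ∀ q, G (q, 1) ∈ R) :
    ∃ γ : ∀ p, Path.Homotopic.Quotient x₀ (π p), Coherent π A γ := by
  let g : ∀ q : A, Path (π q) (G (q, 1)) := fun q =>
    { toFun := fun t => G (q, t)
      continuous_toFun := by fun_prop
      source' := h0 q
      target' := rfl }
  have hex : ∀ p, ∃ c : Path.Homotopic.Quotient x₀ (π p), ∀ hp : p ∈ A,
      β (G (⟨p, hp⟩, 1)) = c.trans (Path.Homotopic.Quotient.mk (g ⟨p, hp⟩)) := fun p => by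
    by_cases hp : p ∈ A
    · refine ⟨(β (G (⟨p, hp⟩, 1))).trans (Path.Homotopic.Quotient.mk (g ⟨p, hp⟩)).symm,
        fun _ => ?_⟩
      rw [Path.Homotopic.Quotient.trans_assoc]
      simp
    · exact ⟨Path.Homotopic.Quotient.mk (PathConnectedSpace.somePath _ _), fun h => (hp h).elim⟩
  choose γ hγ using hex
  refine ⟨γ, fun p q ρ hρ => ?_⟩
  have hp : p ∈ A := by simpa using hρ 0
  have hq : q ∈ A := by simpa using hρ 1
  let ρ' : Path (G (⟨p, hp⟩, 1)) (G (⟨q, hq⟩, 1)) :=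
    { toFun := fun t => G (⟨ρ t, hρ t⟩, 1)
      continuous_toFun := by fun_prop
      source' := by simp
      target' := by simp }
  have hβ' := hβ _ _ ρ' fun t => h1 _
  have hsq := mk_trans_eq_of_square
    (⟨fun u => G (⟨ρ u.1, hρ u.1⟩, u.2), by fun_prop⟩ : C(I × I, M)) (ρ.map π.continuous)
    (g ⟨q, hq⟩) (g ⟨p, hp⟩) ρ' (fun t => (h0 ⟨ρ t, hρ t⟩).symm) (fun t => by simp [g])
    (fun t => by simp [g]) (fun t => rfl)
  have e1 : ρ'.map (ContinuousMap.id M).continuous = ρ' := rfl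
  have hc : (γ q).trans (Path.Homotopic.Quotient.mk (g ⟨q, hq⟩)) =
      ((γ p).trans (Path.Homotopic.Quotient.mk (ρ.map π.continuous))).trans
        (Path.Homotopic.Quotient.mk (g ⟨q, hq⟩)) := by
    rw [Path.Homotopic.Quotient.trans_assoc, hsq, ← Path.Homotopic.Quotient.trans_assoc, ← hγ, ← hγ,
      hβ']
    rfl
  have := congrArg (fun c => c.trans (Path.Homotopic.Quotient.mk (g ⟨q, hq⟩)).symm) hc
  simpa only [Path.Homotopic.Quotient.trans_assoc, Path.Homotopic.Quotient.trans_symm,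
    Path.Homotopic.Quotient.trans_refl] using this

theorem coherent_empty (x₀ : M) (π : C(P, M)) :
    ∃ γ : ∀ p, Path.Homotopic.Quotient x₀ (π p), Coherent π ∅ γ :=
  ⟨fun _ => Path.Homotopic.Quotient.mk (PathConnectedSpace.somePath _ _),
    fun _ _ _ h => (h 0).elim⟩

end

end TCSum

namespace TCSum

/-! ### Pinch maps -/

theorem exists_pinch {N M : Type} {n : ℕ} [TopologicalSpace N] [TopologicalSpace M]
    {φ : EuclideanSpace ℝ (Fin n) → M} (hφ : IsOpenEmbedding φ) {C C' : Set N} (hC : IsClosed C)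
    (hC' : IsClosed C') (hcov : C ∪ C' = Set.univ)
    (h : C ≃ₜ ((φ '' Metric.ball 0 1)ᶜ : Set M))
    (hsph : ∀ x : C, (x : N) ∈ C' → (h x : M) ∈ φ '' Metric.sphere 0 1) [NormalSpace C'] :
    ∃ p : C(N, M), (∀ x : C, p x = h x) ∧ ∀ x ∈ C', p x ∈ Set.range φ := by
  classical
  let D : Set C' := Subtype.val ⁻¹' C
  have hD : IsClosed D := hC.preimage continuous_subtype_val
  have hr : ∀ x : D, (h ⟨x.1.1, x.2⟩ : M) ∈ Set.range φ := fun x =>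
    Set.image_subset_range _ _ (hsph ⟨x.1.1, x.2⟩ x.1.2)
  let f : C(D, EuclideanSpace ℝ (Fin n)) :=
    ⟨fun x => hφ.isEmbedding.toHomeomorph.symm ⟨h ⟨x.1.1, x.2⟩, hr x⟩, by fun_prop⟩
  obtain ⟨g, hg⟩ := f.exists_restrict_eq hD
  have hfg : ∀ x : D, φ (g x.1) = h ⟨x.1.1, x.2⟩ := fun x => by
    have : g x.1 = f x := congrArg (fun k => k x) hg
    rw [this]
    exact congrArg Subtype.val (hφ.isEmbedding.toHomeomorph.apply_symm_apply ⟨_, hr x⟩)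
  let p : N → M := fun x => if hx : x ∈ C then h ⟨x, hx⟩ else
    φ (g ⟨x, (hcov.ge (Set.mem_univ x)).resolve_left hx⟩)
  have hp : ∀ x : C, p x = h x := fun x => dif_pos x.2
  have hp' : ∀ x : C', p x = φ (g x) := fun x => by
    by_cases hx : (x : N) ∈ C
    · rw [hfg ⟨x, hx⟩]; exact dif_pos hx
    · exact dif_neg hx
  have hcont : Continuous p := by
    rw [← continuousOn_univ, ← hcov]
    refine ContinuousOn.union_of_isClosed ?_ ?_ hC hC'
    · rw [continuousOn_iff_continuous_domRestrict]
      have : C.domRestrict p = fun x => (h x : M) := funext hp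
      rw [this]; fun_prop
    · rw [continuousOn_iff_continuous_domRestrict]
      have : C'.domRestrict p = fun x => φ (g x) := funext hp'
      rw [this]; exact hφ.continuous.comp g.continuous
  exact ⟨⟨p, hcont⟩, hp, fun x hx => ⟨_, (hp' ⟨x, hx⟩).symm⟩⟩

theorem pathConnectedSpace_of_isLocallyEuclidean {n : ℕ} {M : Type} [TopologicalSpace M]
    [ConnectedSpace M] (h : IsLocallyEuclidean n M) : PathConnectedSpace M := by
  have hj : ∀ x : M, ∃ U, x ∈ U ∧ IsOpen U ∧ ∀ y ∈ U, Joined x y := fun x => by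
    obtain ⟨U, hx, hU, ⟨e⟩⟩ := h x
    refine ⟨U, hx, hU, fun y hy => ?_⟩
    obtain ⟨γ⟩ := PathConnectedSpace.joined (e ⟨x, hx⟩) (e ⟨y, hy⟩)
    exact ⟨(γ.map (continuous_subtype_val.comp e.symm.continuous)).cast (by simp) (by simp)⟩
  obtain ⟨x₀⟩ : Nonempty M := inferInstance
  have hopen : ∀ x : M, IsOpen (pathComponent x) := fun x =>
    isOpen_iff_forall_mem_open.2 fun y hy => by
      obtain ⟨U, h1, h2, h3⟩ := hj y
      exact ⟨U, fun z hz => Joined.trans hy (h3 z hz), h2, h1⟩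
  have hclosed : IsClosed (pathComponent x₀) := ⟨isOpen_iff_forall_mem_open.2 fun y hy =>
    ⟨pathComponent y, fun z hz hz' => hy (Joined.trans hz' (Joined.symm hz)), hopen y,
      mem_pathComponent_self y⟩⟩
  have huniv := IsClopen.eq_univ ⟨hclosed, hopen x₀⟩ ⟨x₀, mem_pathComponent_self x₀⟩
  have hx : ∀ x, Joined x₀ x := fun x => huniv.ge (Set.mem_univ x)
  exact ⟨⟨x₀⟩, fun x y => (hx x).symm.trans (hx y)⟩

end TCSum

namespace TCSum

/-! ### Reduction to coherent covers -/

theorem exists_coherent_of_section {P N M : Type} [TopologicalSpace P] [TopologicalSpace N]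
    [TopologicalSpace M] [PathConnectedSpace M] {x₀ : M} {R : Set M}
    {β : ∀ a, Path.Homotopic.Quotient x₀ a} (hβ : Coherent (ContinuousMap.id M) R β) (π : C(P, M))
    (p : C(N, M)) {W : Set P} (f : C(W, N × N)) {U : Set (N × N)} (s : C(U, C(I, N))) (e : C(I, I))
    (h0 : ∀ (q : W) (h : f q ∈ U), p (s ⟨f q, h⟩ (e 0)) = π q)
    (h1 : ∀ (q : W) (h : f q ∈ U), p (s ⟨f q, h⟩ (e 1)) ∈ R) :
    ∃ γ : ∀ p, Path.Homotopic.Quotient x₀ (π p), Coherent π (Subtype.val '' (f ⁻¹' U)) γ := by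
  have hW : ∀ q : (Subtype.val '' (f ⁻¹' U) : Set P), ∃ h : q.1 ∈ W, f ⟨q.1, h⟩ ∈ U := by
    rintro ⟨_, q, hq, rfl⟩
    exact ⟨q.2, hq⟩
  choose hW hU using hW
  exact exists_coherent_of_homotopy hβ π _
    ⟨fun q => p (s ⟨f ⟨q.1.1, hW q.1⟩, hU q.1⟩ (e q.2)),
      p.continuous.comp (Continuous.eval (by fun_prop) (by fun_prop))⟩
    (fun q => h0 ⟨q.1, hW q⟩ (hU q)) fun q => h1 ⟨q.1, hW q⟩ (hU q)

/-- The compact complement of an open ball is normal. -/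
theorem normalSpace_piece {N M : Type} {n : ℕ} [TopologicalSpace N] [TopologicalSpace M]
    [CompactSpace M] [T2Space M] {φ : EuclideanSpace ℝ (Fin n) → M} (hφ : IsOpenEmbedding φ)
    {C : Set N} (h : C ≃ₜ ((φ '' Metric.ball 0 1)ᶜ : Set M)) : NormalSpace C := by
  have hc : IsClosed (φ '' Metric.ball 0 1)ᶜ := (hφ.isOpenMap _ Metric.isOpen_ball).isClosed_compl
  have : CompactSpace ((φ '' Metric.ball 0 1)ᶜ : Set M) := isCompact_iff_compactSpace.1 hc.isCompact
  exact h.isClosedEmbedding.normalSpace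

theorem not_tcCoverable {n m : ℕ} (hn : 3 ≤ n) (hm : m ≤ 6) {M₁ M₂ N : Type} [TopologicalSpace M₁]
    [TopologicalSpace M₂] [TopologicalSpace N] (hM₁ : IsClosedOrientedManifold (n + 1) M₁)
    (hM₂ : IsClosedOrientedManifold (n + 1) M₂) (ha₁ : Aspherical M₁) (ha₂ : Aspherical M₂)
    (D : ConnectedSumData (n + 1) N M₁ M₂) : ¬ TCCoverable N m := by
  rintro ⟨U, hUo, hUc, hUs⟩
  obtain ⟨_, _, _, _, hl₁, hH₁⟩ := hM₁
  obtain ⟨_, _, _, _, hl₂, hH₂⟩ := hM₂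
  have := pathConnectedSpace_of_isLocallyEuclidean hl₁
  have := pathConnectedSpace_of_isLocallyEuclidean hl₂
  obtain ⟨x₁⟩ : Nonempty M₁ := inferInstance
  obtain ⟨x₂⟩ : Nonempty M₂ := inferInstance
  have := normalSpace_piece D.emb₁ D.h₁
  have := normalSpace_piece D.emb₂ D.h₂
  obtain ⟨p₁, hp₁, hr₁⟩ := exists_pinch D.emb₁ D.closed₁ D.closed₂ D.cover D.h₁
    fun x => (D.inter₁ x).1
  obtain ⟨p₂, hp₂, hr₂⟩ := exists_pinch D.emb₂ D.closed₂ D.closed₁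
    ((Set.union_comm _ _).trans D.cover) D.h₂ fun x => (D.inter₂ x).1
  obtain ⟨β₁, hβ₁⟩ := exists_coherent_range x₁ D.emb₁.isEmbedding
  obtain ⟨β₂, hβ₂⟩ := exists_coherent_range x₂ D.emb₂.isEmbedding
  let W : Set (M₁ × M₂) := (D.φ₁ '' Metric.closedBall 0 1)ᶜ ×ˢ (D.φ₂ '' Metric.closedBall 0 1)ᶜ
  have hWo : IsOpen W :=
    ((isCompact_closedBall _ _).image D.emb₁.continuous).isClosed.isOpen_compl.prod
      ((isCompact_closedBall _ _).image D.emb₂.continuous).isClosed.isOpen_compl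
  have hW₁ : ∀ q : W, q.1.1 ∈ (D.φ₁ '' Metric.ball 0 1)ᶜ := fun q h =>
    q.2.1 (Set.image_mono Metric.ball_subset_closedBall h)
  have hW₂ : ∀ q : W, q.1.2 ∈ (D.φ₂ '' Metric.ball 0 1)ᶜ := fun q h =>
    q.2.2 (Set.image_mono Metric.ball_subset_closedBall h)
  let f : C(W, N × N) := ⟨fun q => (D.h₁.symm ⟨q.1.1, hW₁ q⟩, D.h₂.symm ⟨q.1.2, hW₂ q⟩), by fun_prop⟩
  have hf₁ : ∀ q, p₁ (f q).1 = q.1.1 := fun q => by simp [f, hp₁]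
  have hf₂ : ∀ q, p₂ (f q).2 = q.1.2 := fun q => by simp [f, hp₂]
  let A : ℕ → Set (M₁ × M₂) := fun k =>
    if h : k < m then Subtype.val '' (f ⁻¹' (U ⟨k, h⟩)) else ∅
  have hAo : ∀ k, IsOpen (A k) := fun k => by
    by_cases h : k < m
    · simp only [A, dif_pos h]
      exact hWo.isOpenMap_subtype_val _ ((hUo _).preimage f.continuous)
    · simp only [A, dif_neg h, isOpen_empty]
  have hA₁ : ∀ k, ∃ γ : ∀ p, Path.Homotopic.Quotient x₁ (ContinuousMap.fst (α := M₁) (β := M₂) p),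
      Coherent _ (A k) γ := fun k => by
    by_cases h : k < m
    · simp only [A, dif_pos h]
      obtain ⟨s, hs⟩ := hUs ⟨k, h⟩
      exact exists_coherent_of_section hβ₁ _ p₁ f s (ContinuousMap.id I)
        (fun q hq => (congrArg p₁ (hs _).1).trans (hf₁ q)) fun q hq => by
          rw [ContinuousMap.id_apply, (hs _).2]
          exact hr₁ _ (Subtype.prop _)
    · simp only [A, dif_neg h]
      exact coherent_empty _ _
  have hA₂ : ∀ k, ∃ γ : ∀ p, Path.Homotopic.Quotient x₂ (ContinuousMap.snd (α := M₁) (β := M₂) p),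
      Coherent _ (A k) γ := fun k => by
    by_cases h : k < m
    · simp only [A, dif_pos h]
      obtain ⟨s, hs⟩ := hUs ⟨k, h⟩
      exact exists_coherent_of_section hβ₂ _ p₂ f s ⟨unitInterval.symm, by fun_prop⟩
        (fun q hq => by
          change p₂ (s _ (unitInterval.symm 0)) = _
          rw [symm_zero, (hs _).2]
          exact hf₂ q) fun q hq => by
          change p₂ (s _ (unitInterval.symm 1)) ∈ _
          rw [symm_one, (hs _).1]
          exact hr₂ _ (Subtype.prop _)
    · simp only [A, dif_neg h]
      exact coherent_empty _ _
  choose γ₁ hγ₁ using hA₁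
  choose γ₂ hγ₂ using hA₂
  let := TopologicalSpace.metrizableSpaceMetric M₁
  let := TopologicalSpace.metrizableSpaceMetric M₂
  refine not_exists_coherent_cover x₁ x₂ ha₁ ha₂ hH₁ hH₂
    (Fin.cons (Prod.fst ⁻¹' Set.range D.φ₁) fun j => A j)
    (Fin.cons (Prod.snd ⁻¹' Set.range D.φ₂) fun j => A (j + 3)) ?_ ?_ ?_
    (Fin.cons (fun p => β₁ p.1) fun j => γ₁ j) (Fin.cons (fun p => β₂ p.2) fun j => γ₂ (j + 3)) ?_ ?_
  · exact Fin.cases (D.emb₁.isOpen_range.preimage continuous_fst) fun j => hAo j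
  · exact Fin.cases (D.emb₂.isOpen_range.preimage continuous_snd) fun j => hAo (j + 3)
  · intro q
    by_cases h1 : q.1 ∈ D.φ₁ '' Metric.closedBall 0 1
    · exact Or.inl ⟨0, Set.image_subset_range _ _ h1⟩
    by_cases h2 : q.2 ∈ D.φ₂ '' Metric.closedBall 0 1
    · exact Or.inr ⟨0, Set.image_subset_range _ _ h2⟩
    obtain ⟨k, hk⟩ := Set.mem_iUnion.1 (hUc.ge (Set.mem_univ (f ⟨q, h1, h2⟩)))
    have hq : q ∈ A k := by
      simp only [A, dif_pos k.2]
      exact ⟨⟨q, h1, h2⟩, hk, rfl⟩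
    have hk6 := k.2
    rcases lt_or_ge (k : ℕ) 3 with h | h
    · exact Or.inl ⟨Fin.succ ⟨k, by omega⟩, hq⟩
    · refine Or.inr ⟨Fin.succ ⟨k - 3, by omega⟩, ?_⟩
      change q ∈ A (k - 3 + 3)
      rwa [Nat.sub_add_cancel h]
  · exact Fin.cases (hβ₁.comap ContinuousMap.fst) fun j => hγ₁ j
  · exact Fin.cases (hβ₂.comap ContinuousMap.snd) fun j => hγ₂ (j + 3)

end TCSum

/-- **Corollary.**  Let `M₁, M₂` be closed oriented aspherical `n`-manifolds, `n ≥ 4`,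
with `H₂(Mⱼ; ℚ) ≠ 0` for `j = 1, 2`.  Then `TC(M₁ # M₂) ≥ 6` if `n` is odd, and
`TC(M₁ # M₂) ≥ 7` if `n` is even. -/
theorem tc_connectedSum_aspherical_lower_bound
    (n : ℕ) (hn : 4 ≤ n) (M₁ M₂ N : Type)
    [TopologicalSpace M₁] [TopologicalSpace M₂] [TopologicalSpace N]
    (hM₁ : IsClosedOrientedManifold n M₁) (hM₂ : IsClosedOrientedManifold n M₂)
    (ha₁ : Aspherical M₁) (ha₂ : Aspherical M₂)
    (hH₁ : Nontrivial (H 2 M₁)) (hH₂ : Nontrivial (H 2 M₂))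
    (hN : IsConnectedSum n N M₁ M₂) :
    (Odd n → 6 ≤ topologicalComplexity N) ∧ (Even n → 7 ≤ topologicalComplexity N) := by
  have h7 : 7 ≤ topologicalComplexity N := by
    obtain ⟨n, rfl⟩ : ∃ k, n = k + 1 := ⟨n - 1, by omega⟩
    obtain ⟨D⟩ := hN
    refine le_sInf ?_
    rintro _ ⟨m, rfl, hm⟩
    by_contra h
    have hm6 : m < 7 := by exact_mod_cast not_le.1 h
    exact TCSum.not_tcCoverable (by omega) (by omega) hM₁ hM₂ ha₁ ha₂ D hm
  exact ⟨fun _ => le_trans (by norm_num) h7, fun _ => h7⟩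

end
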